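/- Let Ω ⊆ ℝⁿ be a connected open set, let F, G : ℝⁿ × ℝ → ℝ satisfy 0 < λ ≤ F ≤ Λ, 0 < λ ≤ G ≤ Λ and be locally Lipschitz, and let f : Ω → ℝ satisfy λ·Σ_{i=1}^m |P_i(x)|^{α_i} ≤ f(x) ≤ Λ·Σ_{i=1}^m |P_i(x)|^{α_i}, where P_1, …, P_m are real polynomials on ℝⁿ and α_i ≥ 0. Let u ≥ v be convex functions on Ω that are both generalized (Aleksandrov) solutions of det D²w = f(x)·F(x,w)/G(∇w, w*∘∇w) on Ω. Then on each connected component of Ω ∖ (Σ_u ∩ Σ_v), either u ≡ v or u > v everywhere on that component. -/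

import Mathlib

open MeasureTheory Set
open scoped RealInnerProductSpace ENNReal

noncomputable section

abbrev En (n : ℕ) := EuclideanSpace ℝ (Fin n)

/-- The subgradient of `u` (as a convex function on `Ω`) at `x`. -/
def subgrad {n : ℕ} (Ω : Set (En n)) (u : En n → ℝ) (x : En n) : Set (En n) :=
  {p | ∀ y ∈ Ω, u x + ⟪p, y - x⟫ ≤ u y}

/-- The Monge–Ampère measure of `u` on a set `s`. -/
def MAm {n : ℕ} (Ω : Set (En n)) (u : En n → ℝ) (s : Set (En n)) : ℝ≥0∞ :=
  volume (⋃ x ∈ s, subgrad Ω u x)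

/-- `x₀` is a strictly convex point of `u` on `Ω`. -/
def IsStrictConvexPt {n : ℕ} (Ω : Set (En n)) (u : En n → ℝ) (x₀ : En n) : Prop :=
  ∀ x ∈ Ω, x ≠ x₀ → u ((1/2 : ℝ) • (x + x₀)) < (u x + u x₀) / 2

/-- `Σ_u`: the set of non-strictly convex points of `u` in `Ω`. -/
def SigmaSet {n : ℕ} (Ω : Set (En n)) (u : En n → ℝ) : Set (En n) :=
  {x ∈ Ω | ¬ IsStrictConvexPt Ω u x}

/-- The Legendre transform of `u` (as a function on `Ω`). -/
def legendreT {n : ℕ} (Ω : Set (En n)) (u : En n → ℝ) (p : En n) : ℝ :=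
  sSup ((fun x => ⟪x, p⟫ - u x) '' Ω)

/-- `w` is a generalized (Aleksandrov) solution of
`det D²w = f(x) · F(x, w) / G(∇w, w* ∘ ∇w)` on `Ω`. -/
def IsGenSol {n : ℕ} (Ω : Set (En n)) (f : En n → ℝ) (F G : En n × ℝ → ℝ)
    (w : En n → ℝ) : Prop :=
  ∀ s : Set (En n), s ⊆ Ω → MeasurableSet s →
    MAm Ω w s = ∫⁻ x in s, ENNReal.ofReal
      (f x * F (x, w x) / G (gradient w x, legendreT Ω w (gradient w x)))

section Subgradients
open Topology Filter

variable {n : ℕ} {Ω : Set (En n)} {u : En n → ℝ}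

lemma subgrad_nonempty (hΩ : IsOpen Ω) (hu : ConvexOn ℝ Ω u) {x : En n} (hx : x ∈ Ω) :
    (subgrad Ω u x).Nonempty := by
  have hcont := hu.continuousOn hΩ
  set s : Set (En n × ℝ) := {q | q.1 ∈ Ω ∧ u q.1 < q.2} with hs
  have hsc : Convex ℝ s := hu.convex_strict_epigraph
  have hso : IsOpen s := by
    rw [isOpen_iff_mem_nhds]
    rintro ⟨y, t⟩ ⟨hy, hyt⟩
    have h1 : ContinuousAt u y := hcont.continuousAt (hΩ.mem_nhds hy)
    have h2 : ∀ᶠ q : En n × ℝ in 𝓝 (y, t), q.1 ∈ Ω :=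
      continuousAt_fst.eventually (hΩ.mem_nhds hy)
    have h3 : ∀ᶠ q : En n × ℝ in 𝓝 (y, t), u q.1 < q.2 := by
      have ha : ContinuousAt (fun q : En n × ℝ => u q.1) (y, t) :=
        ContinuousAt.comp (f := Prod.fst) (g := u) h1 continuousAt_fst
      exact ha.eventually_lt continuousAt_snd hyt
    filter_upwards [h2, h3] with q hq1 hq2 using ⟨hq1, hq2⟩
  have hns : (x, u x) ∉ s := fun h => lt_irrefl _ h.2
  obtain ⟨g, hg⟩ := geometric_hahn_banach_open_point hsc hso hns
  set c : ℝ := g (0, 1) with hc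
  have hsplit : ∀ (y : En n) (t : ℝ), g (y, t) = g (y, 0) + c * t := by
    intro y t
    have : ((y, t) : En n × ℝ) = (y, 0) + t • ((0 : En n), (1 : ℝ)) := by
      ext <;> simp
    rw [this, map_add, map_smul, smul_eq_mul, mul_comm]
  have hcneg : c < 0 := by
    have := hg (x, u x + 1) ⟨hx, by simp⟩
    rw [hsplit, hsplit x (u x)] at this
    linarith
  set g0 : En n →L[ℝ] ℝ := g.comp (ContinuousLinearMap.inl ℝ (En n) ℝ) with hg0
  have hg0' : ∀ y, g (y, 0) = g0 y := fun y => by simp [hg0]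
  refine ⟨(InnerProductSpace.toDual ℝ (En n)).symm ((-c)⁻¹ • g0), fun y hy => ?_⟩
  rw [InnerProductSpace.toDual_symm_apply]
  have key : g0 y + c * u y ≤ g0 x + c * u x := by
    refine le_of_forall_pos_lt_add fun ε hε => ?_
    have := hg (y, u y + ε / (-c)) ⟨hy, by
      have : 0 < ε / (-c) := div_pos hε (by linarith)
      simpa using this⟩
    rw [hsplit, hsplit x (u x), hg0', hg0'] at this
    have h4 : c * (ε / (-c)) = -ε := by
      have := hcneg.ne
      field_simp
    rw [mul_add, h4] at this
    linarith
  simp only [_root_.smul_apply, map_sub, smul_eq_mul]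
  have h5 : (-c)⁻¹ * (g0 y - g0 x) ≤ u y - u x := by
    rw [inv_mul_le_iff₀ (by linarith)]
    linarith
  linarith

lemma subgrad_of_eventually (hu : ConvexOn ℝ Ω u) {x p : En n} (hx : x ∈ Ω)
    (h : ∀ᶠ y in 𝓝 x, u x + ⟪p, y - x⟫ ≤ u y) : p ∈ subgrad Ω u x := by
  intro y hy
  have ht : Tendsto (fun t : ℝ => x + t • (y - x)) (𝓝[>] 0) (𝓝 x) := by
    have : ContinuousAt (fun t : ℝ => x + t • (y - x)) 0 := by fun_prop
    have h2 := this.tendsto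
    simp only [zero_smul, add_zero] at h2
    exact h2.mono_left nhdsWithin_le_nhds
  have h1 : ∀ᶠ t : ℝ in 𝓝[>] 0, t < 1 := by
    filter_upwards [nhdsWithin_le_nhds (Iio_mem_nhds (zero_lt_one' ℝ))] with t ht using ht
  obtain ⟨t, ht1, ht2, ht3⟩ := ((ht.eventually h).and (h1.and self_mem_nhdsWithin)).exists
  have ht3 : 0 < t := ht3
  have hc := hu.2 hx hy (by linarith : 0 ≤ 1 - t) ht3.le (by ring)
  have he : (1 - t) • x + t • y = x + t • (y - x) := by module
  rw [he] at hc
  simp only [smul_eq_mul] at hc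
  rw [add_sub_cancel_left, inner_smul_right] at ht1
  have : t * (u x + ⟪p, y - x⟫) ≤ t * u y := by nlinarith
  exact le_of_mul_le_mul_left this ht3

lemma subgrad_mono {x y p q : En n} (hx : x ∈ Ω) (hy : y ∈ Ω) (hp : p ∈ subgrad Ω u x)
    (hq : q ∈ subgrad Ω u y) : 0 ≤ ⟪p - q, x - y⟫ := by
  have h1 := hp y hy
  have h2 := hq x hx
  have h3 : ⟪p, y - x⟫ = - ⟪p, x - y⟫ := by rw [← inner_neg_right, neg_sub]
  rw [inner_sub_left]
  linarith

/-- The graph of the subgradient over a compact set is compact. -/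
lemma isCompact_subgrad_graph (hΩ : IsOpen Ω) (hu : ConvexOn ℝ Ω u) {K : Set (En n)}
    (hK : IsCompact K) (hKΩ : K ⊆ Ω) :
    IsCompact {z : En n × En n | z.1 ∈ K ∧ z.2 ∈ subgrad Ω u z.1} := by
  have hcont := hu.continuousOn hΩ
  obtain ⟨δ, hδ, hδΩ⟩ := hK.exists_cthickening_subset_open hΩ hKΩ
  obtain ⟨M, hM⟩ := (hK.cthickening (r := δ)).exists_bound_of_continuousOn (hcont.mono hδΩ)
  have hsub : {z : En n × En n | z.1 ∈ K ∧ z.2 ∈ subgrad Ω u z.1} ⊆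
      K ×ˢ Metric.closedBall 0 (2 * M / δ) := by
    rintro ⟨x, p⟩ ⟨hx, hp⟩
    refine ⟨hx, ?_⟩
    simp only at hx hp ⊢
    rw [mem_closedBall_zero_iff, le_div_iff₀ hδ]
    have hx' := hM x (Metric.self_subset_cthickening K hx)
    rw [Real.norm_eq_abs] at hx'
    by_cases hp0 : p = 0
    · subst hp0
      have := abs_nonneg (u x)
      simp only [norm_zero, zero_mul]; linarith
    have hpn : 0 < ‖p‖ := norm_pos_iff.mpr hp0
    set y := x + (δ / ‖p‖) • p with hy
    have hyK : y ∈ Metric.cthickening δ K := by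
      refine Metric.mem_cthickening_of_dist_le y x δ K hx ?_
      rw [hy, dist_eq_norm, add_sub_cancel_left, norm_smul, Real.norm_eq_abs,
        abs_of_pos (by positivity)]
      field_simp; exact le_rfl
    have h1 := hp y (hδΩ hyK)
    have h2 := hM y hyK
    rw [Real.norm_eq_abs] at h2
    rw [hy, add_sub_cancel_left, inner_smul_right, real_inner_self_eq_norm_sq] at h1
    have h3 : δ / ‖p‖ * ‖p‖ ^ 2 = ‖p‖ * δ := by field_simp
    rw [h3, ← hy] at h1
    have := abs_le.mp hx'
    have := abs_le.mp h2
    linarith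
  refine (hK.prod (isCompact_closedBall 0 (2 * M / δ))).of_isClosed_subset ?_ hsub
  refine IsSeqClosed.isClosed fun z w hz hw => ?_
  have h1 : Tendsto (fun k => (z k).1) atTop (𝓝 w.1) := (continuous_fst.tendsto w).comp hw
  have h2 : Tendsto (fun k => (z k).2) atTop (𝓝 w.2) := (continuous_snd.tendsto w).comp hw
  have hwK : w.1 ∈ K := hK.isClosed.mem_of_tendsto h1 (.of_forall fun k => (hz k).1)
  have h3 : Tendsto (fun k => u (z k).1) atTop (𝓝 (u w.1)) :=
    (hcont.continuousAt (hΩ.mem_nhds (hKΩ hwK))).tendsto.comp h1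
  refine ⟨hwK, fun y hy => ?_⟩
  exact le_of_tendsto (h3.add (h2.inner (tendsto_const_nhds.sub h1)))
    (.of_forall fun k => (hz k).2 y hy)

lemma isCompact_iUnion_subgrad (hΩ : IsOpen Ω) (hu : ConvexOn ℝ Ω u) {K : Set (En n)}
    (hK : IsCompact K) (hKΩ : K ⊆ Ω) : IsCompact (⋃ x ∈ K, subgrad Ω u x) := by
  convert (isCompact_subgrad_graph hΩ hu hK hKΩ).image continuous_snd using 1
  ext p
  simp only [mem_iUnion, exists_prop, mem_image, mem_ofPred_eq, Prod.exists, exists_eq_right]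

lemma isCompact_subgrad (hΩ : IsOpen Ω) (hu : ConvexOn ℝ Ω u) {x : En n} (hx : x ∈ Ω) :
    IsCompact (subgrad Ω u x) := by
  simpa using isCompact_iUnion_subgrad hΩ hu isCompact_singleton (singleton_subset_iff.mpr hx)

/-- Upper semicontinuity of the subgradient. -/
lemma eventually_subgrad_subset (hΩ : IsOpen Ω) (hu : ConvexOn ℝ Ω u) {y : En n} (hy : y ∈ Ω)
    {U : Set (En n)} (hU : IsOpen U) (hyU : subgrad Ω u y ⊆ U) :
    ∀ᶠ z in 𝓝 y, subgrad Ω u z ⊆ U := by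
  obtain ⟨r, hr, hrΩ⟩ := Metric.nhds_basis_closedBall.mem_iff.mp (hΩ.mem_nhds hy)
  have hK := isCompact_subgrad_graph hΩ hu (isCompact_closedBall y r) hrΩ
  have hc : IsCompact (Prod.fst '' ({z : En n × En n | z.1 ∈ Metric.closedBall y r ∧
      z.2 ∈ subgrad Ω u z.1} ∩ Prod.snd ⁻¹' Uᶜ)) :=
    (hK.inter_right (hU.isClosed_compl.preimage continuous_snd)).image continuous_fst
  have hy' : y ∉ Prod.fst '' ({z : En n × En n | z.1 ∈ Metric.closedBall y r ∧
      z.2 ∈ subgrad Ω u z.1} ∩ Prod.snd ⁻¹' Uᶜ) := by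
    rintro ⟨⟨a, b⟩, ⟨⟨_, h2⟩, h3⟩, h4⟩
    simp only at h2 h4
    subst h4
    exact h3 (hyU h2)
  filter_upwards [hc.isClosed.isOpen_compl.mem_nhds hy', Metric.closedBall_mem_nhds y hr] with
    z hz hzr q hq
  by_contra hlt
  exact hz ⟨(z, q), ⟨⟨hzr, hq⟩, hlt⟩, rfl⟩

/-- If `∂u(y) = {p}`, then subgradients at points close to `y` are close to `p`. -/
lemma eventually_subgrad_dist_lt (hΩ : IsOpen Ω) (hu : ConvexOn ℝ Ω u) {y p : En n} (hy : y ∈ Ω)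
    (hp : subgrad Ω u y ⊆ {p}) {ε : ℝ} (hε : 0 < ε) :
    ∀ᶠ z in 𝓝 y, ∀ q ∈ subgrad Ω u z, dist q p < ε :=
  eventually_subgrad_subset hΩ hu hy (Metric.isOpen_ball (x := p) (ε := ε))
    (hp.trans (singleton_subset_iff.mpr (Metric.mem_ball_self hε)))

/-- The (sub-level) section of `u` below the affine function `⟪p, ·⟫ + c`. -/
def usec (Ω : Set (En n)) (u : En n → ℝ) (p : En n) (c : ℝ) : Set (En n) :=
  {x ∈ Ω | u x ≤ ⟪p, x⟫ + c}

lemma convex_usec (hu : ConvexOn ℝ Ω u) (p : En n) (c : ℝ) : Convex ℝ (usec Ω u p c) := by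
  intro x hx y hy a b ha hb hab
  refine ⟨hu.1 hx.1 hy.1 ha hb hab, ?_⟩
  have h := hu.2 hx.1 hy.1 ha hb hab
  simp only [smul_eq_mul] at h
  rw [inner_add_right, inner_smul_right, inner_smul_right]
  have := hx.2
  have := hy.2
  have hb' : b = 1 - a := by linarith
  subst hb'
  nlinarith

lemma usec_subset_ball (hu : ConvexOn ℝ Ω u) {a p x₁ : En n} {ρ c : ℝ}
    (hρ : ∀ x ∈ Metric.sphere a ρ, ⟪p, x⟫ + c < u x) (hx₁ : x₁ ∈ Metric.closedBall a ρ)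
    (h₁ : x₁ ∈ usec Ω u p c) : usec Ω u p c ⊆ Metric.ball a ρ := by
  intro x hx
  by_contra hxb
  have hx1 : dist x₁ a ≤ ρ := hx₁
  have hx2 : ρ ≤ dist x a := by simpa using hxb
  have hconn : IsPreconnected (segment ℝ x₁ x) := (convex_segment x₁ x).isPreconnected
  obtain ⟨z, hz, hzρ⟩ := hconn.intermediate_value (left_mem_segment ℝ x₁ x)
    (right_mem_segment ℝ x₁ x) (f := fun z => dist z a) (by fun_prop) ⟨hx1, hx2⟩
  have h3 := (convex_usec hu p c).segment_subset h₁ hx hz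
  have h4 := hρ z hzρ
  exact absurd h3.2 (not_le.mpr h4)

lemma isCompact_usec (hΩ : IsOpen Ω) (hu : ConvexOn ℝ Ω u) {a p : En n} {ρ c : ℝ}
    (haΩ : Metric.closedBall a ρ ⊆ Ω) (hs : usec Ω u p c ⊆ Metric.closedBall a ρ) :
    IsCompact (usec Ω u p c) := by
  have hcont := (hu.continuousOn hΩ).mono haΩ
  have : usec Ω u p c = {x ∈ Metric.closedBall a ρ | u x ≤ ⟪p, x⟫ + c} := by
    ext x
    exact ⟨fun h => ⟨hs h, h.2⟩, fun h => ⟨haΩ h.1, h.2⟩⟩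
  rw [this]
  exact (isCompact_closedBall a ρ).of_isClosed_subset
    (Metric.isClosed_closedBall.isClosed_le hcont (by fun_prop)) (fun x hx => hx.1)

lemma exists_pos_le_of_compact {X : Type*} [TopologicalSpace X] {K : Set X} (hK : IsCompact K)
    {g : X → ℝ} (hg : ContinuousOn g K) (hpos : ∀ x ∈ K, 0 < g x) : ∃ m > 0, ∀ x ∈ K, m ≤ g x := by
  rcases K.eq_empty_or_nonempty with rfl | hne
  · exact ⟨1, one_pos, by simp⟩
  · obtain ⟨x, hx, hmin⟩ := hK.exists_isMinOn hne hg
    exact ⟨g x, hpos x hx, fun y hy => hmin hy⟩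

end Subgradients

section Doubling

variable {n : ℕ}

lemma exists_polynomial_restrict_line (P : MvPolynomial (Fin n) ℝ) :
    ∃ d : ℕ, ∀ a b : En n, ∃ q : Polynomial ℝ, q.natDegree ≤ d ∧
      ∀ t : ℝ, q.eval t = MvPolynomial.eval (fun j => (a + t • b) j) P := by
  induction P using MvPolynomial.induction_on with
  | C r => exact ⟨0, fun a b => ⟨Polynomial.C r, by simp, by simp⟩⟩
  | add p q hp hq =>
    obtain ⟨d₁, h₁⟩ := hp
    obtain ⟨d₂, h₂⟩ := hq
    refine ⟨max d₁ d₂, fun a b => ?_⟩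
    obtain ⟨q₁, h₁, h₁'⟩ := h₁ a b
    obtain ⟨q₂, h₂, h₂'⟩ := h₂ a b
    refine ⟨q₁ + q₂, (Polynomial.natDegree_add_le _ _).trans (max_le_max h₁ h₂), fun t => ?_⟩
    rw [Polynomial.eval_add, h₁', h₂', map_add]
  | mul_X p i hp =>
    obtain ⟨d, h⟩ := hp
    refine ⟨d + 1, fun a b => ?_⟩
    obtain ⟨q, hq, hq'⟩ := h a b
    refine ⟨q * (Polynomial.C (a i) + Polynomial.X * Polynomial.C (b i)),
      Polynomial.natDegree_mul_le.trans (add_le_add hq ?_), fun t => ?_⟩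
    · refine (Polynomial.natDegree_add_le _ _).trans (max_le (by simp) ?_)
      exact Polynomial.natDegree_mul_le.trans (by simp)
    · rw [map_mul, MvPolynomial.eval_X, ← hq']
      simp [mul_comm t]

/-- Interpolation nodes in `[1/4, 1/2]`. -/
def dnode (d j : ℕ) : ℝ := 1 / 4 + (1 / 4) * (j / (d + 1))

lemma dnode_mem {d j : ℕ} (hj : j ∈ Finset.range (d + 1)) : dnode d j ∈ Icc (1 / 4 : ℝ) (1 / 2) := by
  have h1 : (j : ℝ) / (d + 1) ≤ 1 := by
    rw [div_le_one (by positivity)]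
    have := Finset.mem_range.mp hj
    exact_mod_cast this.le
  have h2 : 0 ≤ (j : ℝ) / (d + 1) := by positivity
  unfold dnode
  constructor <;> linarith

lemma dnode_injOn (d : ℕ) : InjOn (dnode d) (Finset.range (d + 1)) := by
  intro i _ j _ h
  unfold dnode at h
  have : (i : ℝ) / (d + 1) = j / (d + 1) := by linarith
  rw [div_left_inj' (by positivity)] at this
  exact_mod_cast this

lemma exists_abs_rpow_le_sum_nodes (P : MvPolynomial (Fin n) ℝ) {α : ℝ} (hα : 0 ≤ α) :
    ∃ d : ℕ, ∃ D : ℝ, 0 ≤ D ∧ ∀ x₀ x : En n,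
      |MvPolynomial.eval (fun j => x j) P| ^ α ≤ D * ∑ j ∈ Finset.range (d + 1),
        |MvPolynomial.eval (fun i => (x₀ + dnode d j • (x - x₀)) i) P| ^ α := by
  obtain ⟨d, hd⟩ := exists_polynomial_restrict_line P
  set s := Finset.range (d + 1)
  set B : ℝ := ∑ j ∈ s, |(Lagrange.basis s (dnode d) j).eval 1|
  have hB : 0 ≤ B := Finset.sum_nonneg fun _ _ => abs_nonneg _
  refine ⟨d, B ^ α, by positivity, fun x₀ x => ?_⟩
  obtain ⟨q, hqd, hq⟩ := hd x₀ (x - x₀)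
  have hdeg : q.degree < s.card := by
    refine lt_of_le_of_lt Polynomial.degree_le_natDegree ?_
    simp only [s, Finset.card_range]
    exact_mod_cast Nat.lt_succ_of_le hqd
  have h1 := Lagrange.eq_interpolate (dnode_injOn d) hdeg
  have h2 : q.eval 1 = ∑ j ∈ s, q.eval (dnode d j) * (Lagrange.basis s (dnode d) j).eval 1 := by
    conv_lhs => rw [h1]
    rw [Lagrange.interpolate_apply, Polynomial.eval_finsetSum]
    simp [s]
  have h3 : q.eval 1 = MvPolynomial.eval (fun j => x j) P := by
    rw [hq]; simp
  obtain ⟨k, hk, hkmax⟩ := s.exists_max_image (fun j => |q.eval (dnode d j)|)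
    ⟨0, by simp [s]⟩
  have h4 : |q.eval 1| ≤ B * |q.eval (dnode d k)| := by
    rw [h2, Finset.sum_mul]
    refine (Finset.abs_sum_le_sum_abs _ _).trans (Finset.sum_le_sum fun j hj => ?_)
    rw [abs_mul, mul_comm]
    exact mul_le_mul_of_nonneg_left (hkmax j hj) (abs_nonneg _)
  rw [← h3]
  calc |q.eval 1| ^ α ≤ (B * |q.eval (dnode d k)|) ^ α :=
        Real.rpow_le_rpow (abs_nonneg _) h4 hα
    _ = B ^ α * |q.eval (dnode d k)| ^ α := Real.mul_rpow hB (abs_nonneg _)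
    _ ≤ B ^ α * ∑ j ∈ s, |q.eval (dnode d j)| ^ α := by
        refine mul_le_mul_of_nonneg_left ?_ (by positivity)
        exact Finset.single_le_sum (f := fun j => |q.eval (dnode d j)| ^ α)
          (fun j _ => by positivity) hk
    _ = _ := by simp_rw [hq]; rfl

lemma lintegral_comp_homothety_le (x₀ : En n) {A : Set (En n)} (hA : MeasurableSet A)
    (hAc : Convex ℝ A) (hx₀ : x₀ ∈ A) {t : ℝ} (ht : t ∈ Icc (1 / 4 : ℝ) (1 / 2))
    (g : En n → ℝ≥0∞) :
    ∫⁻ x in A, g (x₀ + t • (x - x₀)) ≤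
      4 ^ n * ∫⁻ x in (fun x => x₀ + (1 / 2 : ℝ) • (x - x₀)) '' A, g x := by
  have ht0 : 0 < t := by linarith [ht.1]
  have hder : ∀ x ∈ A, HasFDerivWithinAt (fun x => x₀ + t • (x - x₀))
      (t • ContinuousLinearMap.id ℝ (En n)) A x := fun x _ =>
    (((hasFDerivAt_id x).sub_const x₀).const_smul t |>.const_add x₀).hasFDerivWithinAt
  have hinj : InjOn (fun x => x₀ + t • (x - x₀)) A := by
    intro x _ y _ h
    simpa [ht0.ne'] using h
  have hdet : |(t • ContinuousLinearMap.id ℝ (En n)).det| = t ^ n := by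
    rw [ContinuousLinearMap.det]
    simp [abs_of_pos ht0]
  have h1 := lintegral_image_eq_lintegral_abs_det_fderiv_mul volume hA hder hinj g
  rw [hdet] at h1
  have h2 : (fun x => x₀ + t • (x - x₀)) '' A ⊆ (fun x => x₀ + (1 / 2 : ℝ) • (x - x₀)) '' A := by
    rintro _ ⟨x, hx, rfl⟩
    refine ⟨x₀ + (2 * t) • (x - x₀), ?_, by simp only; module⟩
    have := hAc hx₀ hx (by linarith [ht.2] : 0 ≤ 1 - 2 * t) (by linarith : 0 ≤ 2 * t) (by ring)
    convert this using 1
    module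
  have h3 : (1 : ℝ≥0∞) ≤ 4 ^ n * ENNReal.ofReal (t ^ n) := by
    have : (4 : ℝ≥0∞) ^ n = ENNReal.ofReal (4 ^ n) := by
      rw [ENNReal.ofReal_pow (by norm_num)]; norm_num
    rw [this, ← ENNReal.ofReal_mul (by positivity), ← mul_pow, ENNReal.one_le_ofReal]
    exact one_le_pow₀ (by linarith [ht.1])
  calc ∫⁻ x in A, g (x₀ + t • (x - x₀))
      ≤ ∫⁻ x in A, 4 ^ n * (ENNReal.ofReal (t ^ n) * g (x₀ + t • (x - x₀))) := by
        refine lintegral_mono fun x => ?_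
        rw [← mul_assoc]
        exact le_mul_of_one_le_left (zero_le) h3
    _ = 4 ^ n * ∫⁻ x in (fun x => x₀ + t • (x - x₀)) '' A, g x := by
        rw [h1, lintegral_const_mul' _ _ (by simp)]
    _ ≤ _ := by gcongr

lemma exists_doubling_sum {m : ℕ} (P : Fin m → MvPolynomial (Fin n) ℝ) (α : Fin m → ℝ)
    (hα : ∀ i, 0 ≤ α i) : ∃ D : ℝ≥0∞, D ≠ ⊤ ∧ ∀ (x₀ : En n) (A : Set (En n)), MeasurableSet A →
      Convex ℝ A → x₀ ∈ A →
      ∫⁻ x in A, ENNReal.ofReal (∑ i, |MvPolynomial.eval (fun j => x j) (P i)| ^ (α i)) ≤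
      D * ∫⁻ x in (fun x => x₀ + (1 / 2 : ℝ) • (x - x₀)) '' A,
        ENNReal.ofReal (∑ i, |MvPolynomial.eval (fun j => x j) (P i)| ^ (α i)) := by
  choose d D hD hdD using fun i => exists_abs_rpow_le_sum_nodes (P i) (hα i)
  set σ : Fin m → En n → ℝ := fun i x => |MvPolynomial.eval (fun j => x j) (P i)| ^ (α i) with hσ
  have hσ0 : ∀ i x, 0 ≤ σ i x := fun i x => by positivity
  have hσm : ∀ i, Measurable (σ i) := fun i => by
    refine Measurable.pow_const (Measurable.abs ?_) _
    have : Continuous fun x : En n => MvPolynomial.eval (fun j => x j) (P i) := by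
      exact (MvPolynomial.continuous_eval (P i)).comp (by fun_prop)
    exact this.measurable
  refine ⟨∑ i, ENNReal.ofReal (D i) * ((d i + 1 : ℕ) * 4 ^ n), by
    simp [ENNReal.sum_eq_top, ENNReal.mul_eq_top], fun x₀ A hA hAc hx₀ => ?_⟩
  set I := ∫⁻ x in (fun x => x₀ + (1 / 2 : ℝ) • (x - x₀)) '' A, ENNReal.ofReal (∑ i, σ i x)
  have hi : ∀ i, ∫⁻ x in A, ENNReal.ofReal (σ i x) ≤
      ENNReal.ofReal (D i) * ((d i + 1 : ℕ) * 4 ^ n) * I := by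
    intro i
    calc ∫⁻ x in A, ENNReal.ofReal (σ i x)
        ≤ ∫⁻ x in A, ENNReal.ofReal (D i) * ∑ j ∈ Finset.range (d i + 1),
            ENNReal.ofReal (σ i (x₀ + dnode (d i) j • (x - x₀))) := by
          refine lintegral_mono fun x => ?_
          rw [← ENNReal.ofReal_sum_of_nonneg (fun j _ => hσ0 i _), ← ENNReal.ofReal_mul (hD i)]
          exact ENNReal.ofReal_le_ofReal (hdD i x₀ x)
      _ = ENNReal.ofReal (D i) * ∑ j ∈ Finset.range (d i + 1),
            ∫⁻ x in A, ENNReal.ofReal (σ i (x₀ + dnode (d i) j • (x - x₀))) := by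
          rw [lintegral_const_mul' _ _ (by simp), lintegral_finsetSum]
          intro j _
          exact ((hσm i).comp (by fun_prop)).ennreal_ofReal
      _ ≤ ENNReal.ofReal (D i) * ∑ j ∈ Finset.range (d i + 1), 4 ^ n * I := by
          gcongr with j hj
          refine (lintegral_comp_homothety_le x₀ hA hAc hx₀ (dnode_mem hj)
            (fun x => ENNReal.ofReal (σ i x))).trans ?_
          refine mul_le_mul_right (lintegral_mono fun x => ENNReal.ofReal_le_ofReal ?_) _
          exact Finset.single_le_sum (f := fun i => σ i x) (fun j _ => hσ0 j x) (Finset.mem_univ i)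
      _ = _ := by
          rw [Finset.sum_const, Finset.card_range, nsmul_eq_mul]; ring
  calc ∫⁻ x in A, ENNReal.ofReal (∑ i, σ i x)
      = ∑ i, ∫⁻ x in A, ENNReal.ofReal (σ i x) := by
        rw [← lintegral_finsetSum _ fun i _ => (hσm i).ennreal_ofReal]
        congr with x
        exact ENNReal.ofReal_sum_of_nonneg fun i _ => hσ0 i x
    _ ≤ ∑ i, ENNReal.ofReal (D i) * ((d i + 1 : ℕ) * 4 ^ n) * I :=
        Finset.sum_le_sum fun i _ => hi i
    _ = _ := by rw [Finset.sum_mul]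

/-- The doubling property of a set function on convex subsets of `Ω`. -/
def IsDoublingOn (Ω : Set (En n)) (μ : Set (En n) → ℝ≥0∞) (D : ℝ≥0∞) : Prop :=
  ∀ (x₀ : En n) (A : Set (En n)), A ⊆ Ω → MeasurableSet A → Convex ℝ A → x₀ ∈ A →
    MeasurableSet ((fun x => x₀ + (1 / 2 : ℝ) • (x - x₀)) '' A) →
    μ A ≤ D * μ ((fun x => x₀ + (1 / 2 : ℝ) • (x - x₀)) '' A)

lemma isGenSol_doubling {Ω : Set (En n)} {f : En n → ℝ} {F G : En n × ℝ → ℝ} {lam Lam : ℝ}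
    (hlam : 0 < lam) (hFb : ∀ p : En n × ℝ, lam ≤ F p ∧ F p ≤ Lam)
    (hGb : ∀ p : En n × ℝ, lam ≤ G p ∧ G p ≤ Lam)
    {m : ℕ} (P : Fin m → MvPolynomial (Fin n) ℝ) (α : Fin m → ℝ) (hα : ∀ i, 0 ≤ α i)
    (hfb : ∀ x ∈ Ω,
      lam * (∑ i, |MvPolynomial.eval (fun j => x j) (P i)| ^ (α i)) ≤ f x ∧
      f x ≤ Lam * (∑ i, |MvPolynomial.eval (fun j => x j) (P i)| ^ (α i)))
    {w : En n → ℝ} (hw : IsGenSol Ω f F G w) :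
    ∃ D : ℝ≥0∞, D ≠ ⊤ ∧ IsDoublingOn Ω (MAm Ω w) D := by
  obtain ⟨D, hD, hDσ⟩ := exists_doubling_sum P α hα
  have hLam : 0 < Lam := hlam.trans_le ((hFb 0).1.trans (hFb 0).2)
  set σ : En n → ℝ := fun x => ∑ i, |MvPolynomial.eval (fun j => x j) (P i)| ^ (α i) with hσ
  have hσ0 : ∀ x, 0 ≤ σ x := fun x => by positivity
  set K : ℝ := Lam * Lam / lam
  set k : ℝ := lam * lam / Lam
  have hk : 0 < k := by positivity
  have hup : ∀ x ∈ Ω, ∀ a b, f x * F a / G b ≤ K * σ x := by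
    intro x hx a b
    have h0 : 0 ≤ f x := le_trans (by have := hσ0 x; positivity) (hfb x hx).1
    rw [div_le_iff₀ (hlam.trans_le (hGb b).1)]
    calc f x * F a ≤ (Lam * σ x) * Lam :=
          mul_le_mul (hfb x hx).2 (hFb a).2 (hlam.le.trans (hFb a).1) (by have := hσ0 x; positivity)
      _ = K * σ x * lam := by simp only [K]; field_simp
      _ ≤ K * σ x * G b := mul_le_mul_of_nonneg_left (hGb b).1 (by have := hσ0 x; positivity)
  have hlow : ∀ x ∈ Ω, ∀ a b, k * σ x ≤ f x * F a / G b := by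
    intro x hx a b
    have h0 : 0 ≤ f x := le_trans (by have := hσ0 x; positivity) (hfb x hx).1
    rw [le_div_iff₀ (hlam.trans_le (hGb b).1)]
    calc k * σ x * G b ≤ k * σ x * Lam :=
          mul_le_mul_of_nonneg_left (hGb b).2 (by have := hσ0 x; positivity)
      _ = (lam * σ x) * lam := by simp only [k]; field_simp
      _ ≤ f x * F a := mul_le_mul (hfb x hx).1 (hFb a).1 hlam.le h0
  refine ⟨ENNReal.ofReal K * D * ENNReal.ofReal k⁻¹, by
    simp [ENNReal.mul_eq_top, hD], fun x₀ A hAΩ hA hAc hx₀ hTA => ?_⟩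
  have hTsub : (fun x => x₀ + (1 / 2 : ℝ) • (x - x₀)) '' A ⊆ A := by
    rintro _ ⟨x, hx, rfl⟩
    have := hAc hx₀ hx (by norm_num : (0 : ℝ) ≤ 1 / 2) (by norm_num : (0 : ℝ) ≤ 1 / 2) (by norm_num)
    convert this using 1
    module
  set TA := (fun x => x₀ + (1 / 2 : ℝ) • (x - x₀)) '' A
  rw [hw A hAΩ hA, hw TA (hTsub.trans hAΩ) hTA]
  calc _ ≤ ∫⁻ x in A, ENNReal.ofReal K * ENNReal.ofReal (σ x) := by
        refine setLIntegral_mono' hA fun x hx => ?_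
        rw [← ENNReal.ofReal_mul (by positivity)]
        exact ENNReal.ofReal_le_ofReal (hup x (hAΩ hx) _ _)
    _ ≤ ENNReal.ofReal K * (D * ∫⁻ x in TA, ENNReal.ofReal (σ x)) := by
        rw [lintegral_const_mul' _ _ (by simp)]
        gcongr
        exact hDσ x₀ A hA hAc hx₀
    _ = ENNReal.ofReal K * D * ENNReal.ofReal k⁻¹ *
        ∫⁻ x in TA, ENNReal.ofReal k * ENNReal.ofReal (σ x) := by
        rw [lintegral_const_mul' _ _ (by simp)]
        have : ENNReal.ofReal k⁻¹ * ENNReal.ofReal k = 1 := by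
          rw [← ENNReal.ofReal_mul (by positivity), inv_mul_cancel₀ hk.ne', ENNReal.ofReal_one]
        rw [← mul_assoc _ (ENNReal.ofReal k), mul_assoc (_ * D) _ (ENNReal.ofReal k), this]
        ring
    _ ≤ _ := by
        gcongr 1
        refine setLIntegral_mono' hTA fun x hx => ?_
        rw [← ENNReal.ofReal_mul hk.le]
        exact ENNReal.ofReal_le_ofReal (hlow x (hAΩ (hTsub hx)) _ _)

end Doubling

section Polar

variable {n : ℕ}

/-- The cube `{c | ∀ i, |c i| ≤ r}`. -/
def cubeR (n : ℕ) (r : ℝ) : Set (En n) := {c | ∀ i, |c i| ≤ r}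

/-- The cube `{c | ∀ i, 0 ≤ c i ≤ r}`. -/
def cubeP (n : ℕ) (r : ℝ) : Set (En n) := {c | ∀ i, 0 ≤ c i ∧ c i ≤ r}

lemma volume_cubeR_ne_top (r : ℝ) : volume (cubeR n r) ≠ ⊤ := by
  have : cubeR n r = (MeasurableEquiv.toLp 2 (Fin n → ℝ)).symm ⁻¹' (Icc (fun _ => -r) fun _ => r) := by
    ext c
    simp only [cubeR, mem_ofPred_eq, mem_preimage, mem_Icc, Pi.le_def, abs_le]
    exact forall_and
  rw [this, (EuclideanSpace.volume_preserving_symm_measurableEquiv_toLp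
    (Fin n)).measure_preimage measurableSet_Icc.nullMeasurableSet]
  exact isCompact_Icc.measure_ne_top

lemma volume_cubeP_pos {r : ℝ} (hr : 0 < r) : volume (cubeP n r) ≠ 0 := by
  have : cubeP n r = (MeasurableEquiv.toLp 2 (Fin n → ℝ)).symm ⁻¹' (Icc (fun _ => 0) fun _ => r) := by
    ext c
    simp only [cubeP, mem_ofPred_eq, mem_preimage, mem_Icc, Pi.le_def]
    exact forall_and
  rw [this, (EuclideanSpace.volume_preserving_symm_measurableEquiv_toLp
    (Fin n)).measure_preimage measurableSet_Icc.nullMeasurableSet, Real.volume_Icc_pi]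
  simp [hr]

lemma volume_cubeP_ne_top (r : ℝ) : volume (cubeP n r) ≠ ⊤ :=
  ne_top_of_le_ne_top (volume_cubeR_ne_top (n := n) r) (measure_mono fun _ hc i =>
    abs_le.mpr ⟨by linarith [(hc i).1, (hc i).2], (hc i).2⟩)

/-- An inscribed parallelepiped with a vertex at `x`, of comparable size. -/
lemma exists_parallelepiped {S : Set (En n)} (hS : IsCompact S) (hSc : Convex ℝ S)
    (hSi : (interior S).Nonempty) {x : En n} (hx : x ∈ S) :
    ∃ e : Fin n → En n, (Matrix.of fun j i => e j i).det ≠ 0 ∧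
      (∀ j, x + e j ∈ S) ∧
      ∀ s ∈ S, ∃ c ∈ cubeR n 1, s - x = ∑ j, c j • e j := by
  set D : (Fin n → En n) → ℝ := fun y => |(Matrix.of fun j i => (y j - x) i).det| with hD
  have hDc : Continuous D := by
    refine Continuous.abs (Continuous.matrix_det ?_)
    exact continuous_matrix fun i j => by simp only [Matrix.of_apply]; fun_prop
  obtain ⟨y, hy, hmax⟩ := (isCompact_univ_pi fun _ : Fin n => hS).exists_isMaxOn
    ⟨fun _ => x, fun _ _ => hx⟩ hDc.continuousOn
  set M : Matrix (Fin n) (Fin n) ℝ := Matrix.of fun j i => (y j - x) i with hM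
  have hdet : M.det ≠ 0 := by
    have haff := hSc.interior_nonempty_iff_affineSpan_eq_top.mp hSi
    have hspan : ⊤ ≤ Submodule.span ℝ ((· - x) '' S) := by
      have h1 : vectorSpan ℝ S = ⊤ := by
        rw [← direction_affineSpan, haff, AffineSubspace.direction_top]
      rw [vectorSpan_eq_span_vsub_set_right ℝ hx] at h1
      exact h1.ge
    set b0 := Module.Basis.ofSpan hspan
    have hfin : Fintype (linearIndepOn_empty ℝ (id : En n → En n) |>.extend
      (empty_subset ((· - x) '' S))) := FiniteDimensional.fintypeBasisIndex b0
    have hcard : Fintype.card (linearIndepOn_empty ℝ (id : En n → En n) |>.extend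
      (empty_subset ((· - x) '' S))) = Fintype.card (Fin n) := by
      rw [← Module.finrank_eq_card_basis b0]; simp
    set b := b0.reindex (Fintype.equivOfCardEq hcard)
    have hb : ∀ j, x + b j ∈ S := by
      intro j
      have : b j ∈ range b0 := by simp [b]
      obtain ⟨s, hs, hsx⟩ := Module.Basis.ofSpan_subset hspan this
      rw [← hsx]; simpa using hs
    have hle := hmax (a := fun j => x + b j) (fun j _ => hb j)
    have hli : LinearIndependent ℝ (Matrix.of fun j i => b j i).row := by
      exact b.linearIndependent.map' (WithLp.linearEquiv 2 ℝ (Fin n → ℝ)).toLinearMap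
        (LinearEquiv.ker _)
    have hu := (Matrix.isUnit_iff_isUnit_det _).mp
      (Matrix.linearIndependent_rows_iff_isUnit.mp hli)
    intro h0
    have : D (fun j => x + b j) ≤ 0 := by
      have h2 : D y = 0 := by simp only [hD]; rw [← hM, h0, abs_zero]
      exact h2 ▸ hle
    simp only [hD, add_sub_cancel_left] at this
    exact hu.ne_zero (abs_nonpos_iff.mp this)
  refine ⟨fun j => y j - x, hdet, fun j => by simpa using hy j (mem_univ j), fun s hs => ?_⟩
  have hMu : IsUnit M.transpose.det := by rw [Matrix.det_transpose]; exact isUnit_iff_ne_zero.mpr hdet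
  set c : Fin n → ℝ := (M.transpose)⁻¹.mulVec (fun i => (s - x) i) with hc
  have hsum : s - x = ∑ j, c j • (y j - x) := by
    have h1 : M.transpose.mulVec c = fun i => (s - x) i := by
      rw [hc, Matrix.mulVec_mulVec, Matrix.mul_nonsing_inv _ hMu, Matrix.one_mulVec]
    ext i
    have := congrFun h1 i
    rw [← this]
    simp [Matrix.mulVec, dotProduct, hM, mul_comm]
  refine ⟨WithLp.toLp 2 c, fun i => ?_, hsum⟩
  have h2 := hmax (a := Function.update y i s) (fun j _ => by
    by_cases hj : j = i
    · subst hj; simpa using hs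
    · simpa [hj] using hy j (mem_univ j))
  have h3 : (Matrix.of fun j k => (Function.update y i s j - x) k) =
      M.updateRow i (∑ k, c k • M k) := by
    ext j k
    by_cases hj : j = i
    · subst hj
      simp only [Matrix.of_apply, Function.update_self, Matrix.updateRow_self]
      rw [hsum]
      simp [hM]
    · simp [hj, hM]
  have h4 : D (Function.update y i s) = |c i| * |M.det| := by
    simp only [hD]
    rw [h3, Matrix.det_updateRow_sum, smul_eq_mul, abs_mul]
  have h5 : |c i| * |M.det| ≤ 1 * |M.det| := by
    rw [← h4, one_mul]; exact h2
  exact le_of_mul_le_mul_right h5 (abs_pos.mpr hdet)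

/-- The polar body of `S` with respect to `z`. -/
def polarAt (S : Set (En n)) (z : En n) : Set (En n) := {q | ∀ s ∈ S, ⟪q, s - z⟫ ≤ 1}

/-- The symmetric polar body of `S` with respect to `z`. -/
def symPolarAt (S : Set (En n)) (z : En n) : Set (En n) := {q | ∀ s ∈ S, |⟪q, s - z⟫| ≤ 1}

lemma exists_polar_bounds (n : ℕ) : ∃ c C : ℝ≥0∞, c ≠ 0 ∧ c ≠ ⊤ ∧ C ≠ ⊤ ∧
    ∀ S : Set (En n), IsCompact S → Convex ℝ S → (interior S).Nonempty → ∀ x ∈ S,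
      c ≤ volume (symPolarAt S x) * volume S ∧
      ∃ z ∈ S, volume (polarAt S z) * volume S ≤ C := by
  set ν : ℝ := 1 / (n + 1)
  have hν : 0 < ν := by positivity
  have hnν : n * ν ≤ 1 := by
    simp only [ν]; rw [mul_one_div, div_le_one (by positivity)]; linarith
  refine ⟨volume (cubeP n ν) * volume (cubeP n ν), volume (cubeR n (2 / ν)) * volume (cubeR n 1),
    mul_ne_zero (volume_cubeP_pos hν) (volume_cubeP_pos hν),
    ENNReal.mul_ne_top (volume_cubeP_ne_top _) (volume_cubeP_ne_top _),
    ENNReal.mul_ne_top (volume_cubeR_ne_top _) (volume_cubeR_ne_top _),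
    fun S hS hSc hSi x hx => ?_⟩
  obtain ⟨e, hdet, heS, hSe⟩ := exists_parallelepiped hS hSc hSi hx
  set M : Matrix (Fin n) (Fin n) ℝ := Matrix.of fun j i => e j i with hM
  set T : En n →ₗ[ℝ] En n := Matrix.toEuclideanLin M with hT
  set L : En n →ₗ[ℝ] En n := Matrix.toEuclideanLin M.transpose with hL
  have hTdet : LinearMap.det T = M.det := by
    rw [hT, Matrix.toEuclideanLin_eq_toLin_orthonormal, LinearMap.det_toLin]
  have hLdet : LinearMap.det L = M.det := by
    rw [hL, Matrix.toEuclideanLin_eq_toLin_orthonormal, LinearMap.det_toLin, Matrix.det_transpose]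
  have hTapp : ∀ q j, T q j = ⟪q, e j⟫ := fun q j => by
    simp [hT, hM, Matrix.toLpLin_apply, Matrix.mulVec, dotProduct, PiLp.inner_apply]
  have hLapp : ∀ c : En n, L c = ∑ j, c j • e j := fun c => by
    ext i
    simp [hL, hM, Matrix.toLpLin_apply, Matrix.mulVec, dotProduct, mul_comm]
  have hSub : S ⊆ (fun w => x + w) '' (L '' cubeR n 1) := by
    intro s hs
    obtain ⟨c, hc, hsc⟩ := hSe s hs
    exact ⟨s - x, ⟨c, hc, by rw [hLapp, hsc]⟩, by simp⟩
  have hin : ∀ c ∈ cubeP n ν, x + L c ∈ S := by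
    intro c hc
    have h1 : ∑ j, c j ≤ 1 := by
      refine (Finset.sum_le_sum fun j _ => (hc j).2).trans ?_
      simpa using hnν
    have := hSc.sum_mem (t := Finset.univ) (w := fun o : Option (Fin n) => o.elim (1 - ∑ j, c j) c)
      (z := fun o => o.elim x (fun j => x + e j))
      (by rintro (_ | j) _
          · simpa using h1
          · exact (hc j).1)
      (by rw [Fintype.sum_option]; simp)
      (by rintro (_ | j) _
          · exact hx
          · exact heS j)
    rw [Fintype.sum_option] at this
    convert this using 1
    rw [hLapp]
    simp only [Option.elim_none, Option.elim_some, smul_add, Finset.sum_add_distrib, ← Finset.sum_smul]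
    module
  have hadd : ∀ A : Set (En n), volume ((fun w => x + w) '' A) = volume A := fun A => by
    simp
  have hup : volume S ≤ ENNReal.ofReal |M.det| * volume (cubeR n 1) := by
    refine (measure_mono hSub).trans ?_
    rw [hadd, Measure.addHaar_image_linearMap, hLdet]
  have hlow : ENNReal.ofReal |M.det| * volume (cubeP n ν) ≤ volume S := by
    rw [← hLdet, ← Measure.addHaar_image_linearMap, ← hadd]
    refine measure_mono ?_
    rintro _ ⟨_, ⟨c, hc, rfl⟩, rfl⟩
    exact hin c hc
  have hinv : ENNReal.ofReal |M.det⁻¹| * ENNReal.ofReal |M.det| = 1 := by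
    rw [← ENNReal.ofReal_mul (abs_nonneg _), ← abs_mul, inv_mul_cancel₀ hdet]; simp
  have hTdet' : LinearMap.det T ≠ 0 := by rwa [hTdet]
  constructor
  · have h1 : T ⁻¹' cubeP n ν ⊆ symPolarAt S x := by
      intro q hq s hs
      obtain ⟨c, hc, hsc⟩ := hSe s hs
      rw [hsc, inner_sum]
      refine (Finset.abs_sum_le_sum_abs _ _).trans (le_trans ?_ hnν)
      have : ∀ j ∈ Finset.univ, |⟪q, c j • e j⟫| ≤ ν := by
        intro j _
        rw [inner_smul_right, abs_mul, ← hTapp]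
        have h2 := hc j
        have h3 := hq j
        rw [abs_of_nonneg h3.1]
        calc |c j| * T q j ≤ 1 * ν := mul_le_mul h2 h3.2 h3.1 zero_le_one
          _ = ν := one_mul _
      simpa using Finset.sum_le_sum this
    have h2 := measure_mono (μ := volume) h1
    rw [Measure.addHaar_preimage_linearMap volume hTdet', hTdet] at h2
    calc volume (cubeP n ν) * volume (cubeP n ν)
        = (ENNReal.ofReal |M.det⁻¹| * volume (cubeP n ν)) *
          (ENNReal.ofReal |M.det| * volume (cubeP n ν)) := by
          rw [mul_mul_mul_comm, hinv, one_mul]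
      _ ≤ _ := mul_le_mul' h2 hlow
  · set c₀ : En n := WithLp.toLp 2 (fun _ => ν / 2)
    refine ⟨x + L c₀, hin c₀ fun i => ⟨by simp only [c₀]; positivity, by simp only [c₀]; linarith⟩, ?_⟩
    have h1 : polarAt S (x + L c₀) ⊆ T ⁻¹' cubeR n (2 / ν) := by
      intro q hq j
      have key : ∀ σ : ℝ, |σ| ≤ 1 → σ * (ν / 2) * ⟪q, e j⟫ ≤ 1 := by
        intro σ hσ
        have h2 : x + L (c₀ + (σ * (ν / 2)) • EuclideanSpace.single j 1) ∈ S := by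
          refine hin _ fun i => ?_
          have := abs_le.mp hσ
          by_cases hij : i = j
          · subst hij
            simp [c₀]
            constructor <;> nlinarith
          · simp [c₀, hij]
            constructor <;> linarith
        have h3 := hq _ h2
        have h4 : x + L (c₀ + (σ * (ν / 2)) • EuclideanSpace.single j 1) - (x + L c₀) =
            (σ * (ν / 2)) • e j := by
          have h5 : L (EuclideanSpace.single j 1) = e j := by
            rw [hLapp]
            simp
          rw [map_add, map_smul, h5]
          abel
        rw [h4, inner_smul_right] at h3
        exact h3
      have k1 := key 1 (by simp)
      have k2 := key (-1) (by simp)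
      rw [hTapp, abs_le, neg_le, le_div_iff₀ hν, le_div_iff₀ hν]
      constructor <;> linarith
    have h2 := measure_mono (μ := volume) h1
    rw [Measure.addHaar_preimage_linearMap volume hTdet', hTdet] at h2
    calc _ ≤ (ENNReal.ofReal |M.det⁻¹| * volume (cubeR n (2 / ν))) *
          (ENNReal.ofReal |M.det| * volume (cubeR n 1)) := mul_le_mul' h2 hup
      _ = _ := by rw [mul_mul_mul_comm, hinv, one_mul]

end Polar

section Balanced
open Topology

variable {n : ℕ}

/-- If an affine function bounded by `1` on `Q` takes a large value somewhere on the convex set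
`P ⊇ Q`, then `P` has much larger volume than `Q`. -/
lemma slab_volume_le {P Q : Set (En n)} (hP : Convex ℝ P) (hQP : Q ⊆ P) (hQ : MeasurableSet Q)
    {ξ : En n → ℝ} (hξ : ∀ q q' (t : ℝ), ξ ((1 - t) • q + t • q') = (1 - t) * ξ q + t * ξ q')
    (hξQ : ∀ q ∈ Q, |ξ q| ≤ 1) {N : ℕ} {q₀ : En n} (hq₀ : q₀ ∈ P) (hlarge : 4 * N + 1 ≤ |ξ q₀|) :
    N * volume Q ≤ 2 ^ n * volume P := by
  rcases Nat.eq_zero_or_pos N with rfl | hN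
  · simp
  have hN' : (0 : ℝ) < N := by exact_mod_cast hN
  set t : ℕ → ℝ := fun j => j / (2 * N) with ht
  have ht0 : ∀ j ∈ Finset.range N, 0 ≤ t j ∧ t j ≤ 1 / 2 := by
    intro j hj
    have : (j : ℝ) ≤ N := by exact_mod_cast (Finset.mem_range.mp hj).le
    refine ⟨by positivity, ?_⟩
    simp only [ht]
    rw [div_le_div_iff₀ (by positivity) (by norm_num)]
    linarith
  set Z : ℕ → Set (En n) := fun j => AffineMap.homothety q₀ (1 - t j) '' Q with hZ
  have happ : ∀ j q, AffineMap.homothety q₀ (1 - t j) q = (1 - t j) • q + t j • q₀ := by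
    intro j q
    rw [AffineMap.homothety_apply, vsub_eq_sub, vadd_eq_add]
    module
  have hZm : ∀ j ∈ Finset.range N, MeasurableSet (Z j) := by
    intro j hj
    have h1 : 1 - t j ≠ 0 := by linarith [(ht0 j hj).2]
    simp only [hZ]
    exact ((AffineEquiv.homothetyUnitsMulHom q₀
      (Units.mk0 _ h1)).toContinuousAffineEquiv.toHomeomorph.measurableEmbedding).measurableSet_image.mpr hQ
  have hZP : ∀ j ∈ Finset.range N, Z j ⊆ P := by
    rintro j hj _ ⟨q, hq, rfl⟩
    rw [happ]
    exact hP (hQP hq) hq₀ (by linarith [(ht0 j hj).2]) (ht0 j hj).1 (by ring)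
  have hdist : ∀ i ∈ Finset.range N, ∀ j ∈ Finset.range N, i < j → Disjoint (Z i) (Z j) := by
    intro i hi j hj hij
    rw [Set.disjoint_left]
    rintro _ ⟨q, hq, rfl⟩ ⟨q', hq', heq⟩
    have h1 := congrArg ξ heq
    rw [happ, happ, hξ, hξ] at h1
    have h2 : (t j - t i) * (4 * N + 1) ≤ |(t j - t i) * ξ q₀| := by
      have : 0 ≤ t j - t i := by
        simp only [ht]
        rw [← sub_div]
        have : (i : ℝ) ≤ j := by exact_mod_cast hij.le
        apply div_nonneg <;> linarith
      rw [abs_mul, abs_of_nonneg this]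
      exact mul_le_mul_of_nonneg_left hlarge this
    have h3 : 2 < (t j - t i) * (4 * N + 1) := by
      have : t j - t i = (j - i) / (2 * N) := by simp only [ht]; ring
      rw [this, div_mul_eq_mul_div, lt_div_iff₀ (by positivity)]
      have : (i : ℝ) + 1 ≤ j := by exact_mod_cast hij
      nlinarith
    have h4 : (t j - t i) * ξ q₀ = (1 - t i) * ξ q - (1 - t j) * ξ q' := by linarith
    have h5 := abs_le.mp (hξQ q hq)
    have h6 := abs_le.mp (hξQ q' hq')
    have h7 : |(t j - t i) * ξ q₀| ≤ 2 := by
      rw [h4, abs_le]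
      have := ht0 i hi
      have := ht0 j hj
      constructor <;> nlinarith
    linarith
  have hvol : ∀ j ∈ Finset.range N, volume Q ≤ 2 ^ n * volume (Z j) := by
    intro j hj
    simp only [hZ]
    rw [Measure.addHaar_image_homothety, ← mul_assoc]
    refine le_mul_of_one_le_left zero_le ?_
    have h1 : (1 / 2 : ℝ) ≤ 1 - t j := by linarith [(ht0 j hj).2]
    have : (2 : ℝ≥0∞) ^ n = ENNReal.ofReal (2 ^ n) := by
      rw [ENNReal.ofReal_pow (by norm_num)]; norm_num
    rw [this, ← ENNReal.ofReal_mul (by positivity), ENNReal.one_le_ofReal, finrank_euclideanSpace,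
      Fintype.card_fin, abs_of_nonneg (by positivity), ← mul_pow]
    exact one_le_pow₀ (by linarith)
  calc N * volume Q = ∑ j ∈ Finset.range N, volume Q := by simp
    _ ≤ ∑ j ∈ Finset.range N, 2 ^ n * volume (Z j) := Finset.sum_le_sum hvol
    _ = 2 ^ n * volume (⋃ j ∈ Finset.range N, Z j) := by
        rw [← Finset.mul_sum, measure_biUnion_finset ?_ hZm]
        intro i hi j hj hij
        rcases lt_or_gt_of_ne hij with h | h
        · exact hdist i hi j hj h
        · exact (hdist j hj i hi h).symm
    _ ≤ _ := by
        gcongr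
        exact iUnion₂_subset hZP

variable {Ω : Set (En n)} {u : En n → ℝ}

lemma usec_mem_nhds (hΩ : IsOpen Ω) (hu : ConvexOn ℝ Ω u) {p x : En n} {c : ℝ} (hx : x ∈ Ω)
    (hlt : u x < ⟪p, x⟫ + c) : usec Ω u p c ∈ 𝓝 x := by
  have h1 : ContinuousAt u x := (hu.continuousOn hΩ).continuousAt (hΩ.mem_nhds hx)
  have h2 : ContinuousAt (fun y => ⟪p, y⟫ + c) x := by fun_prop
  filter_upwards [hΩ.mem_nhds hx, h1.eventually_lt h2 hlt] with y hy hy' using ⟨hy, hy'.le⟩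

open scoped Pointwise in
lemma volume_affine_image (a : En n) (r : ℝ) (A : Set (En n)) :
    volume ((fun q => a + r • q) '' A) = ENNReal.ofReal (|r| ^ n) * volume A := by
  have : (fun q => a + r • q) '' A = (fun q => a + q) '' (r • A) := by
    rw [← image_smul, image_image]
  rw [this]
  simp [Measure.addHaar_smul]

/-- Upper bound for the Monge–Ampère mass of a section. -/
lemma volume_mul_MAm_usec_le (n : ℕ) {D : ℝ≥0∞} (hD : D ≠ ⊤) : ∃ C : ℝ≥0∞, C ≠ ⊤ ∧
    ∀ (Ω : Set (En n)) (u : En n → ℝ), IsOpen Ω → ConvexOn ℝ Ω u → IsDoublingOn Ω (MAm Ω u) D →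
    ∀ (p : En n) (c H : ℝ), 0 < H → IsCompact (usec Ω u p c) →
    (∀ s ∈ usec Ω u p c, ⟪p, s⟫ + c - u s ≤ H) → (∃ x ∈ Ω, u x < ⟪p, x⟫ + c) →
    volume (usec Ω u p c) * MAm Ω u (usec Ω u p c) ≤ C * ENNReal.ofReal (H ^ n) := by
  obtain ⟨c₀, C₀, -, -, hC₀, hpol⟩ := exists_polar_bounds n
  refine ⟨C₀ * D * 2 ^ n, by simp [ENNReal.mul_eq_top, hD, hC₀], ?_⟩
  intro Ω u hΩ hu hdoub p c H hH hS hSH ⟨x, hx, hxlt⟩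
  set S := usec Ω u p c
  have hSc : Convex ℝ S := convex_usec hu p c
  have hSn : S ∈ 𝓝 x := usec_mem_nhds hΩ hu hx hxlt
  obtain ⟨-, z, hz, hzC⟩ := hpol S hS hSc ⟨x, mem_interior_iff_mem_nhds.mpr hSn⟩ x (mem_of_mem_nhds hSn)
  have hTS : IsCompact ((fun x => z + (1 / 2 : ℝ) • (x - z)) '' S) := hS.image (by fun_prop)
  have h1 := hdoub z S (fun s hs => hs.1) hS.measurableSet hSc hz hTS.measurableSet
  have h2 : (⋃ y ∈ (fun x => z + (1 / 2 : ℝ) • (x - z)) '' S, subgrad Ω u y) ⊆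
      (fun q => p + (2 * H) • q) '' polarAt S z := by
    intro q hq
    simp only [mem_iUnion, exists_prop, mem_image, exists_exists_and_eq_and] at hq
    obtain ⟨y, hy, hq⟩ := hq
    refine ⟨(2 * H)⁻¹ • (q - p), fun s hs => ?_, ?_⟩
    · have h3 : (1 / 2 : ℝ) • y + (1 / 2 : ℝ) • s ∈ S :=
        hSc hy hs (by norm_num) (by norm_num) (by norm_num)
      have h4 := hq _ h3.1
      have h5 := h3.2
      have hyS : z + (1 / 2 : ℝ) • (y - z) ∈ S := by
        have := hSc hz hy (by norm_num : (0 : ℝ) ≤ 1 / 2) (by norm_num : (0 : ℝ) ≤ 1 / 2) (by norm_num)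
        convert this using 1
        module
      have h6 := hSH _ hyS
      have h7 : (1 / 2 : ℝ) • y + (1 / 2 : ℝ) • s =
          (z + (1 / 2 : ℝ) • (y - z)) + (1 / 2 : ℝ) • (s - z) := by module
      rw [h7, add_sub_cancel_left, inner_smul_right] at h4
      rw [h7, inner_add_right, inner_smul_right] at h5
      rw [inner_smul_left, inner_sub_left]
      simp only [conj_trivial]
      rw [inv_mul_le_iff₀ (by positivity)]
      linarith
    · simp only [smul_smul]
      rw [mul_inv_cancel₀ (by positivity), one_smul]; abel
  have h3 : MAm Ω u ((fun x => z + (1 / 2 : ℝ) • (x - z)) '' S) ≤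
      2 ^ n * ENNReal.ofReal (H ^ n) * volume (polarAt S z) := by
    refine (measure_mono h2).trans ?_
    rw [volume_affine_image, abs_of_pos (by positivity), mul_pow, ENNReal.ofReal_mul (by positivity)]
    rw [ENNReal.ofReal_pow (by norm_num)]
    norm_num
  calc volume S * MAm Ω u S ≤ volume S * (D * (2 ^ n * ENNReal.ofReal (H ^ n) *
        volume (polarAt S z))) := by gcongr; exact h1.trans (by gcongr)
    _ = (volume (polarAt S z) * volume S) * D * 2 ^ n * ENNReal.ofReal (H ^ n) := by ring
    _ ≤ _ := by gcongr

/-- Lower bound for the Monge–Ampère mass of a section. -/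
lemma volume_polarAt_le_MAm (hΩ : IsOpen Ω) (hu : ConvexOn ℝ Ω u) {p x : En n} {c d : ℝ}
    (hS : IsCompact (usec Ω u p c)) (hx : x ∈ Ω) (hd : 0 < d) (hxd : d ≤ ⟪p, x⟫ + c - u x) :
    ENNReal.ofReal ((d / 2) ^ n) * volume (polarAt (usec Ω u p c) x) ≤
      MAm Ω u (usec Ω u p c) := by
  set S := usec Ω u p c
  have hxS : x ∈ S := ⟨hx, by linarith⟩
  rw [← abs_of_pos (half_pos hd), ← volume_affine_image p]
  refine measure_mono ?_
  rintro _ ⟨q, hq, rfl⟩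
  have hcont : ContinuousOn (fun y => u y - ⟪p + (d / 2) • q, y⟫) S :=
    ((hu.continuousOn hΩ).mono fun s hs => hs.1).sub (by fun_prop)
  obtain ⟨y, hy, hmin⟩ := hS.exists_isMinOn ⟨x, hxS⟩ hcont
  have h1 := hmin hxS
  simp only [mem_ofPred_eq, inner_add_left, inner_smul_left, conj_trivial] at h1
  have h2 := hq y hy
  rw [inner_sub_right] at h2
  have hlt : u y < ⟪p, y⟫ + c := by nlinarith
  simp only [mem_iUnion, exists_prop]
  refine ⟨y, hy, subgrad_of_eventually hu hy.1 ?_⟩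
  filter_upwards [usec_mem_nhds hΩ hu hy.1 hlt] with w hw
  have h3 := hmin hw
  simp only [mem_ofPred_eq] at h3
  rw [inner_sub_right]
  linarith

/-- Sections are balanced around points where the affine function is far above `u`. -/
lemma exists_balanced (n : ℕ) {D : ℝ≥0∞} (hD : D ≠ ⊤) : ∃ M₀ : ℝ, 0 < M₀ ∧
    ∀ (Ω : Set (En n)) (u : En n → ℝ), IsOpen Ω → ConvexOn ℝ Ω u → IsDoublingOn Ω (MAm Ω u) D →
    ∀ (p : En n) (c H : ℝ), 0 < H → IsCompact (usec Ω u p c) →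
    (∀ s ∈ usec Ω u p c, ⟪p, s⟫ + c - u s ≤ H) →
    ∀ x ∈ Ω, H / 2 ≤ ⟪p, x⟫ + c - u x → ∀ e : En n,
    (∀ s ∈ usec Ω u p c, -1 ≤ ⟪e, s - x⟫) → ∀ s ∈ usec Ω u p c, ⟪e, s - x⟫ < M₀ := by
  obtain ⟨C₁, hC₁, hup⟩ := volume_mul_MAm_usec_le n hD
  obtain ⟨c₀, C₀, hc₀, hc₀', -, hpol⟩ := exists_polar_bounds n
  obtain ⟨N, hN⟩ := ENNReal.exists_nat_mul_gt hc₀ (b := 2 ^ n * (C₁ * 4 ^ n))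
    (by simp [ENNReal.mul_eq_top, hC₁])
  refine ⟨4 * N + 1, by positivity, ?_⟩
  intro Ω u hΩ hu hdoub p c H hH hS hSH x hx hxH e he s hs
  by_contra! hlarge
  set S := usec Ω u p c
  have hSc : Convex ℝ S := convex_usec hu p c
  have hSn : S ∈ 𝓝 x := usec_mem_nhds hΩ hu hx (by linarith)
  have h1 := (hpol S hS hSc ⟨x, mem_interior_iff_mem_nhds.mpr hSn⟩ x (mem_of_mem_nhds hSn)).1
  have hQcl : IsClosed (symPolarAt S x) := by
    have : symPolarAt S x = ⋂ s ∈ S, {q | |⟪q, s - x⟫| ≤ 1} := by ext; simp [symPolarAt]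
    rw [this]
    exact isClosed_biInter fun s _ => isClosed_le (by fun_prop) (by fun_prop)
  have hPc : Convex ℝ (polarAt S x) := by
    intro q hq q' hq' a b ha hb hab s hs
    rw [inner_add_left, inner_smul_left, inner_smul_left]
    simp only [conj_trivial]
    have := hq s hs
    have := hq' s hs
    nlinarith
  have h2 := slab_volume_le (N := N) (Q := symPolarAt S x) hPc
    (fun q hq s hs => (le_abs_self _).trans (hq s hs)) hQcl.measurableSet
    (ξ := fun q => ⟪q, s - x⟫) (by
      intro q q' t
      rw [inner_add_left, inner_smul_left, inner_smul_left]; simp)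
    (fun q hq => hq s hs) (q₀ := -e)
    (by intro s' hs'; rw [inner_neg_left]; linarith [he s' hs'])
    (by rw [inner_neg_left, abs_neg]; exact hlarge.trans (le_abs_self _))
  have h3 := volume_polarAt_le_MAm hΩ hu hS hx (half_pos hH) hxH
  have h4 := hup Ω u hΩ hu hdoub p c H hH hS hSH ⟨x, hx, by linarith⟩
  have hHn : ENNReal.ofReal (H ^ n) ≠ 0 := by
    rw [ne_eq, ENNReal.ofReal_eq_zero, not_le]; positivity
  have h5 : volume (polarAt S x) * volume S ≤ C₁ * 4 ^ n := by
    have h6 : ENNReal.ofReal (H ^ n) = 4 ^ n * ENNReal.ofReal ((H / 2 / 2) ^ n) := by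
      have : (4 : ℝ≥0∞) ^ n = ENNReal.ofReal (4 ^ n) := by
        rw [ENNReal.ofReal_pow (by norm_num)]; norm_num
      rw [this, ← ENNReal.ofReal_mul (by positivity), ← mul_pow]
      ring_nf
    rw [← ENNReal.mul_le_mul_iff_right hHn ENNReal.ofReal_ne_top]
    calc ENNReal.ofReal (H ^ n) * (volume (polarAt S x) * volume S)
        = 4 ^ n * volume S * (ENNReal.ofReal ((H / 2 / 2) ^ n) * volume (polarAt S x)) := by
          rw [h6]; ring
      _ ≤ 4 ^ n * volume S * MAm Ω u S := by gcongr
      _ = 4 ^ n * (volume S * MAm Ω u S) := by ring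
      _ ≤ 4 ^ n * (C₁ * ENNReal.ofReal (H ^ n)) := by gcongr
      _ = _ := by ring
  refine absurd hN (not_lt.mpr ?_)
  calc N * c₀ ≤ N * (volume (symPolarAt S x) * volume S) := by gcongr
    _ = (N * volume (symPolarAt S x)) * volume S := by ring
    _ ≤ (2 ^ n * volume (polarAt S x)) * volume S := by gcongr
    _ = 2 ^ n * (volume (polarAt S x) * volume S) := by ring
    _ ≤ _ := by gcongr

end Balanced

section StrictContact
open Topology

variable {n : ℕ} {Ω : Set (En n)} {u : En n → ℝ}

/-- The affine function with slope `p` touches `u` from below at `y` and only there. -/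
def StrictContact (Ω : Set (En n)) (u : En n → ℝ) (y p : En n) : Prop :=
  y ∈ Ω ∧ p ∈ subgrad Ω u y ∧ ∀ x ∈ Ω, x ≠ y → u y + ⟪p, x - y⟫ < u x

lemma StrictContact.exists_gap (hΩ : IsOpen Ω) (hu : ConvexOn ℝ Ω u) {y p : En n}
    (h : StrictContact Ω u y p) {ρ : ℝ} (hρ : 0 < ρ) (hρΩ : Metric.closedBall y ρ ⊆ Ω) :
    ∃ m > 0, ∀ x ∈ Metric.sphere y ρ, m ≤ u x - (u y + ⟪p, x - y⟫) := by
  refine exists_pos_le_of_compact (isCompact_sphere y ρ) ?_ ?_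
  · exact ((hu.continuousOn hΩ).mono (Metric.sphere_subset_closedBall.trans hρΩ)).sub (by fun_prop)
  · intro x hx
    have hxy : x ≠ y := by
      rintro rfl
      simp at hx; linarith
    linarith [h.2.2 x (hρΩ (Metric.sphere_subset_closedBall hx)) hxy]

/-- At a strict contact point the subgradient is a singleton. -/
lemma StrictContact.subgrad_subset (hΩ : IsOpen Ω) (hu : ConvexOn ℝ Ω u) {D : ℝ≥0∞} (hD : D ≠ ⊤)
    (hdoub : IsDoublingOn Ω (MAm Ω u) D) {y p₀ : En n} (h : StrictContact Ω u y p₀) :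
    subgrad Ω u y ⊆ {p₀} := by
  intro q hq
  by_contra hne
  have hne : q ≠ p₀ := hne
  have hy := h.1
  have hp₀ := h.2.1
  obtain ⟨ρ, hρ, hρΩ⟩ := Metric.nhds_basis_closedBall.mem_iff.mp (hΩ.mem_nhds hy)
  obtain ⟨m, hm, hgap⟩ := h.exists_gap hΩ hu hρ hρΩ
  set e₀ := q - p₀
  obtain ⟨p₁, hp₁, hmax⟩ := (isCompact_subgrad hΩ hu hy).exists_isMaxOn ⟨q, hq⟩
    (f := fun p => ⟪p, e₀⟫) (by fun_prop)
  set e := p₁ - p₀ with he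
  set κ := ⟪e, e₀⟫ with hκ
  have hκ0 : 0 < κ := by
    have h1 : ⟪q, e₀⟫ ≤ ⟪p₁, e₀⟫ := hmax hq
    have h2 : 0 < ⟪e₀, e₀⟫ := real_inner_self_pos.mpr (sub_ne_zero.mpr hne)
    have h3 : ⟪e₀, e₀⟫ = ⟪q, e₀⟫ - ⟪p₀, e₀⟫ := inner_sub_left _ _ _
    rw [hκ, he, inner_sub_left]; linarith
  obtain ⟨M₀, hM₀, hbal⟩ := exists_balanced n hD
  set t : ℝ := 1 / (2 * M₀ + 1) with ht
  have ht0 : 0 < t := by positivity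
  have ht1 : t < 1 := by rw [ht, div_lt_one (by positivity)]; linarith
  have htM : (1 - t) / (2 * t) = M₀ := by rw [ht]; field_simp; ring
  set pt := p₁ - t • e with hpt
  have hpt' : pt = (1 - t) • p₁ + t • p₀ := by rw [hpt, he]; module
  have hU : ∀ᶠ z in 𝓝 y, subgrad Ω u z ⊆ {p | ⟪p, e₀⟫ < ⟪p₁, e₀⟫ + t * κ} := by
    refine eventually_subgrad_subset hΩ hu hy (isOpen_lt (by fun_prop) (by fun_prop)) ?_
    intro p hp
    have h1 : ⟪p, e₀⟫ ≤ ⟪p₁, e₀⟫ := hmax hp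
    have : 0 < t * κ := by positivity
    simp only [mem_ofPred_eq]; linarith
  have htend : Filter.Tendsto (fun η : ℝ => y + η • e₀) (𝓝[>] 0) (𝓝 y) := by
    have : ContinuousAt (fun η : ℝ => y + η • e₀) 0 := by fun_prop
    have h2 := this.tendsto
    simp only [zero_smul, add_zero] at h2
    exact h2.mono_left nhdsWithin_le_nhds
  have hsm : ∀ᶠ η : ℝ in 𝓝[>] 0, η < m / (2 * κ) :=
    nhdsWithin_le_nhds (Iio_mem_nhds (by positivity))
  obtain ⟨η, ⟨hηU, hηΩ⟩, hηm, hη⟩ := ((htend.eventually (hU.and (hΩ.mem_nhds hy))).and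
    (hsm.and self_mem_nhdsWithin)).exists
  have hη : 0 < η := hη
  set δ := 2 * t * κ * η with hδ
  have hδ0 : 0 < δ := by positivity
  have hδm : δ < t * m := by
    rw [lt_div_iff₀ (by positivity)] at hηm
    rw [hδ]; nlinarith
  set c := u y - ⟪pt, y⟫ + δ with hc
  have hl : ∀ x, ⟪pt, x⟫ + c = u y + (1 - t) * ⟪p₁, x - y⟫ + t * ⟪p₀, x - y⟫ + δ := by
    intro x
    rw [hc, hpt']
    simp only [inner_add_left, inner_smul_left, inner_sub_right, conj_trivial]
    ring
  have hyS : y ∈ usec Ω u pt c := ⟨hy, by rw [hl]; simp [hδ0.le]⟩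
  have hSρ : usec Ω u pt c ⊆ Metric.ball y ρ := by
    refine usec_subset_ball hu (fun x hx => ?_) (Metric.mem_closedBall_self hρ.le) hyS
    rw [hl]
    have h1 := hgap x hx
    have h2 := hp₁ x (hρΩ (Metric.sphere_subset_closedBall hx))
    nlinarith
  have hS := isCompact_usec hΩ hu hρΩ (hSρ.trans Metric.ball_subset_closedBall)
  have hdep : ∀ s ∈ usec Ω u pt c, ⟪pt, s⟫ + c - u s ≤ δ := by
    intro s hs
    rw [hl]
    have h1 := hp₁ s hs.1
    have h2 := hp₀ s hs.1
    nlinarith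
  have hbal' := hbal Ω u hΩ hu hdoub pt c δ hδ0 hS hdep y hy (by rw [hl]; simp; linarith)
    (((1 - t) / δ) • e) (by
      intro s hs
      have h1 := hs.2
      rw [hl] at h1
      have h2 := hp₀ s hs.1
      have h3 : ⟪e, s - y⟫ = ⟪p₁, s - y⟫ - ⟪p₀, s - y⟫ := by rw [he, inner_sub_left]
      rw [inner_smul_left, conj_trivial, div_mul_eq_mul_div, le_div_iff₀ hδ0, h3]
      linarith) (y + η • e₀) (by
      refine ⟨hηΩ, ?_⟩
      obtain ⟨pη, hpη⟩ := subgrad_nonempty hΩ hu hηΩ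
      have h1 := hηU hpη
      have h2 := hpη y hy
      simp only [mem_ofPred_eq] at h1
      rw [sub_add_cancel_left, inner_neg_right, inner_smul_right] at h2
      rw [hl, add_sub_cancel_left, inner_smul_right, inner_smul_right]
      have h3 : κ = ⟪p₁, e₀⟫ - ⟪p₀, e₀⟫ := by rw [hκ, he, inner_sub_left]
      have h4 : η * ⟪pη, e₀⟫ ≤ η * (⟪p₁, e₀⟫ + t * κ) := mul_le_mul_of_nonneg_left h1.le hη.le
      have h5 : ⟪p₀, e₀⟫ = ⟪p₁, e₀⟫ - κ := by linarith
      rw [h5, hδ]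
      nlinarith)
  rw [add_sub_cancel_left, inner_smul_left, inner_smul_right, conj_trivial, ← hκ] at hbal'
  have : (1 - t) / δ * (η * κ) = (1 - t) / (2 * t) := by rw [hδ]; field_simp
  rw [this, htM] at hbal'
  exact lt_irrefl _ hbal'

/-- A supporting affine function which stays strictly below `u` on a sphere around the contact
point touches at one point only. -/
lemma strictContact_of_sphere (hΩ : IsOpen Ω) (hu : ConvexOn ℝ Ω u) {D : ℝ≥0∞} (hD : D ≠ ⊤)
    (hdoub : IsDoublingOn Ω (MAm Ω u) D) {a z p : En n} {ρ : ℝ}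
    (hρΩ : Metric.closedBall a ρ ⊆ Ω) (hz : z ∈ Metric.ball a ρ) (hp : p ∈ subgrad Ω u z)
    (hsph : ∀ x ∈ Metric.sphere a ρ, u z + ⟪p, x - z⟫ < u x) : StrictContact Ω u z p := by
  have hzΩ : z ∈ Ω := hρΩ (Metric.ball_subset_closedBall hz)
  refine ⟨hzΩ, hp, fun x hx hxz => ?_⟩
  by_contra! hxle
  have hcont := hu.continuousOn hΩ
  set c₀ := u z - ⟪p, z⟫ with hc₀
  have hl₀ : ∀ x, ⟪p, x⟫ + c₀ = u z + ⟪p, x - z⟫ := fun x => by rw [hc₀, inner_sub_right]; ring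
  set C := usec Ω u p c₀
  have hzC : z ∈ C := ⟨hzΩ, by rw [hl₀]; simp⟩
  have hCρ : C ⊆ Metric.ball a ρ := usec_subset_ball hu (fun x hx => by rw [hl₀]; exact hsph x hx)
    (Metric.ball_subset_closedBall hz) hzC
  have hCc : IsCompact C := isCompact_usec hΩ hu hρΩ (hCρ.trans Metric.ball_subset_closedBall)
  obtain ⟨xs, hxs, hfar⟩ := hCc.exists_isMaxOn ⟨z, hzC⟩ (f := fun x => ‖x - z‖) (by fun_prop)
  have hxC : x ∈ C := ⟨hx, by rw [hl₀]; exact hxle⟩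
  set e := xs - z with he
  have he0 : 0 < ‖e‖ := (norm_pos_iff.mpr (sub_ne_zero.mpr hxz)).trans_le (hfar hxC)
  obtain ⟨M₀, hM₀, hbal⟩ := exists_balanced n hD
  set η := ‖e‖ ^ 2 / (M₀ + 1) with hη
  have hη0 : 0 < η := by positivity
  have hηe : η ≤ ‖e‖ ^ 2 := div_le_self (by positivity) (by linarith)
  have hg : ContinuousOn (fun x => u x - (u z + ⟪p, x - z⟫)) (Metric.closedBall a ρ) :=
    (hcont.mono hρΩ).sub (by fun_prop)
  obtain ⟨m₁, hm₁, hgap₁⟩ := exists_pos_le_of_compact (isCompact_sphere a ρ)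
    (hg.mono Metric.sphere_subset_closedBall) (fun x hx => by linarith [hsph x hx])
  obtain ⟨m₂, hm₂, hgap₂⟩ := exists_pos_le_of_compact
    ((isCompact_closedBall a ρ).inter_right (t := {x | η ≤ ⟪e, x - xs⟫})
      (isClosed_le (by fun_prop) (by fun_prop))) (hg.mono inter_subset_left) (by
      rintro x ⟨hxρ, hxη⟩
      by_contra! hle
      have hxC : x ∈ C := ⟨hρΩ hxρ, by rw [hl₀]; linarith⟩
      have h1 : ‖x - z‖ ≤ ‖e‖ := hfar hxC
      have h2 : ⟪e, x - z⟫ ≤ ‖e‖ * ‖x - z‖ := real_inner_le_norm _ _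
      have h3 : x - xs = (x - z) - e := by rw [he]; abel
      simp only [mem_ofPred_eq] at hxη
      rw [h3, inner_sub_right, real_inner_self_eq_norm_sq] at hxη
      nlinarith)
  have hρ0 : 0 < ρ := Metric.pos_of_mem_ball hz
  have hbd : ∀ x ∈ Metric.closedBall a ρ, ⟪e, x - z⟫ ≤ ‖e‖ * (2 * ρ) := by
    intro x hx
    refine (real_inner_le_norm _ _).trans (mul_le_mul_of_nonneg_left ?_ he0.le)
    rw [← dist_eq_norm]
    have := dist_triangle_right x z a
    have h1 : dist x a ≤ ρ := hx
    have h2 : dist z a < ρ := hz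
    linarith
  obtain ⟨ε, hε, hεm⟩ : ∃ ε > 0, ε * (‖e‖ * (2 * ρ)) < min m₁ m₂ := by
    refine ⟨min m₁ m₂ / (2 * (‖e‖ * (2 * ρ))), by have := lt_min hm₁ hm₂; positivity, ?_⟩
    have := lt_min hm₁ hm₂
    have h4 : min m₁ m₂ / (2 * (‖e‖ * (2 * ρ))) * (‖e‖ * (2 * ρ)) = min m₁ m₂ / 2 := by field_simp
    linarith
  set c := c₀ - ε * ⟪e, z⟫ with hc
  have hl : ∀ x, ⟪p + ε • e, x⟫ + c = u z + ⟪p, x - z⟫ + ε * ⟪e, x - z⟫ := by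
    intro x
    rw [hc, hc₀]
    simp only [inner_add_left, inner_smul_left, inner_sub_right, conj_trivial]
    ring
  have hzS : z ∈ usec Ω u (p + ε • e) c := ⟨hzΩ, by rw [hl]; simp⟩
  have hSρ : usec Ω u (p + ε • e) c ⊆ Metric.ball a ρ := by
    refine usec_subset_ball hu (fun x hx => ?_) (Metric.ball_subset_closedBall hz) hzS
    rw [hl]
    have h1 := hgap₁ x hx
    have h2 := hbd x (Metric.sphere_subset_closedBall hx)
    have := min_le_left m₁ m₂
    nlinarith
  have hSη : ∀ x ∈ usec Ω u (p + ε • e) c, ⟪e, x - xs⟫ < η := by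
    intro x hx
    by_contra! hle
    have hxρ := Metric.ball_subset_closedBall (hSρ hx)
    have h1 := hgap₂ x ⟨hxρ, hle⟩
    have h2 := hbd x hxρ
    have h3 := hx.2
    rw [hl] at h3
    have := min_le_right m₁ m₂
    nlinarith
  have hS := isCompact_usec hΩ hu hρΩ (hSρ.trans Metric.ball_subset_closedBall)
  have hdec : ∀ x, ⟪e, x - z⟫ = ⟪e, x - xs⟫ + ‖e‖ ^ 2 := by
    intro x
    rw [← real_inner_self_eq_norm_sq, ← inner_add_right, he]
    congr 1; abel
  have hcontact : u xs = u z + ⟪p, xs - z⟫ := by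
    refine le_antisymm ?_ (hp xs hxs.1)
    rw [← hl₀]; exact hxs.2
  have key := hbal Ω u hΩ hu hdoub (p + ε • e) c (ε * (2 * ‖e‖ ^ 2)) (by positivity) hS
    (by
      intro s hs
      rw [hl]
      have h1 := hp s hs.1
      have h2 := hSη s hs
      have h3 := hdec s
      nlinarith) xs hxs.1 (by
      rw [hl, hcontact, hdec xs]
      simp; linarith) (-(η⁻¹ • e)) (by
      intro s hs
      rw [inner_neg_left, inner_smul_left, conj_trivial, neg_le_neg_iff, inv_mul_le_iff₀ hη0, mul_one]
      exact (hSη s hs).le) z hzS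
  have hzx : z - xs = -e := by rw [he]; abel
  rw [hzx, inner_neg_neg, inner_smul_left, conj_trivial, real_inner_self_eq_norm_sq, hη] at key
  have : (‖e‖ ^ 2 / (M₀ + 1))⁻¹ * ‖e‖ ^ 2 = M₀ + 1 := by field_simp
  linarith

/-- Strict contact is an open condition. -/
lemma StrictContact.eventually (hΩ : IsOpen Ω) (hu : ConvexOn ℝ Ω u) {D : ℝ≥0∞} (hD : D ≠ ⊤)
    (hdoub : IsDoublingOn Ω (MAm Ω u) D) {x₀ p₀ : En n} (h : StrictContact Ω u x₀ p₀) :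
    ∀ᶠ z in 𝓝 x₀, ∀ p ∈ subgrad Ω u z, StrictContact Ω u z p := by
  have hx₀ := h.1
  have hp₀ := h.2.1
  obtain ⟨ρ, hρ, hρΩ⟩ := Metric.nhds_basis_closedBall.mem_iff.mp (hΩ.mem_nhds hx₀)
  obtain ⟨m, hm, hgap⟩ := h.exists_gap hΩ hu hρ hρΩ
  have h1 := eventually_subgrad_dist_lt hΩ hu hx₀ (h.subgrad_subset hΩ hu hD hdoub)
    (ε := m / (8 * ρ)) (by positivity)
  have hcont := (hu.continuousOn hΩ).continuousAt (hΩ.mem_nhds hx₀)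
  have h2 : ∀ᶠ z in 𝓝 x₀, u z - ⟪p₀, z⟫ < u x₀ - ⟪p₀, x₀⟫ + m / 4 :=
    (hcont.sub (by fun_prop)).eventually_lt continuousAt_const (by simp only [Pi.sub_apply]; linarith)
  filter_upwards [h1, h2, Metric.ball_mem_nhds x₀ hρ] with z hz1 hz2 hzρ p hp
  refine strictContact_of_sphere hΩ hu hD hdoub hρΩ hzρ hp fun x hx => ?_
  have h3 := hgap x hx
  have h4 := hz1 p hp
  have h5 : ⟪p - p₀, x - z⟫ ≤ m / (8 * ρ) * (2 * ρ) := by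
    refine (real_inner_le_norm _ _).trans ?_
    rw [← dist_eq_norm, ← dist_eq_norm]
    refine mul_le_mul h4.le ?_ dist_nonneg (by positivity)
    have := dist_triangle_right x z x₀
    have h6 : dist x x₀ = ρ := hx
    have h7 : dist z x₀ < ρ := hzρ
    linarith
  have h8 : m / (8 * ρ) * (2 * ρ) = m / 4 := by field_simp; ring
  rw [h8, inner_sub_left] at h5
  simp only [inner_sub_right] at h5 h3 ⊢
  linarith

end StrictContact

section SecondOrder
open Topology

variable {n : ℕ} {Ω : Set (En n)} {u : En n → ℝ}

lemma LipschitzWith.volume_image_null {K : NNReal} {J : En n → En n} (hJ : LipschitzWith K J)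
    {N : Set (En n)} (hN : volume N = 0) : volume (J '' N) = 0 := by
  have h1 : (volume : Measure (En n)) ≪ Measure.hausdorffMeasure (Module.finrank ℝ (En n)) := by
    exact Measure.absolutelyContinuous_isAddHaarMeasure _ _
  have h2 : Measure.hausdorffMeasure (Module.finrank ℝ (En n)) ≪ (volume : Measure (En n)) := by
    exact Measure.absolutelyContinuous_isAddHaarMeasure _ _
  refine h1 (le_antisymm ((hJ.hausdorffMeasure_image_le (by positivity) N).trans ?_) bot_le)
  rw [h2 hN, mul_zero]

/-- The maximizer `J z` of `⟪z, x⟫ - ‖x‖ ^ 2 / 2 - w x` over a convex body depends on `z` in a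
Lipschitz way, is a gradient, and inverts `x ↦ x + ∂w x`. -/
lemma exists_resolvent {B : Set (En n)} (hB : IsCompact B) (hBne : B.Nonempty)
    {w : En n → ℝ} (hw : ConvexOn ℝ B w) (hwc : ContinuousOn w B) :
    ∃ (J : En n → En n) (Φ : En n → ℝ), LipschitzWith 2 J ∧
      (∀ z, HasFDerivAt Φ (innerSL ℝ (J z)) z) ∧
      ∀ x ∈ B, ∀ q, (∀ y ∈ B, w x + ⟪q, y - x⟫ ≤ w y) → J (x + q) = x := by
  set ψ : En n → En n → ℝ := fun z x => ⟪z, x⟫ - ‖x‖ ^ 2 / 2 - w x with hψ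
  have hex : ∀ z, ∃ x ∈ B, ∀ y ∈ B, ψ z y ≤ ψ z x := fun z =>
    hB.exists_isMaxOn hBne (f := ψ z) (by fun_prop)
  choose J hJB hJ using hex
  have key : ∀ z, ∀ x ∈ B, ψ z x + ‖x - J z‖ ^ 2 / 4 ≤ ψ z (J z) := by
    intro z x hx
    have h1 := hJ z _ (hw.1 hx (hJB z) (show (0 : ℝ) ≤ 1/2 by norm_num)
      (show (0 : ℝ) ≤ 1/2 by norm_num) (by norm_num))
    have h2 := hw.2 hx (hJB z) (show (0 : ℝ) ≤ 1/2 by norm_num)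
      (show (0 : ℝ) ≤ 1/2 by norm_num) (by norm_num)
    simp only [hψ, smul_eq_mul, inner_add_right, inner_smul_right] at h1 h2 ⊢
    have h3 : ‖(1/2 : ℝ) • x + (1/2 : ℝ) • J z‖ ^ 2 =
        ‖x‖ ^ 2 / 2 + ‖J z‖ ^ 2 / 2 - ‖x - J z‖ ^ 2 / 4 := by
      simp only [← real_inner_self_eq_norm_sq, inner_add_left, inner_add_right, inner_sub_left,
        inner_sub_right, inner_smul_left, inner_smul_right, conj_trivial]
      ring
    rw [h3] at h1
    linarith
  have hmono : ∀ z z', ‖J z' - J z‖ ^ 2 / 2 ≤ ⟪z' - z, J z' - J z⟫ := by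
    intro z z'
    have h1 := key z _ (hJB z')
    have h2 := key z' _ (hJB z)
    rw [norm_sub_rev (J z)] at h2
    simp only [hψ, inner_sub_left, inner_sub_right] at h1 h2 ⊢
    linarith
  have hlip : ∀ z z', ‖J z' - J z‖ ≤ 2 * ‖z' - z‖ := by
    intro z z'
    have h1 := hmono z z'
    have h2 := real_inner_le_norm (z' - z) (J z' - J z)
    by_contra! hlt
    have : 0 < ‖J z' - J z‖ := lt_of_le_of_lt (by positivity) hlt
    nlinarith
  refine ⟨J, fun z => ψ z (J z), ?_, ?_, ?_⟩
  · refine LipschitzWith.of_dist_le_mul fun z z' => ?_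
    rw [dist_eq_norm, dist_eq_norm]
    exact hlip z' z
  · intro z
    rw [hasFDerivAt_iff_isLittleO_nhds_zero]
    have h2 : (fun h : En n => ψ (z + h) (J (z + h)) - ψ z (J z) - innerSL ℝ (J z) h) =O[𝓝 0]
        fun h => ‖h‖ ^ 2 := by
      refine Asymptotics.IsBigO.of_bound 2 (Filter.Eventually.of_forall fun h => ?_)
      have h1 := hJ z _ (hJB (z + h))
      have h2 := hJ (z + h) _ (hJB z)
      have h3 := hlip z (z + h)
      have h4 := real_inner_le_norm h (J (z + h) - J z)
      rw [add_sub_cancel_left] at h3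
      have h5 : ‖h‖ * ‖J (z + h) - J z‖ ≤ ‖h‖ * (2 * ‖h‖) :=
        mul_le_mul_of_nonneg_left h3 (norm_nonneg _)
      simp only [hψ, innerSL_apply_apply, inner_add_left, inner_sub_right] at h1 h2 h4 ⊢
      rw [real_inner_comm h (J z)]
      rw [Real.norm_eq_abs, abs_le, Real.norm_eq_abs, abs_of_nonneg (by positivity)]
      constructor <;> nlinarith [sq_nonneg ‖h‖]
    exact h2.trans_isLittleO (Asymptotics.isLittleO_norm_pow_id one_lt_two)
  · intro x hx q hq
    have h1 := key (x + q) x hx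
    have h2 := hq _ (hJB (x + q))
    simp only [hψ, inner_add_left, inner_sub_right, real_inner_self_eq_norm_sq] at h1 h2
    have h3 : ‖x - J (x + q)‖ ^ 2 = ‖x‖ ^ 2 - 2 * ⟪x, J (x + q)⟫ + ‖J (x + q)‖ ^ 2 :=
      norm_sub_sq_real _ _
    have h4 : ‖x - J (x + q)‖ ^ 2 = 0 := le_antisymm (by nlinarith) (by positivity)
    have h5 : x - J (x + q) = 0 := by simpa using h4
    exact (sub_eq_zero.mp h5).symm

lemma subgrad_subset_of_hasFDerivAt (hΩ : IsOpen Ω) {x : En n} (hx : x ∈ Ω)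
    {u' : En n →L[ℝ] ℝ} (hd : HasFDerivAt u u' x) {p : En n} (hp : p ∈ subgrad Ω u x) :
    innerSL ℝ p = u' := by
  have hmin : IsLocalMin (fun y => u y - ⟪p, y - x⟫) x := by
    filter_upwards [hΩ.mem_nhds hx] with y hy
    have := hp y hy
    simp; linarith
  have h2 : HasFDerivAt (fun y => u y - ⟪p, y - x⟫) (u' - innerSL ℝ p) x := by
    refine hd.sub ?_
    have := ((innerSL ℝ p).hasFDerivAt (x := x)).sub_const (innerSL ℝ p x)
    simpa [inner_sub_right] using this
  exact (sub_eq_zero.mp (hmin.hasFDerivAt_eq_zero h2)).symm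

lemma ae_subgrad_subsingleton (hΩ : IsOpen Ω) (hu : ConvexOn ℝ Ω u) :
    ∀ᵐ x, x ∈ Ω → (subgrad Ω u x).Subsingleton := by
  have h : volume {x | x ∈ Ω ∧ ¬ DifferentiableAt ℝ u x} = 0 := by
    refine measure_null_of_locally_null _ fun x hx => ?_
    obtain ⟨K, t, ht, hK⟩ := hu.locallyLipschitzOn hΩ hx.1
    rw [hΩ.nhdsWithin_eq hx.1] at ht
    obtain ⟨t', ht't, ht'o, hxt'⟩ := mem_nhds_iff.mp ht
    refine ⟨{x | x ∈ Ω ∧ ¬ DifferentiableAt ℝ u x} ∩ t',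
      Filter.inter_mem self_mem_nhdsWithin (mem_nhdsWithin_of_mem_nhds (ht'o.mem_nhds hxt')), ?_⟩
    have h1 := (hK.mono ht't).ae_differentiableWithinAt_of_mem (μ := volume)
    refine measure_mono_null ?_ h1
    intro y hy hyd
    exact hy.1.2 ((hyd hy.2).differentiableAt (ht'o.mem_nhds hy.2))
  filter_upwards [measure_eq_zero_iff_ae_notMem.mp h] with x hx hxΩ p hp q hq
  have hd : DifferentiableAt ℝ u x := by
    by_contra hnd
    exact hx ⟨hxΩ, hnd⟩
  have := (subgrad_subset_of_hasFDerivAt hΩ hxΩ hd.hasFDerivAt hp).trans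
    (subgrad_subset_of_hasFDerivAt hΩ hxΩ hd.hasFDerivAt hq).symm
  exact (innerSL_inj (𝕜 := ℝ)).mp this

/-- Alexandrov: a selection of the subgradient of a convex function is differentiable almost
everywhere, with symmetric nonnegative derivative. -/
lemma ae_hasFDerivAt_subgrad (hΩ : IsOpen Ω) (hu : ConvexOn ℝ Ω u) {q : En n → En n}
    (hq : ∀ x ∈ Ω, q x ∈ subgrad Ω u x) :
    ∀ᵐ x, x ∈ Ω → subgrad Ω u x = {q x} ∧ ∃ A : En n →L[ℝ] En n, HasFDerivAt q A x ∧
      (∀ h k, ⟪A h, k⟫ = ⟪h, A k⟫) ∧ ∀ h, 0 ≤ ⟪A h, h⟫ := by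
  set P : En n → Prop := fun x => ∃ A : En n →L[ℝ] En n, HasFDerivAt q A x ∧
      (∀ h k, ⟪A h, k⟫ = ⟪h, A k⟫) ∧ ∀ h, 0 ≤ ⟪A h, h⟫ with hP
  suffices h : volume {x | x ∈ Ω ∧ ¬ (subgrad Ω u x = {q x} ∧ P x)} = 0 by
    filter_upwards [measure_eq_zero_iff_ae_notMem.mp h] with x hx hxΩ
    by_contra hc
    exact hx ⟨hxΩ, hc⟩
  refine measure_null_of_locally_null _ fun x₀ hx₀ => ?_
  obtain ⟨ρ, hρ, hρΩ⟩ := Metric.nhds_basis_closedBall.mem_iff.mp (hΩ.mem_nhds hx₀.1)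
  obtain ⟨J, Φ, hJL, hΦ, hJ⟩ := exists_resolvent (isCompact_closedBall x₀ ρ)
    ⟨x₀, Metric.mem_closedBall_self hρ.le⟩ (hu.subset hρΩ (convex_closedBall _ _))
    ((hu.continuousOn hΩ).mono hρΩ)
  have hJq : ∀ x ∈ Metric.closedBall x₀ ρ, J (x + q x) = x := fun x hx =>
    hJ x hx _ fun y hy => hq x (hρΩ hx) y (hρΩ hy)
  set N₁ := {z | ¬ DifferentiableAt ℝ J z}
  set N₂ := {z | DifferentiableAt ℝ J z ∧ (fderiv ℝ J z).det = 0}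
  have hN₁ : volume (J '' N₁) = 0 := hJL.volume_image_null hJL.ae_differentiableAt
  have hN₂ : volume (J '' N₂) = 0 :=
    addHaar_image_eq_zero_of_det_fderivWithin_eq_zero volume
      (fun z hz => hz.1.hasFDerivAt.hasFDerivWithinAt) fun z hz => hz.2
  refine ⟨{x | x ∈ Ω ∧ ¬ (subgrad Ω u x = {q x} ∧ P x)} ∩ Metric.ball x₀ ρ, Filter.inter_mem
    self_mem_nhdsWithin (mem_nhdsWithin_of_mem_nhds (Metric.ball_mem_nhds x₀ hρ)), ?_⟩
  refine measure_mono_null (t := (J '' N₁ ∪ J '' N₂) ∪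
    {x | ¬ (x ∈ Ω → (subgrad Ω u x).Subsingleton)}) ?_
    (measure_union_null (measure_union_null hN₁ hN₂) (ae_subgrad_subsingleton hΩ hu))
  rintro x ⟨⟨hxΩ, hbad⟩, hxρ⟩
  by_contra hgood
  simp only [mem_union, not_or, mem_ofPred_eq, not_not] at hgood
  obtain ⟨⟨hx1, hx2⟩, hx3⟩ := hgood
  have hsing : subgrad Ω u x = {q x} := (hx3 hxΩ).eq_singleton_of_mem (hq x hxΩ)
  refine hbad ⟨hsing, ?_⟩
  have hJx := hJq x (Metric.ball_subset_closedBall hxρ)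
  have hdiff : DifferentiableAt ℝ J (x + q x) := by
    by_contra hnd
    exact hx1 ⟨x + q x, hnd, hJx⟩
  set L := fderiv ℝ J (x + q x) with hL
  have hdet : L.det ≠ 0 := fun h0 => hx2 ⟨x + q x, ⟨hdiff, h0⟩, hJx⟩
  set Le := L.toContinuousLinearEquivOfDetNeZero hdet with hLe
  have hLe' : (Le : En n →L[ℝ] En n) = L := by ext; simp [hLe]
  have hLsymm : ∀ h k, ⟪L h, k⟫ = ⟪L k, h⟫ := by
    intro h k
    have h1 : HasFDerivAt (fun z => innerSL ℝ (J z)) ((innerSL ℝ).comp L) (x + q x) :=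
      (innerSL ℝ).hasFDerivAt.comp (x + q x) hdiff.hasFDerivAt
    have := second_derivative_symmetric hΦ h1 h k
    simpa using this
  have hqc : ContinuousAt q x := by
    rw [Metric.continuousAt_iff']
    intro ε hε
    filter_upwards [eventually_subgrad_dist_lt hΩ hu hxΩ hsing.subset hε, hΩ.mem_nhds hxΩ]
      with y hy hyΩ using hy _ (hq y hyΩ)
  have hg : HasFDerivAt (fun y => y + q y) (Le.symm : En n →L[ℝ] En n) x := by
    refine HasFDerivAt.of_local_left_inverse (f := J) (continuousAt_id.add hqc) ?_ ?_
    · rw [hLe']; exact hdiff.hasFDerivAt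
    · filter_upwards [Metric.isOpen_ball.mem_nhds hxρ] with y hy
        using hJq y (Metric.ball_subset_closedBall hy)
  have hqd : HasFDerivAt q ((Le.symm : En n →L[ℝ] En n) - ContinuousLinearMap.id ℝ (En n)) x := by
    have := hg.sub (hasFDerivAt_id x)
    refine this.congr_of_eventuallyEq (Filter.Eventually.of_forall fun y => ?_)
    simp
  refine ⟨_, hqd, ?_, ?_⟩
  · intro h k
    have h1 := hLsymm (Le.symm h) (Le.symm k)
    have h2 : ∀ a, L (Le.symm a) = a := fun a => by
      rw [← hLe']; simp
    rw [h2, h2] at h1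
    simp only [_root_.sub_apply, inner_sub_left, inner_sub_right,
      ContinuousLinearEquiv.coe_coe, ContinuousLinearMap.id_apply]
    rw [h1, real_inner_comm, real_inner_comm k]
  · intro h
    set A := (Le.symm : En n →L[ℝ] En n) - ContinuousLinearMap.id ℝ (En n)
    have h1 : HasDerivAt (fun t : ℝ => ⟪q (x + t • h), h⟫) ⟪A h, h⟫ 0 := by
      have h2 : HasDerivAt (fun t : ℝ => x + t • h) h 0 := by
        simpa using ((hasDerivAt_id (0 : ℝ)).smul_const h).const_add x
      have h3 : HasFDerivAt q A (x + (0 : ℝ) • h) := by simpa using hqd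
      have h4 := (h3.comp_hasDerivAt (0 : ℝ) h2).inner ℝ (hasDerivAt_const (0 : ℝ) h)
      simpa using h4
    have h5 := h1.tendsto_slope_zero_right
    refine ge_of_tendsto h5 ?_
    have h6 : ∀ᶠ t : ℝ in 𝓝[>] 0, x + t • h ∈ Ω := by
      have : ContinuousAt (fun t : ℝ => x + t • h) 0 := by fun_prop
      have h7 := this.tendsto
      simp only [zero_smul, add_zero] at h7
      exact (h7.mono_left nhdsWithin_le_nhds).eventually (hΩ.mem_nhds hxΩ)
    filter_upwards [h6, self_mem_nhdsWithin] with t ht ht0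
    have ht0 : 0 < t := ht0
    have h8 := subgrad_mono ht hxΩ (hq _ ht) (hq x hxΩ)
    rw [add_sub_cancel_left, inner_smul_right, inner_sub_left] at h8
    simp only [zero_add, zero_smul, add_zero, smul_eq_mul]
    have : 0 ≤ ⟪q (x + t • h), h⟫ - ⟪q x, h⟫ := nonneg_of_mul_nonneg_right h8 ht0
    positivity

end SecondOrder

section Superadditivity
open Topology

variable {n : ℕ} {Ω : Set (En n)} {u : En n → ℝ}

/-- Almost every slope supports a given function at one point at most. -/
lemma volume_common_slopes_eq_zero {N : Set (En n)} (hN : IsCompact N) {c : En n → ℝ}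
    (hc : ContinuousOn c N) :
    volume {q | ∃ x ∈ N, ∃ x' ∈ N, x ≠ x' ∧ q ∈ subgrad N c x ∧ q ∈ subgrad N c x'} = 0 := by
  rcases N.eq_empty_or_nonempty with rfl | hne
  · simp
  have hex : ∀ q, ∃ x ∈ N, ∀ y ∈ N, ⟪q, y⟫ - c y ≤ ⟪q, x⟫ - c x := fun q =>
    hN.exists_isMaxOn hne (f := fun x => ⟪q, x⟫ - c x) (by fun_prop)
  choose X hXN hX using hex
  set h : En n → ℝ := fun q => ⟪q, X q⟫ - c (X q) with hh
  obtain ⟨R, hR⟩ := hN.isBounded.exists_norm_le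
  have hR0 : 0 ≤ R := by
    obtain ⟨x, hx⟩ := hne
    exact (norm_nonneg x).trans (hR x hx)
  have hL : LipschitzWith R.toNNReal h := by
    refine LipschitzWith.of_le_add_mul _ fun q q' => ?_
    have h1 := hX q' _ (hXN q)
    have h2 := real_inner_le_norm (q - q') (X q)
    have h3 : ‖q - q'‖ * ‖X q‖ ≤ ‖q - q'‖ * R :=
      mul_le_mul_of_nonneg_left (hR _ (hXN q)) (norm_nonneg _)
    rw [inner_sub_left] at h2
    rw [dist_eq_norm, Real.coe_toNNReal R hR0]
    simp only [hh]
    linarith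
  have key : ∀ q, ∀ x ∈ N, q ∈ subgrad N c x → x ∈ subgrad univ h q := by
    intro q x hx hq q' _
    have h1 := hX q' x hx
    have h2 := hq _ (hXN q)
    have h3 := hX q x hx
    simp only [hh, inner_sub_right] at h1 h2 h3 ⊢
    rw [real_inner_comm q', real_inner_comm q]
    linarith
  refine measure_mono_null ?_ (hL.ae_differentiableAt (μ := volume))
  rintro q ⟨x, hx, x', hx', hxx', hq, hq'⟩ hd
  refine hxx' ((innerSL_inj (𝕜 := ℝ)).mp ?_)
  exact (subgrad_subset_of_hasFDerivAt isOpen_univ (mem_univ q) hd.hasFDerivAt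
    (key q x hx hq)).trans (subgrad_subset_of_hasFDerivAt isOpen_univ (mem_univ q) hd.hasFDerivAt
    (key q x' hx' hq')).symm

lemma exists_monotone_isCompact_inter {X : Type*} [PseudoMetricSpace X] {N O : Set X}
    (hN : IsCompact N) (hO : IsOpen O) :
    ∃ S : ℕ → Set X, (∀ k, IsCompact (S k)) ∧ Monotone S ∧ ⋃ k, S k = N ∩ O := by
  obtain ⟨F, hF, -, hFO, hmono⟩ := hO.exists_iUnion_isClosed
  refine ⟨fun k => N ∩ F k, fun k => hN.inter_right (hF k), fun i j hij =>
    inter_subset_inter_right _ (hmono hij), ?_⟩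
  rw [← inter_iUnion, hFO]

lemma measurableSet_subgrad_inter (hΩ : IsOpen Ω) (hu : ConvexOn ℝ Ω u) {N O : Set (En n)}
    (hN : IsCompact N) (hNΩ : N ⊆ Ω) (hO : IsOpen O) :
    MeasurableSet (⋃ x ∈ N ∩ O, subgrad Ω u x) := by
  obtain ⟨S, hS, -, hSO⟩ := exists_monotone_isCompact_inter hN hO
  rw [← hSO, biUnion_iUnion]
  refine MeasurableSet.iUnion fun k => (isCompact_iUnion_subgrad hΩ hu (hS k) ?_).measurableSet
  exact ((subset_iUnion S k).trans (hSO.subset.trans inter_subset_left)).trans hNΩ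

/-- Approximate subgradients are close to subgradients. -/
lemma exists_approx_subgrad_subset (hΩ : IsOpen Ω) (hu : ConvexOn ℝ Ω u) {N : Set (En n)}
    (hN : IsCompact N) (hNΩ : N ⊆ Ω) {V : Set (En n)} (hV : IsOpen V)
    (hNV : ⋃ x ∈ N, subgrad Ω u x ⊆ V) :
    ∃ δ > 0, ∀ x ∈ N, ∀ p, (∀ y ∈ Ω, u x + ⟪p, y - x⟫ ≤ u y + δ) → p ∈ V := by
  by_contra! hcon
  have hcont := hu.continuousOn hΩ
  obtain ⟨r, hr, hrΩ⟩ := hN.exists_cthickening_subset_open hΩ hNΩ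
  obtain ⟨M, hM⟩ := (hN.cthickening (r := r)).exists_bound_of_continuousOn (hcont.mono hrΩ)
  choose x hx p hp hpV using fun k : ℕ => hcon (1 / ((k : ℝ) + 1)) (by positivity)
  have hle1 : ∀ k : ℕ, 1 / ((k : ℝ) + 1) ≤ 1 := fun k => by
    rw [div_le_one (by positivity)]; linarith [k.cast_nonneg (α := ℝ)]
  have hpb : ∀ k, p k ∈ Metric.closedBall (0 : En n) ((2 * M + 1) / r) := by
    intro k
    rw [mem_closedBall_zero_iff, le_div_iff₀ hr]
    rcases eq_or_ne (p k) 0 with h0 | h0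
    · rw [h0, norm_zero, zero_mul]
      have := (norm_nonneg _).trans (hM _ (Metric.self_subset_cthickening N (hx k)))
      linarith
    have hp0 : 0 < ‖p k‖ := norm_pos_iff.mpr h0
    have hy : x k + (r / ‖p k‖) • p k ∈ Metric.cthickening r N := by
      refine Metric.closedBall_subset_cthickening (hx k) r ?_
      rw [mem_closedBall_iff_norm, add_sub_cancel_left, norm_smul, Real.norm_eq_abs,
        abs_of_pos (by positivity), div_mul_cancel₀ _ hp0.ne']
    have h1 := hp k _ (hrΩ hy)
    have h2 := abs_le.mp (hM _ hy)
    have h3 := abs_le.mp (hM _ (Metric.self_subset_cthickening N (hx k)))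
    rw [add_sub_cancel_left, inner_smul_right, real_inner_self_eq_norm_sq] at h1
    have h4 : r / ‖p k‖ * ‖p k‖ ^ 2 = ‖p k‖ * r := by field_simp
    rw [h4] at h1
    linarith [hle1 k, h2.2, h3.1]
  obtain ⟨⟨x', p'⟩, ⟨hx', -⟩, φ, hφ, hlim⟩ := (hN.prod (isCompact_closedBall (0 : En n)
    ((2 * M + 1) / r))).tendsto_subseq (x := fun k => (x k, p k)) fun k => ⟨hx k, hpb k⟩
  have hlx : Filter.Tendsto (fun k => x (φ k)) Filter.atTop (𝓝 x') :=
    (continuous_fst.tendsto _).comp hlim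
  have hlp : Filter.Tendsto (fun k => p (φ k)) Filter.atTop (𝓝 p') :=
    (continuous_snd.tendsto _).comp hlim
  have hp'V : p' ∉ V := hV.isClosed_compl.mem_of_tendsto hlp
    (Filter.Eventually.of_forall fun k => hpV (φ k))
  refine hp'V (hNV (mem_iUnion₂.mpr ⟨x', hx', fun y hy => ?_⟩))
  have hux : Filter.Tendsto (fun k => u (x (φ k))) Filter.atTop (𝓝 (u x')) :=
    ((hcont.continuousAt (hΩ.mem_nhds (hNΩ hx'))).tendsto).comp hlx
  have h1 : Filter.Tendsto (fun k => u (x (φ k)) + ⟪p (φ k), y - x (φ k)⟫) Filter.atTop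
      (𝓝 (u x' + ⟪p', y - x'⟫)) := hux.add (hlp.inner (tendsto_const_nhds.sub hlx))
  have h2 : Filter.Tendsto (fun k => u y + 1 / ((φ k : ℝ) + 1)) Filter.atTop (𝓝 (u y + 0)) :=
    tendsto_const_nhds.add (tendsto_one_div_add_atTop_nhds_zero_nat.comp hφ.tendsto_atTop)
  rw [add_zero] at h2
  exact le_of_tendsto_of_tendsto' h1 h2 fun k => hp (φ k) y hy

/-- Adding a convex function increases the Monge–Ampère measure. -/
lemma MAm_le_MAm_add (hΩ : IsOpen Ω) {a b : En n → ℝ} (ha : ConvexOn ℝ Ω a)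
    (hb : ConvexOn ℝ Ω b) {N : Set (En n)} (hN : IsCompact N) (hNΩ : N ⊆ Ω) :
    MAm Ω b N ≤ MAm Ω (a + b) N := by
  rcases N.eq_empty_or_nonempty with rfl | hne
  · simp [MAm]
  refine le_of_forall_gt fun r hr => ?_
  obtain ⟨V, hWV, hV, hVr⟩ := Set.exists_isOpen_lt_of_lt _ r hr
  refine lt_of_le_of_lt ?_ hVr
  obtain ⟨δ, hδ, hδV⟩ := exists_approx_subgrad_subset hΩ (ha.add hb) hN hNΩ hV hWV
  have hacont := ha.continuousOn hΩ
  choose! p hp using fun x (hx : x ∈ Ω) => subgrad_nonempty hΩ ha hx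
  obtain ⟨t, htN, hcov⟩ := hN.elim_nhds_subcover (fun i => {y | a y < a i + ⟪p i, y - i⟫ + δ})
    (fun x hx => by
      have h1 := hacont.continuousAt (hΩ.mem_nhds (hNΩ hx))
      have h2 : ContinuousAt (fun y => a x + ⟪p x, y - x⟫ + δ) x := by fun_prop
      exact h1.eventually_lt h2 (by simpa using hδ))
  obtain ⟨k, ⟨e⟩⟩ : ∃ k, Nonempty (Fin k ≃ t) := ⟨_, ⟨t.equivFin.symm⟩⟩
  set l : Fin k → En n → ℝ := fun j y => a (e j) + ⟪p (e j), y - e j⟫ with hl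
  have hlc : ∀ j, Continuous (l j) := fun j => by simp only [hl]; fun_prop
  have hle : ∀ j, ∀ y ∈ Ω, l j y ≤ a y := fun j y hy => hp _ (hNΩ (htN _ (e j).2)) y hy
  have hladd : ∀ j x y, l j y = l j x + ⟪p (e j), y - x⟫ := fun j x y => by
    simp only [hl, inner_sub_right]; ring
  have hnear : ∀ x ∈ N, ∃ j, a x < l j x + δ := by
    intro x hx
    obtain ⟨i, hi, hxi⟩ := mem_iUnion₂.mp (hcov hx)
    refine ⟨e.symm ⟨i, hi⟩, ?_⟩
    simp only [hl, Equiv.apply_symm_apply]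
    exact hxi
  have hk : Nonempty (Fin k) := by
    obtain ⟨x, hx⟩ := hne
    exact ⟨(hnear x hx).choose⟩
  set M : Fin k → Set (En n) := fun j => {x | ∀ i, l i x ≤ l j x} with hM
  have hMc : ∀ j, IsClosed (M j) := fun j => by
    simp only [hM, ofPred_forall]
    exact isClosed_iInter fun i => isClosed_le (hlc i) (hlc j)
  set N' : Fin k → Set (En n) := fun j => (N ∩ M j) ∩ (⋃ i < j, M i)ᶜ with hN'
  have hN'N : ∀ j, N' j ⊆ N := fun j x hx => hx.1.1
  have hdisj : ∀ i j x, x ∈ N' i → x ∈ N' j → i = j := by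
    intro i j x hi hj
    rcases lt_trichotomy i j with h | h | h
    · exact absurd (mem_iUnion₂.mpr ⟨i, h, hi.1.2⟩) hj.2
    · exact h
    · exact absurd (mem_iUnion₂.mpr ⟨j, h, hj.1.2⟩) hi.2
  have hcovN : ∀ x ∈ N, ∃ j, x ∈ N' j := by
    intro x hx
    obtain ⟨j₀, hj₀⟩ := Finite.exists_max (fun j => l j x)
    obtain ⟨j, hj, hmin⟩ := WellFounded.has_min (wellFounded_lt (α := Fin k)) {j | x ∈ M j}
      ⟨j₀, hj₀⟩
    refine ⟨j, ⟨hx, hj⟩, fun hcon => ?_⟩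
    obtain ⟨i, hij, hi⟩ := mem_iUnion₂.mp hcon
    exact hmin i hi hij
  set Y : Fin k → Set (En n) := fun j => ⋃ x ∈ N' j, subgrad Ω b x with hY
  have hYm : ∀ j, MeasurableSet (Y j) := fun j =>
    measurableSet_subgrad_inter hΩ hb (hN.inter_right (hMc j)) (inter_subset_left.trans hNΩ)
      (isClosed_biUnion_finset (s := Finset.univ.filter (· < j)) (fun i _ => hMc i) |>.isOpen_compl
        |> fun h => by simpa using h)
  set X : Fin k → Set (En n) := fun j => (fun q => q + -p (e j)) ⁻¹' Y j with hX
  have hXV : ∀ j, X j ⊆ V := by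
    intro j q hq
    obtain ⟨x, hx, hqx⟩ := mem_iUnion₂.mp hq
    obtain ⟨i, hi⟩ := hnear x hx.1.1
    refine hδV x hx.1.1 q fun y hy => ?_
    have h1 := hqx y hy
    have h2 := hle j y hy
    have h3 := hladd j x y
    have h4 := hx.1.2 i
    rw [inner_add_left, inner_neg_left] at h1
    simp only [Pi.add_apply]
    linarith
  set c : En n → ℝ := fun y => Finset.univ.sup' Finset.univ_nonempty (fun j => l j y) + b y with hc
  have hcc : ContinuousOn c N := by
    refine ContinuousOn.add ?_ ((hb.continuousOn hΩ).mono hNΩ)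
    exact (Continuous.finset_sup'_apply _ fun j _ => hlc j).continuousOn
  have hcx : ∀ j, ∀ x ∈ N' j, ∀ q, q + -p (e j) ∈ subgrad Ω b x → q ∈ subgrad N c x := by
    intro j x hx q hq y hy
    have h1 := hq y (hNΩ hy)
    have h2 : l j y ≤ Finset.univ.sup' Finset.univ_nonempty (fun j => l j y) :=
      Finset.le_sup' (fun j => l j y) (Finset.mem_univ j)
    have h3 : Finset.univ.sup' Finset.univ_nonempty (fun j => l j x) ≤ l j x :=
      Finset.sup'_le _ _ fun i _ => hx.1.2 i
    have h4 := hladd j x y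
    rw [inner_add_left, inner_neg_left] at h1
    simp only [hc]
    linarith
  have hXd : Pairwise (Function.onFun (AEDisjoint volume) X) := by
    intro i j hij
    refine measure_mono_null ?_ (volume_common_slopes_eq_zero hN hcc)
    rintro q ⟨hqi, hqj⟩
    obtain ⟨x, hx, hqx⟩ := mem_iUnion₂.mp hqi
    obtain ⟨x', hx', hqx'⟩ := mem_iUnion₂.mp hqj
    refine ⟨x, hx.1.1, x', hx'.1.1, ?_, hcx i x hx q hqx, hcx j x' hx' q hqx'⟩
    rintro rfl
    exact hij (hdisj i j x hx hx')
  calc MAm Ω b N ≤ volume (⋃ j, Y j) := by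
        refine measure_mono ?_
        intro q hq
        obtain ⟨x, hx, hqx⟩ := mem_iUnion₂.mp hq
        obtain ⟨j, hj⟩ := hcovN x hx
        exact mem_iUnion.mpr ⟨j, mem_iUnion₂.mpr ⟨x, hj, hqx⟩⟩
    _ ≤ ∑' j, volume (Y j) := measure_iUnion_le _
    _ = ∑' j, volume (X j) := by
        congr 1; ext j
        exact (measure_preimage_add_right volume _ _).symm
    _ = volume (⋃ j, X j) := (measure_iUnion₀ hXd fun j =>
        ((hYm j).preimage (measurable_add_const _)).nullMeasurableSet).symm
    _ ≤ volume V := measure_mono (iUnion_subset hXV)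

end Superadditivity

section Determinants
open scoped MatrixOrder Matrix

lemma Matrix.PosSemidef.exists_det_add {ι : Type*} [Fintype ι] [DecidableEq ι]
    {A B : Matrix ι ι ℝ} (hA : A.PosSemidef) (hA0 : A.det ≠ 0) (hB : B.PosSemidef) :
    ∃ μ : ι → ℝ, (∀ i, 0 ≤ μ i) ∧ B.det = A.det * ∏ i, μ i ∧
      (A + B).det = A.det * ∏ i, (1 + μ i) := by
  obtain ⟨C, hC⟩ := CStarAlgebra.nonneg_iff_eq_star_mul_self.mp hA.nonneg
  rw [Matrix.star_eq_conjTranspose] at hC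
  have hdetA : A.det = Cᴴ.det * C.det := by rw [hC, Matrix.det_mul]
  have hCu : IsUnit C.det := by
    refine isUnit_iff_ne_zero.mpr fun h => hA0 ?_
    rw [hdetA, h, mul_zero]
  have hCu' : IsUnit Cᴴ.det := by
    refine isUnit_iff_ne_zero.mpr fun h => hA0 ?_
    rw [hdetA, h, zero_mul]
  set M := (C⁻¹)ᴴ * B * C⁻¹ with hM
  have hMp : M.PosSemidef := hB.conjTranspose_mul_mul_same _
  have hBM : B = Cᴴ * M * C := by
    rw [hM, Matrix.conjTranspose_nonsing_inv]
    simp only [← Matrix.mul_assoc, Matrix.mul_nonsing_inv _ hCu', Matrix.one_mul]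
    rw [Matrix.mul_assoc, Matrix.nonsing_inv_mul _ hCu, Matrix.mul_one]
  refine ⟨hMp.1.eigenvalues, hMp.eigenvalues_nonneg, ?_, ?_⟩
  · rw [hBM, Matrix.det_mul, Matrix.det_mul, hMp.1.det_eq_prod_eigenvalues, hdetA]
    simp; ring
  · have h1 : A + B = Cᴴ * (1 + M) * C := by
      rw [Matrix.mul_add, Matrix.add_mul, ← hBM, Matrix.mul_one, ← hC]
    have h2 : (1 + M).det = ∏ i, (1 + hMp.1.eigenvalues i) := by
      have h3 := hMp.1.spectral_theorem
      have h4 : 1 + M = Unitary.conjStarAlgAut ℝ _ hMp.1.eigenvectorUnitary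
          (Matrix.diagonal fun i => 1 + hMp.1.eigenvalues i) := by
        have h5 : (Matrix.diagonal fun i => 1 + hMp.1.eigenvalues i) =
            1 + Matrix.diagonal (RCLike.ofReal ∘ hMp.1.eigenvalues) := by
          rw [← Matrix.diagonal_one, Matrix.diagonal_add]; rfl
        rw [h5, map_add, map_one, ← h3]
      rw [h4, Unitary.conjStarAlgAut_apply, Matrix.det_mul, Matrix.det_mul, Matrix.det_diagonal,
        mul_comm, ← mul_assoc, ← Matrix.det_mul]
      simp
    rw [h1, Matrix.det_mul, Matrix.det_mul, h2, hdetA]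
    ring

lemma Matrix.PosSemidef.det_le_det_add {ι : Type*} [Fintype ι] [DecidableEq ι]
    {A B : Matrix ι ι ℝ} (hA : A.PosSemidef) (hB : B.PosSemidef) : A.det ≤ (A + B).det := by
  rcases eq_or_ne A.det 0 with h | h
  · rw [h]; exact (hA.add hB).det_nonneg
  · obtain ⟨μ, hμ, -, h2⟩ := hA.exists_det_add h hB
    rw [h2]
    exact le_mul_of_one_le_right hA.det_nonneg
      (Finset.prod_induction _ (1 ≤ ·) (fun _ _ => one_le_mul_of_one_le_of_one_le) le_rfl
        fun i _ => by linarith [hμ i])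

lemma Matrix.PosSemidef.det_le_of_det_add_le {ι : Type*} [Fintype ι] [DecidableEq ι]
    {A B : Matrix ι ι ℝ} (hA : A.PosSemidef) (hB : B.PosSemidef) {κ : ℝ}
    (h : (A + B).det ≤ (1 + κ) * A.det) : B.det ≤ κ ^ Fintype.card ι * A.det := by
  rcases eq_or_ne A.det 0 with h0 | h0
  · rw [h0, mul_zero] at h ⊢
    have := hB.det_le_det_add hA
    rw [add_comm] at this
    exact this.trans h
  · obtain ⟨μ, hμ, h1, h2⟩ := hA.exists_det_add h0 hB
    have hA0 : 0 < A.det := lt_of_le_of_ne hA.det_nonneg h0.symm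
    rw [h2, mul_comm] at h
    have h3 := le_of_mul_le_mul_right h hA0
    have h4 : ∀ i, μ i ≤ κ := by
      intro i
      have h5 : 1 + μ i ≤ ∏ i, (1 + μ i) := by
        rw [← Finset.mul_prod_erase _ _ (Finset.mem_univ i)]
        refine le_mul_of_one_le_right (by linarith [hμ i]) ?_
        exact Finset.prod_induction _ (1 ≤ ·) (fun _ _ => one_le_mul_of_one_le_of_one_le) le_rfl
          fun i _ => by linarith [hμ i]
      linarith
    rw [h1, mul_comm]
    refine mul_le_mul_of_nonneg_right ?_ hA0.le
    calc ∏ i, μ i ≤ ∏ _i : ι, κ := Finset.prod_le_prod (fun i _ => hμ i) fun i _ => h4 i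
      _ = κ ^ Fintype.card ι := by simp

variable {n : ℕ}

lemma exists_posSemidef_det_eq {A : En n →L[ℝ] En n} (hs : ∀ h k, ⟪A h, k⟫ = ⟪h, A k⟫)
    (hp : ∀ h, 0 ≤ ⟪A h, h⟫) :
    ((A : En n →ₗ[ℝ] En n).toMatrix (EuclideanSpace.basisFun (Fin n) ℝ).toBasis
      (EuclideanSpace.basisFun (Fin n) ℝ).toBasis).PosSemidef := by
  rw [LinearMap.posSemidef_toMatrix_iff]
  exact ⟨hs, hp⟩

lemma det_le_det_add_of_nonneg {A B : En n →L[ℝ] En n} (hA : ∀ h k, ⟪A h, k⟫ = ⟪h, A k⟫)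
    (hA' : ∀ h, 0 ≤ ⟪A h, h⟫) (hB : ∀ h k, ⟪B h, k⟫ = ⟪h, B k⟫) (hB' : ∀ h, 0 ≤ ⟪B h, h⟫) :
    |A.det| ≤ |(A + B).det| ∧
      ∀ κ, |(A + B).det| ≤ (1 + κ) * |A.det| → |B.det| ≤ κ ^ n * |A.det| := by
  set b := (EuclideanSpace.basisFun (Fin n) ℝ).toBasis
  have hMA := exists_posSemidef_det_eq hA hA'
  have hMB := exists_posSemidef_det_eq hB hB'
  have hd : ∀ T : En n →L[ℝ] En n, T.det = ((T : En n →ₗ[ℝ] En n).toMatrix b b).det := fun T =>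
    (LinearMap.det_toMatrix b _).symm
  have hadd : (((A + B : En n →L[ℝ] En n) : En n →ₗ[ℝ] En n).toMatrix b b) =
      (A : En n →ₗ[ℝ] En n).toMatrix b b + (B : En n →ₗ[ℝ] En n).toMatrix b b := by
    rw [← map_add]; rfl
  rw [hd A, hd B, hd (A + B), hadd, abs_of_nonneg hMA.det_nonneg, abs_of_nonneg hMB.det_nonneg,
    abs_of_nonneg (hMA.add hMB).det_nonneg]
  refine ⟨hMA.det_le_det_add hMB, fun κ hκ => ?_⟩
  simpa using hMA.det_le_of_det_add_le hMB hκ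

end Determinants

section Contact
open Topology

variable {n : ℕ} {Ω : Set (En n)} {u v γ : En n → ℝ}

lemma smul_mem_subgrad_of_touch (hu : ConvexOn ℝ Ω u) {a : En n → ℝ} {t : ℝ} (ht : 0 < t)
    {x : En n} (hx : x ∈ Ω) (heq : a x = t * u x) (hle : ∀ᶠ y in 𝓝 x, a y ≤ t * u y)
    {p : En n} (hp : ∀ᶠ y in 𝓝 x, a x + ⟪p, y - x⟫ ≤ a y) : t⁻¹ • p ∈ subgrad Ω u x := by
  refine subgrad_of_eventually hu hx ?_
  filter_upwards [hle, hp] with y h1 h2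
  rw [real_inner_smul_left]
  have : t * (u x + t⁻¹ * ⟪p, y - x⟫) ≤ t * u y := by
    rw [mul_add, mul_inv_cancel_left₀ ht.ne']; linarith
  exact le_of_mul_le_mul_left this ht

lemma MAm_le_of_touch (hΩ : IsOpen Ω) (hu : ConvexOn ℝ Ω u) {a : En n → ℝ} {t : ℝ} (ht : 0 < t)
    {N : Set (En n)} (hN : N ⊆ Ω) (heq : ∀ x ∈ N, a x = t * u x)
    (hle : ∀ x ∈ N, ∀ᶠ y in 𝓝 x, a y ≤ t * u y) :
    MAm Ω a N ≤ ENNReal.ofReal (t ^ n) * MAm Ω u N := by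
  have h := volume_affine_image (0 : En n) t (⋃ x ∈ N, subgrad Ω u x)
  rw [abs_of_pos ht] at h
  rw [MAm, MAm, ← h]
  refine measure_mono (iUnion₂_subset fun x hx p hp => ⟨t⁻¹ • p, mem_biUnion hx ?_, ?_⟩)
  · refine smul_mem_subgrad_of_touch hu ht (hN hx) (heq x hx) (hle x hx) ?_
    filter_upwards [hΩ.mem_nhds (hN hx)] with y hy using hp y hy
  · simp [smul_smul, ht.ne']

lemma MAm_inter_le_of_touch (hΩ : IsOpen Ω) (hu : ConvexOn ℝ Ω u) (hv : ConvexOn ℝ Ω v)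
    (hγ : ConvexOn ℝ Ω γ) {t : ℝ} (ht : 0 < t) {N O : Set (En n)} (hN : IsCompact N)
    (hNΩ : N ⊆ Ω) (hO : IsOpen O) (heq : ∀ x ∈ N, (v + γ) x = t * u x)
    (hle : ∀ x ∈ N, ∀ᶠ y in 𝓝 x, (v + γ) y ≤ t * u y) :
    MAm Ω γ (N ∩ O) ≤ ENNReal.ofReal (t ^ n) * MAm Ω u (N ∩ O) := by
  obtain ⟨S, hS, hmono, hSO⟩ := exists_monotone_isCompact_inter hN hO
  have hsub : ∀ k, S k ⊆ N ∩ O := fun k => (subset_iUnion S k).trans hSO.subset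
  rw [MAm, ← hSO, biUnion_iUnion, Monotone.measure_iUnion
    (fun i j hij => biUnion_subset_biUnion_left (hmono hij)), hSO]
  refine iSup_le fun k => ?_
  have hk : S k ⊆ N := (hsub k).trans inter_subset_left
  refine (MAm_le_MAm_add hΩ hv hγ (hS k) (hk.trans hNΩ)).trans ?_
  refine (MAm_le_of_touch hΩ hu ht (hk.trans hNΩ) (fun x hx => heq x (hk hx))
    fun x hx => hle x (hk hx)).trans ?_
  gcongr
  exact measure_mono (biUnion_subset_biUnion_left (hsub k))

lemma MAm_le_of_touch_of_regular (hΩ : IsOpen Ω) (hu : ConvexOn ℝ Ω u) {t κ₀ κ : ℝ}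
    (ht : 1 ≤ t) (hκ0 : 0 ≤ κ) (hκ : t ^ n * (1 + κ₀) ≤ 1 + κ)
    {E : Set (En n)} (hE : MeasurableSet E) (hEΩ : E ⊆ Ω)
    (heq : ∀ x ∈ E, (v + γ) x = t * u x) (hle : ∀ x ∈ E, ∀ᶠ y in 𝓝 x, (v + γ) y ≤ t * u y)
    (hstrict : ∀ x ∈ E, ∀ p ∈ subgrad Ω u x, StrictContact Ω u x p)
    {gu gv : En n → ℝ≥0∞} (hgu : ∀ S ⊆ Ω, MeasurableSet S → MAm Ω u S = ∫⁻ x in S, gu x)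
    (hgv : ∀ S ⊆ Ω, MeasurableSet S → MAm Ω v S = ∫⁻ x in S, gv x)
    (hdens : ∀ᵐ x, x ∈ E → gu x ≤ ENNReal.ofReal (1 + κ₀) * gv x)
    {a b : En n → En n} (ha : ∀ x ∈ E, subgrad Ω v x = {a x})
    (hb : ∀ x ∈ E, subgrad Ω γ x = {b x}) {A B : En n → En n →L[ℝ] En n}
    (hA : ∀ x ∈ E, HasFDerivAt a (A x) x ∧ (∀ h k, ⟪A x h, k⟫ = ⟪h, A x k⟫) ∧
      ∀ h, 0 ≤ ⟪A x h, h⟫)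
    (hB : ∀ x ∈ E, HasFDerivAt b (B x) x ∧ (∀ h k, ⟪B x h, k⟫ = ⟪h, B x k⟫) ∧
      ∀ h, 0 ≤ ⟪B x h, h⟫) :
    MAm Ω γ E ≤ ENNReal.ofReal (κ ^ n * t ^ n) * MAm Ω u E := by
  have ht0 : 0 < t := by linarith
  have himg : ∀ {w : En n → ℝ} {c : En n → En n}, (∀ x ∈ E, subgrad Ω w x = {c x}) →
      ∀ S ⊆ E, MAm Ω w S = volume (c '' S) := by
    intro w c hc S hS
    rw [MAm, iUnion₂_congr fun x hx => hc x (hS hx), image_eq_iUnion]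
  have hmem : ∀ x ∈ E, t⁻¹ • (a x + b x) ∈ subgrad Ω u x := by
    intro x hx
    refine smul_mem_subgrad_of_touch hu ht0 (hEΩ hx) (heq x hx) (hle x hx) ?_
    filter_upwards [hΩ.mem_nhds (hEΩ hx)] with y hy
    have h1 : a x ∈ subgrad Ω v x := by rw [ha x hx]; rfl
    have h2 : b x ∈ subgrad Ω γ x := by rw [hb x hx]; rfl
    have h3 := h1 y hy
    have h4 := h2 y hy
    simp only [Pi.add_apply, inner_add_left]
    linarith
  have hinj : InjOn (fun x => a x + b x) E := by
    intro x hx y hy hxy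
    by_contra hne
    simp only at hxy
    have h1 := (hstrict x hx _ (hmem x hx)).2.2 y (hEΩ hy) (Ne.symm hne)
    have h2 := hmem y hy x (hEΩ hx)
    rw [← hxy, ← neg_sub y x, inner_neg_right] at h2
    linarith
  have hder : ∀ S ⊆ E, ∀ x ∈ S, HasFDerivWithinAt (fun x => a x + b x) (A x + B x) S x :=
    fun S hS x hx => ((hA x (hS hx)).1.add (hB x (hS hx)).1).hasFDerivWithinAt
  have himle : ∀ S ⊆ E, volume ((fun x => a x + b x) '' S) ≤
      ENNReal.ofReal (t ^ n) * MAm Ω u S := by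
    intro S hS
    have h := volume_affine_image (0 : En n) t (⋃ x ∈ S, subgrad Ω u x)
    rw [abs_of_pos ht0] at h
    rw [MAm, ← h]
    refine measure_mono ?_
    rintro _ ⟨x, hx, rfl⟩
    exact ⟨_, mem_biUnion hx (hmem x (hS hx)), by simp [smul_smul, ht0.ne']⟩
  have hset : ∀ S ⊆ E, MeasurableSet S →
      ∫⁻ x in S, ENNReal.ofReal |(A x + B x).det| ≤ ENNReal.ofReal (t ^ n) * MAm Ω u S := by
    intro S hS hSm
    rw [lintegral_abs_det_fderiv_eq_addHaar_image volume hSm (hder S hS) (hinj.mono hS)]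
    exact himle S hS
  have haem : AEMeasurable (fun x => ENNReal.ofReal |(A x + B x).det|) (volume.restrict E) :=
    aemeasurable_ofReal_abs_det_fderivWithin volume hE (hder E subset_rfl)
  have hcmp : (fun x => ENNReal.ofReal |(A x + B x).det|) ≤ᵐ[volume.restrict E]
      fun x => ENNReal.ofReal (1 + κ) * ENNReal.ofReal |(A x).det| := by
    refine ae_le_of_forall_setLIntegral_le_of_sigmaFinite₀ haem fun S hS _ => ?_
    rw [Measure.restrict_restrict hS]
    have hSE : S ∩ E ⊆ E := inter_subset_right
    have hSm := hS.inter hE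
    calc ∫⁻ x in S ∩ E, ENNReal.ofReal |(A x + B x).det|
        ≤ ENNReal.ofReal (t ^ n) * MAm Ω u (S ∩ E) := hset _ hSE hSm
      _ = ENNReal.ofReal (t ^ n) * ∫⁻ x in S ∩ E, gu x := by rw [hgu _ (hSE.trans hEΩ) hSm]
      _ ≤ ENNReal.ofReal (t ^ n) * ∫⁻ x in S ∩ E, ENNReal.ofReal (1 + κ₀) * gv x := by
          gcongr ENNReal.ofReal (t ^ n) * ?_
          refine lintegral_mono_ae ((ae_restrict_iff' hSm).mpr ?_)
          filter_upwards [hdens] with x hx hxS using hx hxS.2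
      _ = ENNReal.ofReal (t ^ n) * (ENNReal.ofReal (1 + κ₀) * volume (a '' (S ∩ E))) := by
          rw [lintegral_const_mul' _ _ ENNReal.ofReal_ne_top, ← hgv _ (hSE.trans hEΩ) hSm,
            himg ha _ hSE]
      _ ≤ ENNReal.ofReal (1 + κ) * ∫⁻ x in S ∩ E, ENNReal.ofReal |(A x).det| := by
          rw [← mul_assoc, ← ENNReal.ofReal_mul (by positivity)]
          gcongr
          exact addHaar_image_le_lintegral_abs_det_fderiv volume hSm fun x hx =>
            (hA x (hSE hx)).1.hasFDerivWithinAt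
      _ = _ := by rw [lintegral_const_mul' _ _ ENNReal.ofReal_ne_top]
  have hlast : ∀ᵐ x ∂(volume.restrict E), ENNReal.ofReal |(B x).det| ≤
      ENNReal.ofReal (κ ^ n) * ENNReal.ofReal |(A x + B x).det| := by
    filter_upwards [hcmp, ae_restrict_mem hE] with x hx hxE
    rw [← ENNReal.ofReal_mul (by linarith)] at hx
    have h1 := (ENNReal.ofReal_le_ofReal_iff (by positivity)).mp hx
    obtain ⟨h2, h3⟩ := det_le_det_add_of_nonneg (hA x hxE).2.1 (hA x hxE).2.2
      (hB x hxE).2.1 (hB x hxE).2.2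
    rw [← ENNReal.ofReal_mul (by positivity)]
    refine ENNReal.ofReal_le_ofReal ((h3 κ h1).trans ?_)
    gcongr
  calc MAm Ω γ E = volume (b '' E) := himg hb E subset_rfl
    _ ≤ ∫⁻ x in E, ENNReal.ofReal |(B x).det| :=
        addHaar_image_le_lintegral_abs_det_fderiv volume hE fun x hx =>
          (hB x hx).1.hasFDerivWithinAt
    _ ≤ ∫⁻ x in E, ENNReal.ofReal (κ ^ n) * ENNReal.ofReal |(A x + B x).det| :=
        lintegral_mono_ae hlast
    _ = ENNReal.ofReal (κ ^ n) * ∫⁻ x in E, ENNReal.ofReal |(A x + B x).det| :=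
        lintegral_const_mul' _ _ ENNReal.ofReal_ne_top
    _ ≤ ENNReal.ofReal (κ ^ n) * (ENNReal.ofReal (t ^ n) * MAm Ω u E) := by
        gcongr
        exact hset E subset_rfl hE
    _ = _ := by rw [← mul_assoc, ← ENNReal.ofReal_mul (by positivity)]

/-- Mass estimate for a convex perturbation at contact points. -/
lemma MAm_le_of_contact (hΩ : IsOpen Ω) (hu : ConvexOn ℝ Ω u) (hv : ConvexOn ℝ Ω v)
    (hγ : ConvexOn ℝ Ω γ) {t κ₀ κ : ℝ}
    (ht : 1 ≤ t) (hκ0 : 0 ≤ κ) (hκ : t ^ n * (1 + κ₀) ≤ 1 + κ)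
    {E : Set (En n)} (hE : IsCompact E) (hEΩ : E ⊆ Ω)
    (heq : ∀ x ∈ E, (v + γ) x = t * u x) (hle : ∀ x ∈ E, ∀ᶠ y in 𝓝 x, (v + γ) y ≤ t * u y)
    (hstrict : ∀ x ∈ E, ∀ p ∈ subgrad Ω u x, StrictContact Ω u x p)
    {gu gv : En n → ℝ≥0∞} (hgu : ∀ S ⊆ Ω, MeasurableSet S → MAm Ω u S = ∫⁻ x in S, gu x)
    (hgv : ∀ S ⊆ Ω, MeasurableSet S → MAm Ω v S = ∫⁻ x in S, gv x)
    (hdens : ∀ᵐ x, x ∈ E → gu x ≤ ENNReal.ofReal (1 + κ₀) * gv x) :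
    MAm Ω γ E ≤ ENNReal.ofReal (κ ^ n * t ^ n) * MAm Ω u E := by
  have ht0 : 0 < t := by linarith
  have hsel : ∀ {w : En n → ℝ}, ConvexOn ℝ Ω w → ∃ q : En n → En n,
      ∀ x ∈ Ω, q x ∈ subgrad Ω w x := by
    intro w hw
    have : ∀ x, ∃ q, x ∈ Ω → q ∈ subgrad Ω w x := fun x => by
      by_cases hx : x ∈ Ω
      · exact ⟨_, fun _ => (subgrad_nonempty hΩ hw hx).some_mem⟩
      · exact ⟨0, fun h => absurd h hx⟩
    choose q hq using this
    exact ⟨q, hq⟩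
  obtain ⟨a, ha⟩ := hsel hv
  obtain ⟨b, hb⟩ := hsel hγ
  have hgood := (ae_hasFDerivAt_subgrad hΩ hv ha).and (ae_hasFDerivAt_subgrad hΩ hγ hb)
  set Z : Set (En n) := {x | ¬ ((x ∈ Ω → subgrad Ω v x = {a x} ∧ ∃ A : En n →L[ℝ] En n,
    HasFDerivAt a A x ∧ (∀ h k, ⟪A h, k⟫ = ⟪h, A k⟫) ∧ ∀ h, 0 ≤ ⟪A h, h⟫) ∧
    (x ∈ Ω → subgrad Ω γ x = {b x} ∧ ∃ A : En n →L[ℝ] En n,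
    HasFDerivAt b A x ∧ (∀ h k, ⟪A h, k⟫ = ⟪h, A k⟫) ∧ ∀ h, 0 ≤ ⟪A h, h⟫))} with hZ
  have hZ0 : volume Z = 0 := hgood
  have hfin : MAm Ω u E ≠ ⊤ := (isCompact_iUnion_subgrad hΩ hu hE hEΩ).measure_lt_top.ne
  refine ENNReal.le_of_forall_pos_le_add fun ε hε _ => ?_
  have hη : (ε : ℝ≥0∞) / ENNReal.ofReal (t ^ n) ≠ 0 :=
    ENNReal.div_ne_zero.mpr ⟨by exact_mod_cast hε.ne', ENNReal.ofReal_ne_top⟩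
  rw [hgu E hEΩ hE.measurableSet] at hfin
  obtain ⟨δ, hδ, hsmall⟩ := exists_pos_setLIntegral_lt_of_measure_lt hfin hη
  obtain ⟨O, hZO, hO, hOδ⟩ := Set.exists_isOpen_lt_of_lt (μ := volume) Z δ (by rwa [hZ0])
  have hsplit : MAm Ω γ E ≤ MAm Ω γ (E ∩ O) + MAm Ω γ (E \ O) := by
    refine le_trans (measure_mono ?_) (measure_union_le _ _)
    rw [← biUnion_union, inter_union_sdiff]
  refine hsplit.trans ?_
  rw [add_comm]
  refine add_le_add ?_ ?_
  · have hgE : ∀ x ∈ E \ O, (subgrad Ω v x = {a x} ∧ ∃ A : En n →L[ℝ] En n,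
        HasFDerivAt a A x ∧ (∀ h k, ⟪A h, k⟫ = ⟪h, A k⟫) ∧ ∀ h, 0 ≤ ⟪A h, h⟫) ∧
        (subgrad Ω γ x = {b x} ∧ ∃ A : En n →L[ℝ] En n,
        HasFDerivAt b A x ∧ (∀ h k, ⟪A h, k⟫ = ⟪h, A k⟫) ∧ ∀ h, 0 ≤ ⟪A h, h⟫) := by
      intro x hx
      have hxZ : x ∉ Z := fun h => hx.2 (hZO h)
      rw [hZ, mem_ofPred_eq, not_not] at hxZ
      exact ⟨hxZ.1 (hEΩ hx.1), hxZ.2 (hEΩ hx.1)⟩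
    have hA' : ∀ x, ∃ A : En n →L[ℝ] En n, x ∈ E \ O →
        HasFDerivAt a A x ∧ (∀ h k, ⟪A h, k⟫ = ⟪h, A k⟫) ∧ ∀ h, 0 ≤ ⟪A h, h⟫ := by
      intro x
      by_cases hx : x ∈ E \ O
      · exact (hgE x hx).1.2.imp fun A hA _ => hA
      · exact ⟨0, fun h => absurd h hx⟩
    have hB' : ∀ x, ∃ A : En n →L[ℝ] En n, x ∈ E \ O →
        HasFDerivAt b A x ∧ (∀ h k, ⟪A h, k⟫ = ⟪h, A k⟫) ∧ ∀ h, 0 ≤ ⟪A h, h⟫ := by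
      intro x
      by_cases hx : x ∈ E \ O
      · exact (hgE x hx).2.2.imp fun A hA _ => hA
      · exact ⟨0, fun h => absurd h hx⟩
    choose A hA using hA'
    choose B hB using hB'
    have hsub : E \ O ⊆ E := sdiff_subset
    refine (MAm_le_of_touch_of_regular hΩ hu ht hκ0 hκ
      (hE.measurableSet.diff hO.measurableSet) (hsub.trans hEΩ) (fun x hx => heq x hx.1)
      (fun x hx => hle x hx.1) (fun x hx => hstrict x hx.1) hgu hgv ?_
      (fun x hx => (hgE x hx).1.1) (fun x hx => (hgE x hx).2.1) hA hB).trans ?_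
    · filter_upwards [hdens] with x hx hxE using hx hxE.1
    · gcongr
      exact measure_mono (biUnion_subset_biUnion_left hsub)
  · refine (MAm_inter_le_of_touch hΩ hu hv hγ ht0 hE hEΩ hO heq hle).trans ?_
    rw [hgu _ (inter_subset_left.trans hEΩ) (hE.measurableSet.inter hO.measurableSet),
      inter_comm, ← Measure.restrict_restrict hO.measurableSet, mul_comm]
    refine ENNReal.mul_le_of_le_div (hsmall O ?_).le
    exact (Measure.restrict_apply_le _ _).trans_lt hOδ

end Contact

section Envelope
open Topology

variable {n : ℕ} {Ω : Set (En n)} {u v : En n → ℝ}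

lemma exists_lower_envelope {T Q : Set (En n)} (hT : IsCompact T) {y : En n} (hy : y ∈ T)
    {Θ : En n → ℝ} (hΘ : ContinuousOn Θ T) {ε R : ℝ} (hε : 0 < ε) (h0 : 0 ∈ Q)
    (hQT : ∀ q ∈ Q, ∀ x ∈ T, |⟪q, x - y⟫| ≤ ε) (hQR : ∀ q ∈ Q, ‖q‖ ≤ R)
    (hΘy : Θ y ≤ -(8 * ε)) (hΘT : ∀ x ∈ T, x ∉ interior T → -(4 * ε) ≤ Θ x) :
    ∃ (Γ : En n → ℝ) (E : Set (En n)), ConvexOn ℝ univ Γ ∧ IsCompact E ∧ E ⊆ interior T ∧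
      (∀ x ∈ T, Γ x ≤ Θ x) ∧ (∀ x ∈ T, Γ x ≤ 0) ∧ (∀ x ∈ E, Γ x = Θ x) ∧
      (∀ q ∈ Q, ∃ x ∈ E, q ∈ subgrad univ Γ x) ∧
      ∀ x, ∀ q ∈ subgrad univ Γ x, ‖q‖ ≤ R := by
  have hex : ∀ q, ∃ x ∈ T, ∀ z ∈ T, Θ x - ⟪q, x - y⟫ ≤ Θ z - ⟪q, z - y⟫ := fun q =>
    hT.exists_isMinOn ⟨y, hy⟩ (f := fun x => Θ x - ⟪q, x - y⟫)
      (hΘ.sub (by fun_prop))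
  choose X hXT hX using hex
  set m : En n → ℝ := fun q => Θ (X q) - ⟪q, X q - y⟫ with hm
  have hmy : ∀ q, m q ≤ -(8 * ε) := fun q => by
    have := hX q y hy
    simp only [sub_self, inner_zero_right] at this
    simp only [hm]; linarith
  set Γ : En n → ℝ := fun x => sSup ((fun q => ⟪q, x - y⟫ + m q) '' Q) with hΓ
  have hne : ∀ x, ((fun q => ⟪q, x - y⟫ + m q) '' Q).Nonempty := fun x => ⟨_, 0, h0, rfl⟩
  have hbdd : ∀ x, BddAbove ((fun q => ⟪q, x - y⟫ + m q) '' Q) := by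
    intro x
    refine ⟨R * ‖x - y‖, ?_⟩
    rintro _ ⟨q, hq, rfl⟩
    have h1 := real_inner_le_norm q (x - y)
    have h2 := mul_le_mul_of_nonneg_right (hQR q hq) (norm_nonneg (x - y))
    have h3 := hmy q
    simp only
    linarith
  have hle : ∀ x, ∀ q ∈ Q, ⟪q, x - y⟫ + m q ≤ Γ x := fun x q hq => le_csSup (hbdd x) ⟨q, hq, rfl⟩
  have hub : ∀ x c, (∀ q ∈ Q, ⟪q, x - y⟫ + m q ≤ c) → Γ x ≤ c := by
    intro x c h
    refine csSup_le (hne x) ?_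
    rintro _ ⟨q, hq, rfl⟩
    exact h q hq
  have hconv : ConvexOn ℝ univ Γ := by
    refine ⟨convex_univ, fun x _ z _ a b ha hb hab => hub _ _ fun q hq => ?_⟩
    have h1 := mul_le_mul_of_nonneg_left (hle x q hq) ha
    have h2 := mul_le_mul_of_nonneg_left (hle z q hq) hb
    have h3 : a • x + b • z - y = a • (x - y) + b • (z - y) := by
      have : y = (a + b) • y := by rw [hab, one_smul]
      nth_rewrite 1 [this]
      module
    have h4 : m q = a * m q + b * m q := by rw [← add_mul, hab, one_mul]
    rw [h3, inner_add_right, real_inner_smul_right, real_inner_smul_right, h4, smul_eq_mul,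
      smul_eq_mul]
    linarith
  have hΓΘ : ∀ x ∈ T, Γ x ≤ Θ x := fun x hx => hub _ _ fun q _ => by
    have := hX q x hx
    simp only [hm]; linarith
  have hΓε : ∀ x ∈ T, Γ x ≤ -(7 * ε) := fun x hx => hub _ _ fun q hq => by
    have h1 := (abs_le.mp (hQT q hq x hx)).2
    have h2 := hmy q
    linarith
  have hΓc : Continuous Γ := by
    have := hconv.continuousOn isOpen_univ
    rwa [continuousOn_univ] at this
  have hsub : ∀ q ∈ Q, Γ (X q) = Θ (X q) ∧ q ∈ subgrad univ Γ (X q) := by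
    intro q hq
    have h1 := hle (X q) q hq
    have h2 : Γ (X q) = Θ (X q) := le_antisymm (hΓΘ _ (hXT q)) (by simp only [hm] at h1; linarith)
    refine ⟨h2, fun z _ => ?_⟩
    have h3 := hle z q hq
    rw [h2]
    have h4 : z - y = (z - X q) + (X q - y) := by abel
    rw [h4, inner_add_right] at h3
    simp only [hm] at h3
    linarith
  refine ⟨Γ, {x ∈ T | Θ x - Γ x = 0}, hconv, ?_, ?_, hΓΘ, fun x hx => ?_, fun x hx => ?_,
    fun q hq => ⟨X q, ⟨hXT q, ?_⟩, (hsub q hq).2⟩, fun x q hq => ?_⟩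
  · exact hT.of_isClosed_subset ((hΘ.sub hΓc.continuousOn).preimage_isClosed_of_isClosed
      hT.isClosed (isClosed_singleton (x := (0 : ℝ)))) fun x hx => hx.1
  · rintro x ⟨hxT, hx⟩
    by_contra hc
    linarith [hΘT x hxT hc, hΓε x hxT]
  · linarith [hΓε x hx]
  · linarith [hx.2]
  · rw [(hsub q hq).1, sub_self]
  · rcases eq_or_ne q 0 with rfl | hq0
    · rw [norm_zero]
      exact (norm_nonneg _).trans (hQR 0 h0)
    · have h1 := hq (x + q) (mem_univ _)
      have h2 : Γ (x + q) ≤ Γ x + R * ‖q‖ := by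
        refine hub _ _ fun q' hq' => ?_
        have h3 := hle x q' hq'
        have h4 := real_inner_le_norm q' q
        have h5 := mul_le_mul_of_nonneg_right (hQR q' hq') (norm_nonneg q)
        have h6 : x + q - y = (x - y) + q := by abel
        rw [h6, inner_add_right]
        linarith
      rw [add_sub_cancel_left, real_inner_self_eq_norm_mul_norm] at h1
      exact le_of_mul_le_mul_right (by linarith) (norm_pos_iff.mpr hq0)

lemma mem_subgrad_add_affine_iff {Γ γ : En n → ℝ} {e : En n} {k : ℝ}
    (hγ : ∀ x, γ x = Γ x + (⟪e, x⟫ + k)) {x q : En n} :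
    q ∈ subgrad Ω γ x ↔ q - e ∈ subgrad Ω Γ x := by
  refine forall₂_congr fun z _ => ?_
  rw [hγ, hγ, inner_sub_left, inner_sub_right e]
  constructor <;> intro h <;> linarith

lemma subgrad_subset_subgrad_univ {Γ : En n → ℝ} (hΩ : IsOpen Ω) (hΓ : ConvexOn ℝ univ Γ)
    {x : En n} (hx : x ∈ Ω) : subgrad Ω Γ x ⊆ subgrad univ Γ x := by
  intro q hq
  refine subgrad_of_eventually hΓ (mem_univ x) ?_
  filter_upwards [hΩ.mem_nhds hx] with z hz using hq z hz

lemma one_add_mul_pow_le {c s : ℝ} (hc : 0 ≤ c) (hs : 0 ≤ s) (hs1 : s ≤ 1) (k : ℕ) :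
    (1 + c * s) ^ k ≤ 1 + s * ((1 + c) ^ k - 1) := by
  induction k with
  | zero => simp
  | succ k ih =>
    have hA : 1 ≤ (1 + c) ^ k := one_le_pow₀ (by linarith)
    have h1 : 0 ≤ c * ((1 + c) ^ k - 1) := mul_nonneg hc (by linarith)
    have h2 : s * s ≤ s := by nlinarith
    calc (1 + c * s) ^ (k + 1) ≤ (1 + s * ((1 + c) ^ k - 1)) * (1 + c * s) := by
          rw [pow_succ]; gcongr
      _ = 1 + c * s + s * ((1 + c) ^ k - 1) + (c * ((1 + c) ^ k - 1)) * (s * s) := by ring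
      _ ≤ 1 + c * s + s * ((1 + c) ^ k - 1) + (c * ((1 + c) ^ k - 1)) * s := by gcongr
      _ = _ := by ring

/-- Alexandrov–Bakelman–Pucci type estimate for the difference `u - v + s (u - ℓ)`. -/
lemma volume_symPolarAt_le_of_envelope (hΩ : IsOpen Ω) (hu : ConvexOn ℝ Ω u)
    (hv : ConvexOn ℝ Ω v) (huv : ∀ x ∈ Ω, v x ≤ u x)
    {gu gv : En n → ℝ≥0∞} (hgu : ∀ S ⊆ Ω, MeasurableSet S → MAm Ω u S = ∫⁻ x in S, gu x)
    (hgv : ∀ S ⊆ Ω, MeasurableSet S → MAm Ω v S = ∫⁻ x in S, gv x)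
    {T : Set (En n)} (hT : IsCompact T) (hTΩ : T ⊆ Ω)
    (hstrict : ∀ x ∈ T, ∀ p ∈ subgrad Ω u x, StrictContact Ω u x p)
    (hsing : ∀ x ∈ T, (subgrad Ω u x).Subsingleton)
    {M : ℝ} (hM : ∀ x ∈ T, ∀ p ∈ subgrad Ω u x, ‖p‖ ≤ M) {L : ℝ} (hL : 0 ≤ L)
    (hdens : ∀ᵐ x, x ∈ T → ∀ a ∈ subgrad Ω u x, ∀ b ∈ subgrad Ω v x, ∀ τ : ℝ, 0 ≤ τ →
      |u x - v x| ≤ τ → ‖a - b‖ ≤ τ → gu x ≤ ENNReal.ofReal ((1 + L * τ) ^ 2) * gv x)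
    {y e : En n} {k s ε ρ R : ℝ} (hy : y ∈ T) (hε : 0 < ε) (hs : 0 < s) (hs1 : s ≤ 1)
    (hρ : 0 < ρ) (hρT : Metric.closedBall y ρ ⊆ T) (hR : ε ≤ s * R * ρ)
    (hℓ : ∀ x ∈ T, ⟪e, x⟫ + k - u x ≤ 1)
    (hΘy : u y - v y + s * (u y - (⟪e, y⟫ + k)) ≤ -(8 * ε))
    (hΘT : ∀ x ∈ T, x ∉ interior T → -(4 * ε) ≤ u x - v x + s * (u x - (⟪e, x⟫ + k)))
    {c : ℝ} (hc1 : 1 ≤ c) (hcL : L * (1 + R + ‖e‖ + M) ≤ c) :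
    ENNReal.ofReal (ε ^ n) * volume (symPolarAt T y) ≤
      ENNReal.ofReal (((1 + c) ^ (n + 2) * s) ^ n * 2 ^ n) * MAm Ω u T := by
  have hM0 : 0 ≤ M := by
    obtain ⟨p, hp⟩ := subgrad_nonempty hΩ hu (hTΩ hy)
    exact (norm_nonneg _).trans (hM y hy p hp)
  have hR0 : 0 ≤ R := by
    by_contra! hR0
    have : s * R * ρ < 0 := mul_neg_of_neg_of_pos (mul_neg_of_pos_of_neg hs hR0) hρ
    linarith
  set Q : Set (En n) := (fun q => (0 : En n) + ε • q) '' symPolarAt T y with hQ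
  have hQ0 : (0 : En n) ∈ Q := ⟨0, by simp [symPolarAt], by simp⟩
  have hQT : ∀ q ∈ Q, ∀ x ∈ T, |⟪q, x - y⟫| ≤ ε := by
    rintro _ ⟨q, hq, rfl⟩ x hx
    simp only [zero_add]
    rw [real_inner_smul_left, abs_mul, abs_of_pos hε]
    exact mul_le_of_le_one_right hε.le (hq x hx)
  have hQR : ∀ q ∈ Q, ‖q‖ ≤ s * R := by
    intro q hq
    rcases eq_or_ne q 0 with rfl | hq0
    · rw [norm_zero]; positivity
    have hqn : 0 < ‖q‖ := norm_pos_iff.mpr hq0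
    have h1 := hQT q hq (y + (ρ / ‖q‖) • q) (hρT (by
      rw [Metric.mem_closedBall, dist_eq_norm, add_sub_cancel_left, norm_smul, norm_div, norm_norm,
        Real.norm_of_nonneg hρ.le, div_mul_cancel₀ _ hqn.ne']))
    rw [add_sub_cancel_left, real_inner_smul_right, real_inner_self_eq_norm_mul_norm,
      ← mul_assoc, div_mul_cancel₀ _ hqn.ne', abs_of_nonneg (by positivity)] at h1
    exact le_of_mul_le_mul_left (by linarith) hρ
  have hQvol : volume Q = ENNReal.ofReal (ε ^ n) * volume (symPolarAt T y) := by
    rw [hQ, volume_affine_image, abs_of_pos hε]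
  have hcu := (hu.continuousOn hΩ).mono hTΩ
  have hcv := (hv.continuousOn hΩ).mono hTΩ
  obtain ⟨Γ, E, hΓ, hE, hET, hΓΘ, hΓ0, hEeq, hQE, hΓR⟩ := exists_lower_envelope hT hy
    (Θ := fun x => u x - v x + s * (u x - (⟪e, x⟫ + k)))
    ((hcu.sub hcv).add (continuousOn_const.mul (hcu.sub (by fun_prop)))) hε
    hQ0 hQT hQR hΘy hΘT
  have hETT : E ⊆ T := hET.trans interior_subset
  set γ : En n → ℝ := fun x => Γ x + (⟪s • e, x⟫ + s * k) with hγdef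
  have hγc : ConvexOn ℝ Ω γ := by
    have h1 : ConvexOn ℝ Ω (fun x => ⟪s • e, x⟫ + s * k) := by
      refine ⟨hu.1, fun x _ z _ a b _ _ hab => le_of_eq ?_⟩
      simp only [inner_add_right, real_inner_smul_right, smul_eq_mul]
      linear_combination (-(s * k)) * hab
    exact (hΓ.subset (subset_univ _) hu.1).add h1
  have hiff : ∀ x q, q ∈ subgrad Ω γ x ↔ q - s • e ∈ subgrad Ω Γ x := fun x q =>
    mem_subgrad_add_affine_iff (fun _ => rfl)
  have hle : ∀ x ∈ E, ∀ᶠ z in 𝓝 x, (v + γ) z ≤ (1 + s) * u z := by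
    intro x hx
    filter_upwards [mem_interior_iff_mem_nhds.mp (hET hx)] with z hz
    have := hΓΘ z hz
    simp only [Pi.add_apply, hγdef, real_inner_smul_left]
    linarith
  have heq : ∀ x ∈ E, (v + γ) x = (1 + s) * u x := by
    intro x hx
    have := hEeq x hx
    simp only [Pi.add_apply, hγdef, real_inner_smul_left]
    linarith
  set C : ℝ := 1 + R + ‖e‖ + M with hC
  have hC1 : 1 ≤ C := by have := norm_nonneg e; linarith
  have hdensE : ∀ᵐ x, x ∈ E →
      gu x ≤ ENNReal.ofReal (1 + ((1 + L * (C * s)) ^ 2 - 1)) * gv x := by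
    filter_upwards [hdens] with x hx hxE
    have hxT := hETT hxE
    have hxΩ := hTΩ hxT
    obtain ⟨a, ha⟩ := subgrad_nonempty hΩ hu hxΩ
    obtain ⟨b, hb⟩ := subgrad_nonempty hΩ hv hxΩ
    obtain ⟨q, hq⟩ := subgrad_nonempty hΩ hγc hxΩ
    rw [add_sub_cancel]
    refine hx hxT a ha b hb (C * s) (by positivity) ?_ ?_
    · have h1 := hEeq x hxE
      have h2 := hΓ0 x hxT
      have h3 := mul_le_mul_of_nonneg_left (hℓ x hxT) hs.le
      rw [abs_of_nonneg (by linarith [huv x hxΩ])]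
      have h4 : s * 1 ≤ C * s := by nlinarith
      linarith
    · have h1 : (1 + s)⁻¹ • (b + q) ∈ subgrad Ω u x := by
        refine smul_mem_subgrad_of_touch hu (by linarith) hxΩ (heq x hxE) (hle x hxE) ?_
        filter_upwards [hΩ.mem_nhds hxΩ] with z hz
        have h3 := hb z hz
        have h4 := hq z hz
        simp only [Pi.add_apply, inner_add_left]
        linarith
      have h2 : a = (1 + s)⁻¹ • (b + q) := hsing x hxT ha h1
      have h3 : b + q = (1 + s) • a := by
        rw [h2, smul_smul, mul_inv_cancel₀ (by linarith), one_smul]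
      have h4 : a - b = (q - s • e) + s • e - s • a := by
        have : b = (1 + s) • a - q := by rw [← h3]; abel
        rw [this]; module
      have h5 := hΓR x _ (subgrad_subset_subgrad_univ hΩ hΓ hxΩ ((hiff x q).mp hq))
      have h6 := hM x hxT a ha
      rw [h4]
      calc ‖(q - s • e) + s • e - s • a‖ ≤ ‖q - s • e‖ + ‖s • e‖ + ‖s • a‖ :=
            (norm_sub_le _ _).trans (by gcongr; exact norm_add_le _ _)
        _ ≤ s * R + s * ‖e‖ + s * M := by
            rw [norm_smul, norm_smul, Real.norm_of_nonneg hs.le]; gcongr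
        _ ≤ C * s := by rw [hC]; linarith
  have hκ : (1 + s) ^ n * (1 + ((1 + L * (C * s)) ^ 2 - 1)) ≤ 1 + (1 + c) ^ (n + 2) * s := by
    rw [add_sub_cancel]
    calc (1 + s) ^ n * (1 + L * (C * s)) ^ 2 ≤ (1 + c * s) ^ n * (1 + c * s) ^ 2 := by
          have h1 : s ≤ c * s := by nlinarith
          have h2 : L * (C * s) ≤ c * s := by rw [← mul_assoc]; gcongr
          gcongr
      _ = (1 + c * s) ^ (n + 2) := by rw [pow_add]
      _ ≤ 1 + s * ((1 + c) ^ (n + 2) - 1) := one_add_mul_pow_le (by linarith) hs.le hs1 _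
      _ ≤ _ := by linarith
  have hmain := MAm_le_of_contact hΩ hu hv hγc (t := 1 + s) (by linarith)
    (by positivity) hκ hE (hETT.trans hTΩ) heq hle (fun x hx => hstrict x (hETT hx)) hgu hgv hdensE
  calc ENNReal.ofReal (ε ^ n) * volume (symPolarAt T y) = volume Q := hQvol.symm
    _ = volume ((fun q => s • e + (1 : ℝ) • q) '' Q) := by rw [volume_affine_image (s • e) 1 Q, abs_one]; simp
    _ ≤ MAm Ω γ E := by
        refine measure_mono ?_
        rintro _ ⟨q, hq, rfl⟩
        obtain ⟨x, hx, hqx⟩ := hQE q hq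
        refine mem_biUnion hx ((hiff x _).mpr ?_)
        simp only [one_smul, add_sub_cancel_left]
        exact fun z _ => hqx z (mem_univ z)
    _ ≤ _ := hmain
    _ ≤ _ := by
        gcongr
        · linarith
        · exact measure_mono (biUnion_subset_biUnion_left hETT)

end Envelope

section Density
open Topology

variable {n : ℕ} {Ω : Set (En n)} {u v : En n → ℝ}

lemma eventually_sub_le_mul_norm (hΩ : IsOpen Ω) (hu : ConvexOn ℝ Ω u) {y p : En n} (hy : y ∈ Ω)
    (hp : subgrad Ω u y ⊆ {p}) {ε : ℝ} (hε : 0 < ε) :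
    ∀ᶠ z in 𝓝 y, u z - (u y + ⟪p, z - y⟫) ≤ ε * ‖z - y‖ := by
  filter_upwards [hΩ.mem_nhds hy, eventually_subgrad_dist_lt hΩ hu hy hp hε] with z hz hd
  obtain ⟨q, hq⟩ := subgrad_nonempty hΩ hu hz
  have h1 := hq y hy
  have h2 := hd q hq
  rw [dist_eq_norm] at h2
  have h3 := real_inner_le_norm (q - p) (z - y)
  have h4 := mul_le_mul_of_nonneg_right h2.le (norm_nonneg (z - y))
  rw [← neg_sub z y, inner_neg_right] at h1
  rw [inner_sub_left] at h3
  linarith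

lemma hasGradientAt_of_subgrad_subset (hΩ : IsOpen Ω) (hu : ConvexOn ℝ Ω u) {y p : En n}
    (hy : y ∈ Ω) (hp : subgrad Ω u y ⊆ {p}) : HasGradientAt u p y := by
  have hpy : p ∈ subgrad Ω u y := by
    obtain ⟨q, hq⟩ := subgrad_nonempty hΩ hu hy
    rwa [← mem_singleton_iff.mp (hp hq)]
  rw [hasGradientAt_iff_isLittleO, Asymptotics.isLittleO_iff]
  intro c hc
  filter_upwards [hΩ.mem_nhds hy, eventually_sub_le_mul_norm hΩ hu hy hp hc] with z hz h1
  have h2 := hpy z hz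
  rw [Real.norm_eq_abs, abs_of_nonneg (by linarith)]
  linarith

lemma legendreT_eq {x p : En n} (hx : x ∈ Ω) (hp : p ∈ subgrad Ω u x) :
    legendreT Ω u p = ⟪x, p⟫ - u x := by
  refine IsGreatest.csSup_eq ⟨⟨x, hx, rfl⟩, ?_⟩
  rintro _ ⟨z, hz, rfl⟩
  have := hp z hz
  rw [inner_sub_right, real_inner_comm, real_inner_comm x] at this
  simp only
  linarith

lemma mul_div_le_of_close {f Fu Fv Gu Gv lam K τ : ℝ} (hf : 0 ≤ f) (hlam : 0 < lam) (hK : 0 ≤ K)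
    (hτ : 0 ≤ τ) (hFv : lam ≤ Fv) (hGu : lam ≤ Gu) (hGv : lam ≤ Gv) (hF : Fu ≤ Fv + K * τ)
    (hG : Gv ≤ Gu + K * τ) :
    f * Fu / Gu ≤ (1 + K / lam * τ) ^ 2 * (f * Fv / Gv) := by
  have hGu0 := hlam.trans_le hGu
  have hGv0 := hlam.trans_le hGv
  have hFv0 := hlam.trans_le hFv
  set L := K / lam with hL
  have hKL : K * τ = L * τ * lam := by rw [hL]; field_simp
  have hL0 : 0 ≤ L * τ := by positivity
  have h1 : Fu ≤ (1 + L * τ) * Fv := by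
    have := mul_le_mul_of_nonneg_left hFv hL0
    linarith
  have h2 : Gv ≤ (1 + L * τ) * Gu := by
    have := mul_le_mul_of_nonneg_left hGu hL0
    linarith
  rw [div_le_iff₀ hGu0]
  have h3 : 1 ≤ (1 + L * τ) * Gu / Gv := by rwa [le_div_iff₀ hGv0, one_mul]
  calc f * Fu ≤ f * ((1 + L * τ) * Fv) := by gcongr
    _ ≤ f * ((1 + L * τ) * Fv) * ((1 + L * τ) * Gu / Gv) :=
        le_mul_of_one_le_right (by positivity) h3
    _ = _ := by ring

lemma eventually_density_le (hΩ : IsOpen Ω) (hu : ConvexOn ℝ Ω u) (hv : ConvexOn ℝ Ω v)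
    (huv : ∀ x ∈ Ω, v x ≤ u x) {f : En n → ℝ} (hf : ∀ x ∈ Ω, 0 ≤ f x) {F G : En n × ℝ → ℝ}
    {lam Lam : ℝ} (hlam : 0 < lam) (hFb : ∀ p : En n × ℝ, lam ≤ F p ∧ F p ≤ Lam)
    (hGb : ∀ p : En n × ℝ, lam ≤ G p ∧ G p ≤ Lam) (hF : LocallyLipschitz F)
    (hG : LocallyLipschitz G) {y p : En n} (hy : y ∈ Ω) (hyuv : u y = v y)
    (hp : subgrad Ω u y ⊆ {p}) :
    ∃ L : ℝ, 0 ≤ L ∧ ∀ᶠ x in 𝓝 y, ∀ a ∈ subgrad Ω u x, ∀ b ∈ subgrad Ω v x, ∀ τ : ℝ, 0 ≤ τ →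
      |u x - v x| ≤ τ → ‖a - b‖ ≤ τ →
      f x * F (x, u x) / G (a, ⟪x, a⟫ - u x) ≤
        (1 + L * τ) ^ 2 * (f x * F (x, v x) / G (b, ⟪x, b⟫ - v x)) := by
  have hpv : subgrad Ω v y ⊆ {p} := fun q hq => hp fun z hz => by
    rw [hyuv]; exact (hq z hz).trans (huv z hz)
  obtain ⟨KF, sF, hsF, hKF⟩ := hF (y, u y)
  obtain ⟨KG, sG, hsG, hKG⟩ := hG (p, ⟪y, p⟫ - u y)
  have hcu : ContinuousAt u y := (hu.continuousOn hΩ).continuousAt (hΩ.mem_nhds hy)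
  have hcv : ContinuousAt v y := (hv.continuousOn hΩ).continuousAt (hΩ.mem_nhds hy)
  have hFu : ∀ᶠ x in 𝓝 y, (x, u x) ∈ sF :=
    (continuousAt_id.prodMk hcu).eventually_mem hsF
  have hFv : ∀ᶠ x in 𝓝 y, (x, v x) ∈ sF := by
    refine (continuousAt_id.prodMk hcv).eventually_mem ?_
    rwa [← hyuv]
  have hGw : ∀ {w : En n → ℝ}, ConvexOn ℝ Ω w → ContinuousAt w y → subgrad Ω w y ⊆ {p} →
      w y = u y → ∀ᶠ x in 𝓝 y, ∀ a ∈ subgrad Ω w x, (a, ⟪x, a⟫ - w x) ∈ sG := by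
    intro w hw hwc hwp hwy
    have hc : ContinuousAt (fun z : En n × En n => (z.2, ⟪z.1, z.2⟫ - w z.1)) (y, p) := by
      refine continuousAt_snd.prodMk (ContinuousAt.sub (by fun_prop) ?_)
      exact ContinuousAt.comp (f := Prod.fst) (x := (y, p)) (by exact hwc) continuousAt_fst
    have hmem := hc.eventually_mem (s := sG) (by simpa [hwy] using hsG)
    obtain ⟨δ, hδ, hball⟩ := Metric.eventually_nhds_iff.mp hmem
    filter_upwards [Metric.ball_mem_nhds y hδ, eventually_subgrad_dist_lt hΩ hw hy hwp hδ]
      with x hx hd a ha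
    exact hball (y := (x, a)) (by rw [Prod.dist_eq]; exact max_lt hx (hd a ha))
  set K : ℝ := max KF (KG * (‖y‖ + 2)) with hK
  have hK0 : 0 ≤ K := le_max_of_le_left KF.2
  refine ⟨K / lam, by positivity, ?_⟩
  filter_upwards [hΩ.mem_nhds hy, hFu, hFv, hGw hu hcu hp rfl, hGw hv hcv hpv hyuv.symm,
    Metric.ball_mem_nhds y one_pos] with x hx h1 h2 h3 h4 h5 a ha b hb τ hτ hτu hτa
  refine mul_div_le_of_close (hf x hx) hlam hK0 hτ (hFb _).1 (hGb _).1 (hGb _).1 ?_ ?_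
  · have h6 := hKF.dist_le_mul _ h1 _ h2
    rw [Real.dist_eq, Prod.dist_eq, dist_self, Real.dist_eq, max_eq_right (abs_nonneg _)] at h6
    have h7 : (KF : ℝ) * |u x - v x| ≤ K * τ :=
      mul_le_mul (le_max_left _ _) hτu (abs_nonneg _) hK0
    linarith [le_abs_self (F (x, u x) - F (x, v x))]
  · have h6 := hKG.dist_le_mul _ (h4 b hb) _ (h3 a ha)
    have h7 : dist (b, ⟪x, b⟫ - v x) (a, ⟪x, a⟫ - u x) ≤ (‖y‖ + 2) * τ := by
      rw [Prod.dist_eq]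
      refine max_le ?_ ?_
      · rw [dist_comm, dist_eq_norm]
        have := norm_nonneg y
        nlinarith
      · have h8 : ⟪x, b⟫ - v x - (⟪x, a⟫ - u x) = (u x - v x) - ⟪x, a - b⟫ := by
          rw [inner_sub_right]; ring
        have h9 : ‖x‖ ≤ ‖y‖ + 1 := by
          rw [mem_ball_iff_norm] at h5
          linarith [norm_le_norm_add_norm_sub' x y]
        have h10 : |⟪x, a - b⟫| ≤ (‖y‖ + 1) * τ :=
          (abs_real_inner_le_norm _ _).trans (mul_le_mul h9 hτa (norm_nonneg _) (by positivity))
        rw [Real.dist_eq, h8]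
        linarith [abs_sub (u x - v x) ⟪x, a - b⟫]
    rw [Real.dist_eq] at h6
    have h8 : (KG : ℝ) * dist (b, ⟪x, b⟫ - v x) (a, ⟪x, a⟫ - u x) ≤ K * τ := by
      calc (KG : ℝ) * dist (b, ⟪x, b⟫ - v x) (a, ⟪x, a⟫ - u x)
          ≤ KG * ((‖y‖ + 2) * τ) := mul_le_mul_of_nonneg_left h7 KG.2
        _ = KG * (‖y‖ + 2) * τ := by ring
        _ ≤ K * τ := mul_le_mul_of_nonneg_right (le_max_right _ _) hτ
    linarith [le_abs_self (G (b, ⟪x, b⟫ - v x) - G (a, ⟪x, a⟫ - u x))]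

/-- Rewriting of the density of a generalized solution in terms of subgradients. -/
lemma ae_density_eq (hΩ : IsOpen Ω) (hu : ConvexOn ℝ Ω u) (f : En n → ℝ) (F G : En n × ℝ → ℝ) :
    ∀ᵐ x, x ∈ Ω → ∀ a ∈ subgrad Ω u x,
      f x * F (x, u x) / G (gradient u x, legendreT Ω u (gradient u x)) =
        f x * F (x, u x) / G (a, ⟪x, a⟫ - u x) := by
  filter_upwards [ae_subgrad_subsingleton hΩ hu] with x hx hxΩ a ha
  have h1 : subgrad Ω u x ⊆ {a} := fun q hq => hx hxΩ hq ha
  rw [(hasGradientAt_of_subgrad_subset hΩ hu hxΩ h1).gradient, legendreT_eq hxΩ ha]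

end Density

section ContactGap
open Topology

variable {n : ℕ} {Ω : Set (En n)} {u v : En n → ℝ}

lemma natCast_mul_le_of_mass_bounds {N n : ℕ} {c₀ C₁ Vs VT VS MS MT : ℝ≥0∞} {s r B : ℝ}
    (hs : 0 < s) (hr : 0 < r) (hB : 0 ≤ B)
    (h1 : ENNReal.ofReal ((s * r / 16) ^ n) * Vs ≤ ENNReal.ofReal ((B * s) ^ n * 2 ^ n) * MT)
    (h2 : c₀ ≤ Vs * VT) (h3 : N * VT ≤ 2 ^ n * VS) (hMT : MT ≤ MS)
    (h4 : VS * MS ≤ C₁ * ENNReal.ofReal (r ^ n)) :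
    N * c₀ ≤ 2 ^ n * C₁ * ENNReal.ofReal ((32 * B) ^ n) := by
  set ε : ℝ≥0∞ := ENNReal.ofReal ((s * r / 16) ^ n) with hε
  have hε0 : ε ≠ 0 := by
    rw [hε, Ne, ENNReal.ofReal_eq_zero, not_le]; positivity
  refine (ENNReal.mul_le_mul_iff_left hε0 ENNReal.ofReal_ne_top).mp ?_
  calc N * c₀ * ε ≤ N * (Vs * VT) * ε := by gcongr
    _ = (N * VT) * (ε * Vs) := by ring
    _ ≤ (2 ^ n * VS) * (ENNReal.ofReal ((B * s) ^ n * 2 ^ n) * MS) := by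
        exact mul_le_mul' h3 (h1.trans (by gcongr))
    _ = 2 ^ n * ENNReal.ofReal ((B * s) ^ n * 2 ^ n) * (VS * MS) := by ring
    _ ≤ 2 ^ n * ENNReal.ofReal ((B * s) ^ n * 2 ^ n) * (C₁ * ENNReal.ofReal (r ^ n)) := by gcongr
    _ = 2 ^ n * C₁ * (ENNReal.ofReal ((B * s) ^ n * 2 ^ n) * ENNReal.ofReal (r ^ n)) := by ring
    _ = 2 ^ n * C₁ * (ENNReal.ofReal ((32 * B) ^ n) * ε) := by
        rw [hε, ← ENNReal.ofReal_mul (by positivity), ← ENNReal.ofReal_mul (by positivity),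
          ← mul_pow, ← mul_pow, ← mul_pow]
        congr 3
        ring
    _ = _ := by ring

/-- The contact set of two ordered solutions cannot lie, near a strictly convex contact point `y`,
above a function whose graph is a proper wedge. -/
lemma false_of_contact_gap (hΩ : IsOpen Ω) (hu : ConvexOn ℝ Ω u) (hv : ConvexOn ℝ Ω v)
    (huv : ∀ x ∈ Ω, v x ≤ u x) {f : En n → ℝ} (hf : ∀ x ∈ Ω, 0 ≤ f x) {F G : En n × ℝ → ℝ}
    {lam Lam : ℝ} (hlam : 0 < lam) (hFb : ∀ p : En n × ℝ, lam ≤ F p ∧ F p ≤ Lam)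
    (hGb : ∀ p : En n × ℝ, lam ≤ G p ∧ G p ≤ Lam) (hF : LocallyLipschitz F)
    (hG : LocallyLipschitz G) (hMu : IsGenSol Ω f F G u) (hMv : IsGenSol Ω f F G v)
    {D : ℝ≥0∞} (hD : D ≠ ⊤) (hdoub : IsDoublingOn Ω (MAm Ω u) D) {y py p : En n} (hy : y ∈ Ω)
    (hyuv : u y = v y) (hpy : py ∈ subgrad Ω u y) {ρ₀ : ℝ} (hρ₀ : 0 < ρ₀)
    (hρ₀Ω : Metric.closedBall y ρ₀ ⊆ Ω)
    (hstrict : ∀ x ∈ Metric.closedBall y ρ₀, ∀ q ∈ subgrad Ω u x, StrictContact Ω u x q)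
    (hp : p ≠ 0)
    (hK : ∀ x ∈ Metric.closedBall y ρ₀, u x = v x → -⟪p, x - y⟫ ≤ u x - (u y + ⟪py, x - y⟫)) :
    False := by
  have hsy : StrictContact Ω u y py := hstrict y (Metric.mem_closedBall_self hρ₀.le) py hpy
  have hsing := hsy.subgrad_subset hΩ hu hD hdoub
  have hpn : 0 < ‖p‖ := norm_pos_iff.mpr hp
  obtain ⟨L, hL, hdens⟩ := eventually_density_le hΩ hu hv huv hf hlam hFb hGb hF hG hy hyuv hsing
  obtain ⟨ρ, hρ, hρall⟩ := Metric.nhds_basis_closedBall.mem_iff.mp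
    (hdens.and ((eventually_subgrad_dist_lt hΩ hu hy hsing one_pos).and
      (Metric.closedBall_mem_nhds y hρ₀)))
  have hρρ₀ : Metric.closedBall y ρ ⊆ Metric.closedBall y ρ₀ := fun x hx => (hρall hx).2.2
  have hρΩ : Metric.closedBall y ρ ⊆ Ω := hρρ₀.trans hρ₀Ω
  set e : En n := py - (1 / 2 : ℝ) • p with he
  set R : ℝ := (1 + ‖p‖) / 16 with hR
  set M : ℝ := ‖py‖ + 1 with hM
  set c : ℝ := max 1 (L * (1 + R + ‖e‖ + M)) with hc
  have hc1 : 1 ≤ c := le_max_left _ _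
  obtain ⟨C₁, hC₁, hsec⟩ := volume_mul_MAm_usec_le n hD
  obtain ⟨c₀, C₀, hc₀, -, -, hpol⟩ := exists_polar_bounds n
  obtain ⟨N, hN⟩ := ENNReal.exists_nat_mul_gt hc₀
    (b := 2 ^ n * C₁ * ENNReal.ofReal ((32 * (1 + c) ^ (n + 2)) ^ n))
    (by simp [ENNReal.mul_eq_top, hC₁])
  refine hN.not_ge ?_
  obtain ⟨m, hm, hgap⟩ := hsy.exists_gap hΩ hu hρ hρΩ
  have hN1 : (0 : ℝ) < 4 * N + 1 := by positivity
  obtain ⟨η, hη, hηall⟩ := Metric.nhds_basis_ball.mem_iff.mp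
    ((eventually_sub_le_mul_norm hΩ hu hy hsing (ε := min 1 (‖p‖ / (4 * N + 1)))
      (by positivity)).and (hΩ.mem_nhds hy))
  obtain ⟨r, hr, hr1, hrm, hrη, hrη'⟩ : ∃ r : ℝ, 0 < r ∧ r ≤ 1 ∧ r < m ∧ r < η ∧
      (4 * N + 1) * r / ‖p‖ < η := by
    refine ⟨min 1 (min (m / 2) (min (η / 2) (η * ‖p‖ / (4 * N + 1) / 2))), by positivity,
      min_le_left _ _, ?_, ?_, ?_⟩
    · refine lt_of_le_of_lt ((min_le_right _ _).trans (min_le_left _ _)) (by linarith)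
    · refine lt_of_le_of_lt ((min_le_right _ _).trans ((min_le_right _ _).trans
        (min_le_left _ _))) (by linarith)
    · have h1 : min 1 (min (m / 2) (min (η / 2) (η * ‖p‖ / (4 * N + 1) / 2))) <
          η * ‖p‖ / (4 * N + 1) := by
        refine lt_of_le_of_lt ((min_le_right _ _).trans ((min_le_right _ _).trans
          (min_le_right _ _))) (half_lt_self (by positivity))
      rw [lt_div_iff₀ hN1] at h1
      rw [div_lt_iff₀ hpn]
      linarith
  set k₀ : ℝ := u y - ⟪py, y⟫ + r with hk₀
  set V : En n → ℝ := fun x => u x - (u y + ⟪py, x - y⟫) with hV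
  have hV0 : ∀ x ∈ Ω, 0 ≤ V x := fun x hx => by
    have := hpy x hx
    simp only [hV]; linarith
  have hVk : ∀ x, V x = u x - (⟪py, x⟫ + k₀) + r := fun x => by
    simp only [hV, hk₀, inner_sub_right]; ring
  have hVy : V y = 0 := by simp [hV]
  set S : Set (En n) := usec Ω u py k₀ with hS
  have hSiff : ∀ x, x ∈ S ↔ x ∈ Ω ∧ V x ≤ r := fun x => by
    rw [hVk]
    exact and_congr_right fun _ => by constructor <;> intro h <;> linarith
  have hyS : y ∈ S := (hSiff y).mpr ⟨hy, by rw [hVy]; exact hr.le⟩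
  have hSball : S ⊆ Metric.ball y ρ := by
    refine usec_subset_ball hu (fun x hx => ?_) (Metric.mem_closedBall_self hρ.le) hyS
    have h1 : m ≤ V x := hgap x hx
    rw [hVk] at h1
    linarith
  have hScb := hSball.trans Metric.ball_subset_closedBall
  have hSc : IsCompact S := isCompact_usec hΩ hu hρΩ hScb
  set T : Set (En n) := S ∩ {x | |⟪p, x - y⟫| ≤ r} with hTdef
  have hTS : T ⊆ S := inter_subset_left
  have hT : IsCompact T := hSc.inter_right (isClosed_le (by fun_prop) continuous_const)
  have hTΩ : T ⊆ Ω := fun x hx => ((hSiff x).mp hx.1).1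
  have hTcb : T ⊆ Metric.closedBall y ρ := hTS.trans hScb
  have hTconv : Convex ℝ T := by
    refine (convex_usec hu _ _).inter ?_
    intro x hx z hz a b ha hb hab
    have h1 : a • x + b • z - y = a • (x - y) + b • (z - y) := by
      have : y = (a + b) • y := by rw [hab, one_smul]
      nth_rewrite 1 [this]
      module
    have hx := abs_le.mp (show |⟪p, x - y⟫| ≤ r from hx)
    have hz := abs_le.mp (show |⟪p, z - y⟫| ≤ r from hz)
    have h2 : r = a * r + b * r := by rw [← add_mul, hab, one_mul]
    rw [mem_ofPred_eq, h1, inner_add_right, real_inner_smul_right, real_inner_smul_right, abs_le]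
    constructor
    · nlinarith [mul_le_mul_of_nonneg_left hx.1 ha, mul_le_mul_of_nonneg_left hz.1 hb]
    · nlinarith [mul_le_mul_of_nonneg_left hx.2 ha, mul_le_mul_of_nonneg_left hz.2 hb]
  have hyT : y ∈ T := ⟨hyS, by simp [hr.le]⟩
  have hball : Metric.closedBall y (r / (1 + ‖p‖)) ⊆ T := by
    intro x hx
    rw [mem_closedBall_iff_norm, le_div_iff₀ (by positivity)] at hx
    have h0 : 0 ≤ ‖x - y‖ * ‖p‖ := by positivity
    have hxη : x ∈ Metric.ball y η := by
      rw [mem_ball_iff_norm]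
      linarith
    obtain ⟨h1, h2⟩ := hηall hxη
    have h3 : min 1 (‖p‖ / (4 * N + 1)) * ‖x - y‖ ≤ 1 * ‖x - y‖ :=
      mul_le_mul_of_nonneg_right (min_le_left _ _) (norm_nonneg _)
    refine ⟨(hSiff x).mpr ⟨h2, ?_⟩, ?_⟩
    · simp only [hV]; linarith
    · have h4 := abs_real_inner_le_norm p (x - y)
      have h5 := norm_nonneg (x - y)
      rw [mem_ofPred_eq]
      linarith
  have hVc : ContinuousOn V Ω := (hu.continuousOn hΩ).sub (by fun_prop)
  have hbdry : ∀ x ∈ T, x ∉ interior T → V x = r ∨ ⟪p, x - y⟫ = r ∨ ⟪p, x - y⟫ = -r := by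
    intro x hx hxi
    by_contra! hcon
    refine hxi (mem_interior_iff_mem_nhds.mpr ?_)
    have h1 : V x < r := lt_of_le_of_ne ((hSiff x).mp hx.1).2 hcon.1
    have h2 : |⟪p, x - y⟫| < r := by
      refine lt_of_le_of_ne hx.2 fun h => ?_
      rcases (abs_eq hr.le).mp h with h | h
      exacts [hcon.2.1 h, hcon.2.2 h]
    refine Filter.inter_mem (usec_mem_nhds hΩ hu (hTΩ hx) ?_) ?_
    · rw [hVk] at h1; linarith
    · have h3 : ContinuousAt (fun z => |⟪p, z - y⟫|) x := by fun_prop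
      filter_upwards [h3.eventually_lt continuousAt_const h2] with z hz using hz.le
  have hslab : N * volume T ≤ 2 ^ n * volume S := by
    refine slab_volume_le (convex_usec hu _ _) hTS hT.measurableSet
      (ξ := fun x => r⁻¹ * ⟪p, x - y⟫) ?_ ?_ (q₀ := y - (((4 * N + 1) * r / ‖p‖ ^ 2)) • p) ?_ ?_
    · intro q q' t
      have h1 : (1 - t) • q + t • q' - y = (1 - t) • (q - y) + t • (q' - y) := by module
      simp only [h1, inner_add_right, real_inner_smul_right]
      ring
    · intro q hq
      rw [abs_mul, abs_inv, abs_of_pos hr, inv_mul_le_iff₀ hr, mul_one]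
      exact hq.2
    · have hnorm : ‖(y - ((4 * N + 1) * r / ‖p‖ ^ 2) • p) - y‖ = (4 * N + 1) * r / ‖p‖ := by
        rw [sub_sub_cancel_left, norm_neg, norm_smul, Real.norm_of_nonneg (by positivity)]
        field_simp
      obtain ⟨h1, h2⟩ := hηall (show (y - ((4 * N + 1) * r / ‖p‖ ^ 2) • p) ∈ Metric.ball y η by
        rwa [mem_ball_iff_norm, hnorm])
      refine (hSiff _).mpr ⟨h2, h1.trans ?_⟩
      rw [hnorm]
      calc min 1 (‖p‖ / (4 * N + 1)) * ((4 * N + 1) * r / ‖p‖)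
          ≤ ‖p‖ / (4 * N + 1) * ((4 * N + 1) * r / ‖p‖) :=
            mul_le_mul_of_nonneg_right (min_le_right _ _) (by positivity)
        _ = r := by field_simp
    · rw [sub_sub_cancel_left, inner_neg_right, real_inner_smul_right,
        real_inner_self_eq_norm_sq, div_mul_cancel₀ _ (by positivity), mul_neg, abs_neg,
        abs_of_nonneg (by positivity)]
      refine le_of_eq ?_
      field_simp
  set k : ℝ := u y - ⟪e, y⟫ + r / 2 with hk
  have hℓ : ∀ x, u x - (⟪e, x⟫ + k) = V x - (r / 2 - 1 / 2 * ⟪p, x - y⟫) := fun x => by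
    simp only [hV, hk, he, inner_sub_left, inner_sub_right, real_inner_smul_left]
    ring
  set Bd : Set (En n) := {x ∈ T ∩ (interior T)ᶜ | u x - (⟪e, x⟫ + k) ≤ -(r / 4)} with hBd
  have hcu := hu.continuousOn hΩ
  have hcv := hv.continuousOn hΩ
  have hTi : IsCompact (T ∩ (interior T)ᶜ) := hT.inter_right isOpen_interior.isClosed_compl
  have hBdT : Bd ⊆ T := fun x hx => hx.1.1
  have hBdc : IsCompact Bd := by
    refine hTi.of_isClosed_subset ?_ fun x hx => hx.1
    have h1 : ContinuousOn (fun x => u x - (⟪e, x⟫ + k)) (T ∩ (interior T)ᶜ) :=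
      (hcu.mono (inter_subset_left.trans hTΩ)).sub (by fun_prop)
    exact h1.preimage_isClosed_of_isClosed hTi.isClosed isClosed_Iic
  have hnotK : ∀ x ∈ Bd, 0 < u x - v x := by
    intro x hx
    have hxT := hBdT hx
    refine lt_of_le_of_ne (by linarith [huv x (hTΩ hxT)]) fun h => ?_
    have h1 : -⟪p, x - y⟫ ≤ V x := hK x (hρρ₀ (hTcb hxT)) (by linarith)
    have h2 := hx.2
    have h3 := hV0 x (hTΩ hxT)
    have h4 := abs_le.mp (show |⟪p, x - y⟫| ≤ r from hxT.2)
    rw [hℓ] at h2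
    rcases hbdry x hxT hx.1.2 with h5 | h5 | h5 <;> linarith
  obtain ⟨m₀, hm₀, hm₀Bd⟩ := exists_pos_le_of_compact hBdc
    (g := fun x => u x - v x) ((hcu.sub hcv).mono (hBdT.trans hTΩ)) hnotK
  set s : ℝ := min 1 (m₀ / r) with hs
  have hs0 : 0 < s := by positivity
  have hs1 : s ≤ 1 := min_le_left _ _
  have hsr : s * r ≤ m₀ := by
    rw [← le_div_iff₀ hr]; exact min_le_right _ _
  have hdensT : ∀ᵐ x, x ∈ T → ∀ a ∈ subgrad Ω u x, ∀ b ∈ subgrad Ω v x, ∀ τ : ℝ, 0 ≤ τ →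
      |u x - v x| ≤ τ → ‖a - b‖ ≤ τ → ENNReal.ofReal
        (f x * F (x, u x) / G (gradient u x, legendreT Ω u (gradient u x))) ≤
      ENNReal.ofReal ((1 + L * τ) ^ 2) * ENNReal.ofReal
        (f x * F (x, v x) / G (gradient v x, legendreT Ω v (gradient v x))) := by
    filter_upwards [ae_density_eq hΩ hu f F G, ae_density_eq hΩ hv f F G]
      with x h1 h2 hxT a ha b hb τ hτ hτu hτa
    rw [h1 (hTΩ hxT) a ha, h2 (hTΩ hxT) b hb, ← ENNReal.ofReal_mul (by positivity)]
    exact ENNReal.ofReal_le_ofReal ((hρall (hTcb hxT)).1 a ha b hb τ hτ hτu hτa)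
  have hmain := volume_symPolarAt_le_of_envelope hΩ hu hv huv hMu hMv hT hTΩ
    (fun x hx => hstrict x (hρρ₀ (hTcb hx)))
    (fun x hx q hq q' hq' => by
      have hsub := (hstrict x (hρρ₀ (hTcb hx)) q hq).subgrad_subset hΩ hu hD hdoub
      exact (hsub hq').symm)
    (M := M) (fun x hx q hq => by
      have h1 := (hρall (hTcb hx)).2.1 q hq
      rw [dist_eq_norm] at h1
      linarith [norm_le_norm_add_norm_sub' q py])
    hL hdensT (y := y) (e := e) (k := k) (s := s) (ε := s * r / 16) (ρ := r / (1 + ‖p‖)) (R := R)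
    hyT (by positivity) hs0 hs1 (by positivity) hball
    (le_of_eq (by rw [hR]; field_simp))
    (fun x hx => by
      have h1 := hℓ x
      have h2 := hV0 x (hTΩ hx)
      have h4 := abs_le.mp (show |⟪p, x - y⟫| ≤ r from hx.2)
      linarith)
    (by
      rw [hℓ, hVy, hyuv, sub_self, sub_self, inner_zero_right]
      exact le_of_eq (by ring))
    (fun x hx hxi => by
      have h1 := huv x (hTΩ hx)
      by_cases hb : u x - (⟪e, x⟫ + k) ≤ -(r / 4)
      · have h2 := hm₀Bd x ⟨⟨hx, hxi⟩, hb⟩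
        have h3 : -r ≤ u x - (⟪e, x⟫ + k) := by
          rw [hℓ]
          have h4 := abs_le.mp (show |⟪p, x - y⟫| ≤ r from hx.2)
          linarith [hV0 x (hTΩ hx)]
        have h4 := mul_le_mul_of_nonneg_left h3 hs0.le
        have h5 : 0 < s * r := by positivity
        linarith
      · have h4 := mul_le_mul_of_nonneg_left (not_le.mp hb).le hs0.le
        linarith)
    hc1 (le_max_right _ _)
  refine natCast_mul_le_of_mass_bounds hs0 hr (by positivity) hmain
    (hpol T hT hTconv ⟨y, ?_⟩ y hyT).1 hslab
    (measure_mono (biUnion_subset_biUnion_left hTS)) (hsec Ω u hΩ hu hdoub py k₀ r hr hSc ?_ ?_)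
  · exact interior_mono hball (mem_interior_iff_mem_nhds.mpr
      (Metric.closedBall_mem_nhds y (by positivity)))
  · intro x hx
    have h1 := hVk x
    have h2 := hV0 x ((hSiff x).mp hx).1
    linarith
  · refine ⟨y, hy, ?_⟩
    have := hVk y
    rw [hVy] at this
    linarith

end ContactGap

section ContactSet
open Topology

variable {n : ℕ} {Ω : Set (En n)} {u v : En n → ℝ}

lemma IsStrictConvexPt.strictContact (hu : ConvexOn ℝ Ω u) {x₀ p : En n} (hx₀ : x₀ ∈ Ω)
    (hs : IsStrictConvexPt Ω u x₀) (hp : p ∈ subgrad Ω u x₀) : StrictContact Ω u x₀ p := by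
  refine ⟨hx₀, hp, fun x hx hne => lt_of_le_of_ne (hp x hx) fun h => ?_⟩
  have h1 := hs x hx hne
  have h2 : (1 / 2 : ℝ) • (x + x₀) ∈ Ω := by
    rw [smul_add]
    exact hu.1 hx hx₀ (by norm_num) (by norm_num) (by norm_num)
  have h3 := hp _ h2
  have h4 : (1 / 2 : ℝ) • (x + x₀) - x₀ = (1 / 2 : ℝ) • (x - x₀) := by module
  rw [h4, real_inner_smul_right] at h3
  linarith

/-- Above a strict contact point `x₀`, every nearby point has a supporting plane for which the
minimum of the gap over a set containing `x₀` is attained in the interior of a fixed ball. -/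
lemma exists_interior_min_gap (hΩ : IsOpen Ω) (hu : ConvexOn ℝ Ω u) {D : ℝ≥0∞} (hD : D ≠ ⊤)
    (hdoub : IsDoublingOn Ω (MAm Ω u) D) {x₀ p₀ : En n} (h : StrictContact Ω u x₀ p₀) {ρ : ℝ}
    (hρ : 0 < ρ) (hρΩ : Metric.closedBall x₀ ρ ⊆ Ω) :
    ∀ᶠ z in 𝓝 x₀, ∀ q ∈ subgrad Ω u z, ∀ K : Set (En n), x₀ ∈ K →
      IsCompact (K ∩ Metric.closedBall x₀ ρ) → ∃ y ∈ K ∩ Metric.ball x₀ ρ,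
        ∀ x ∈ K ∩ Metric.closedBall x₀ ρ,
          u y - (u z + ⟪q, y - z⟫) ≤ u x - (u z + ⟪q, x - z⟫) := by
  obtain ⟨m, hm, hgap⟩ := h.exists_gap hΩ hu hρ hρΩ
  have h1 := eventually_subgrad_dist_lt hΩ hu h.1 (h.subgrad_subset hΩ hu hD hdoub)
    (ε := m / (8 * ρ)) (by positivity)
  have hcont := (hu.continuousOn hΩ).continuousAt (hΩ.mem_nhds h.1)
  have h2 : ∀ᶠ z in 𝓝 x₀, u z - ⟪p₀, z⟫ < u x₀ - ⟪p₀, x₀⟫ + m / 4 :=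
    (hcont.sub (by fun_prop)).eventually_lt continuousAt_const (by simp only [Pi.sub_apply]; linarith)
  filter_upwards [h1, h2, Metric.ball_mem_nhds x₀ hρ] with z hz1 hz2 hzρ q hq K hxK hKc
  have hKΩ : K ∩ Metric.closedBall x₀ ρ ⊆ Ω := inter_subset_right.trans hρΩ
  obtain ⟨y, hy, hmin⟩ := hKc.exists_isMinOn ⟨x₀, hxK, Metric.mem_closedBall_self hρ.le⟩
    (f := fun x => u x - (u z + ⟪q, x - z⟫))
    (((hu.continuousOn hΩ).mono hKΩ).sub (by fun_prop))
  have hin : ∀ x ∈ Metric.closedBall x₀ ρ, |⟪q - p₀, x - z⟫| ≤ m / 4 := by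
    intro x hx
    have h3 : ‖q - p₀‖ ≤ m / (8 * ρ) := by rw [← dist_eq_norm]; exact (hz1 q hq).le
    have h4 : ‖x - z‖ ≤ 2 * ρ := by
      rw [← dist_eq_norm]
      linarith [dist_triangle_right x z x₀, Metric.mem_closedBall.mp hx, Metric.mem_ball.mp hzρ]
    calc |⟪q - p₀, x - z⟫| ≤ ‖q - p₀‖ * ‖x - z‖ := abs_real_inner_le_norm _ _
      _ ≤ m / (8 * ρ) * (2 * ρ) := by gcongr
      _ = m / 4 := by field_simp; norm_num
  refine ⟨y, ⟨hy.1, ?_⟩, fun x hx => hmin hx⟩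
  rw [Metric.mem_ball]
  refine lt_of_le_of_ne hy.2 fun hys => ?_
  have h5 := hgap y hys
  have h6 := (abs_le.mp (hin y hy.2)).2
  have h7 := (abs_le.mp (hin x₀ (Metric.mem_closedBall_self hρ.le))).1
  have h8 := h.2.1 z (hρΩ (Metric.ball_subset_closedBall hzρ))
  have h9 : u y - (u z + ⟪q, y - z⟫) ≤ u x₀ - (u z + ⟪q, x₀ - z⟫) :=
    hmin (show x₀ ∈ K ∩ Metric.closedBall x₀ ρ from ⟨hxK, Metric.mem_closedBall_self hρ.le⟩)
  simp only [inner_sub_left, inner_sub_right] at h5 h6 h7 h8 h9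
  linarith

/-- Two ordered solutions that agree at a strict contact point agree nearby. -/
lemma eventually_eq_of_strictContact (hΩ : IsOpen Ω) (hu : ConvexOn ℝ Ω u) (hv : ConvexOn ℝ Ω v)
    (huv : ∀ x ∈ Ω, v x ≤ u x) {f : En n → ℝ} (hf : ∀ x ∈ Ω, 0 ≤ f x) {F G : En n × ℝ → ℝ}
    {lam Lam : ℝ} (hlam : 0 < lam) (hFb : ∀ p : En n × ℝ, lam ≤ F p ∧ F p ≤ Lam)
    (hGb : ∀ p : En n × ℝ, lam ≤ G p ∧ G p ≤ Lam) (hF : LocallyLipschitz F)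
    (hG : LocallyLipschitz G) (hMu : IsGenSol Ω f F G u) (hMv : IsGenSol Ω f F G v)
    {D : ℝ≥0∞} (hD : D ≠ ⊤) (hdoub : IsDoublingOn Ω (MAm Ω u) D) {x₀ p₀ : En n}
    (h₀ : u x₀ = v x₀) (h : StrictContact Ω u x₀ p₀) : ∀ᶠ z in 𝓝 x₀, u z = v z := by
  obtain ⟨ρ, hρ, hρall⟩ := Metric.nhds_basis_closedBall.mem_iff.mp
    ((h.eventually hΩ hu hD hdoub).and (hΩ.mem_nhds h.1))
  have hρΩ : Metric.closedBall x₀ ρ ⊆ Ω := fun x hx => (hρall hx).2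
  have hcu := (hu.continuousOn hΩ).mono hρΩ
  have hcv := (hv.continuousOn hΩ).mono hρΩ
  set K : Set (En n) := {x | u x = v x} with hK
  have hKc : IsCompact (K ∩ Metric.closedBall x₀ ρ) := by
    refine (isCompact_closedBall x₀ ρ).of_isClosed_subset ?_ inter_subset_right
    have h1 := (hcu.sub hcv).preimage_isClosed_of_isClosed Metric.isClosed_closedBall
      (isClosed_singleton (x := (0 : ℝ)))
    convert h1 using 1
    ext x
    simp only [hK, mem_inter_iff, mem_ofPred_eq, mem_preimage, Pi.sub_apply, mem_singleton_iff,
      sub_eq_zero]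
    tauto
  filter_upwards [exists_interior_min_gap hΩ hu hD hdoub h hρ hρΩ, Metric.closedBall_mem_nhds x₀ hρ]
    with z hz hzρ
  by_contra hne
  obtain ⟨q, hq⟩ := subgrad_nonempty hΩ hu (hρΩ hzρ)
  have hzs := (hρall hzρ).1 q hq
  obtain ⟨y, ⟨hyK, hyb⟩, hmin⟩ := hz q hq K h₀ hKc
  have hycb := Metric.ball_subset_closedBall hyb
  have hyΩ := hρΩ hycb
  have hyz : y ≠ z := fun h => hne (h ▸ hyK)
  obtain ⟨py, hpy⟩ := subgrad_nonempty hΩ hu hyΩ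
  obtain ⟨r, hr, hrb⟩ := Metric.nhds_basis_closedBall.mem_iff.mp (Metric.isOpen_ball.mem_nhds hyb)
  have hrcb := hrb.trans Metric.ball_subset_closedBall
  refine false_of_contact_gap hΩ hu hv huv hf hlam hFb hGb hF hG hMu hMv hD hdoub hyΩ hyK hpy hr
    (hrcb.trans hρΩ) (fun x hx => (hρall (hrcb hx)).1) (p := py - q) ?_ ?_
  · intro h0
    obtain rfl := sub_eq_zero.mp h0
    have h1 := hzs.2.2 y hyΩ hyz
    have h2 := hpy z (hρΩ hzρ)
    simp only [inner_sub_right] at h1 h2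
    linarith
  · intro x hx hxK
    have h1 := hmin x ⟨hxK, hrcb hx⟩
    simp only [inner_sub_left, inner_sub_right] at h1 ⊢
    linarith

lemma exists_strictContact_of_notMem (hΩ : IsOpen Ω) (hu : ConvexOn ℝ Ω u) (hv : ConvexOn ℝ Ω v)
    (huv : ∀ x ∈ Ω, v x ≤ u x) {x₀ : En n} (h₀ : u x₀ = v x₀)
    (hx₀ : x₀ ∈ Ω \ (SigmaSet Ω u ∩ SigmaSet Ω v)) : ∃ p, StrictContact Ω u x₀ p := by
  obtain ⟨p, hp⟩ := subgrad_nonempty hΩ hv hx₀.1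
  have hpu : p ∈ subgrad Ω u x₀ := fun x hx => by
    rw [h₀]; exact (hp x hx).trans (huv x hx)
  refine ⟨p, ?_⟩
  by_cases hs : IsStrictConvexPt Ω u x₀
  · exact hs.strictContact hu hx₀.1 hpu
  · have hsv : IsStrictConvexPt Ω v x₀ := by
      by_contra hsv
      exact hx₀.2 ⟨⟨hx₀.1, hs⟩, ⟨hx₀.1, hsv⟩⟩
    refine ⟨hx₀.1, hpu, fun x hx hne => ?_⟩
    rw [h₀]
    exact ((hsv.strictContact hv hx₀.1 hp).2.2 x hx hne).trans_le (huv x hx)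

end ContactSet

/-- Theorem 1.7 (Theorem `thm:smp dege 1`): the strong maximum principle for degenerate
Monge–Ampère equations whose right-hand side is comparable to a finite sum of powers of
absolute values of polynomials, on each connected component of `Ω \ (Σ_u ∩ Σ_v)`. -/
theorem statement_5 {n : ℕ} (Ω : Set (En n)) (hΩo : IsOpen Ω) (hΩc : IsConnected Ω)
    (f : En n → ℝ) (hfm : Measurable f)
    (F G : En n × ℝ → ℝ)
    (lam Lam : ℝ) (hlam : 0 < lam) (hLam : lam ≤ Lam)
    (hFb : ∀ p : En n × ℝ, lam ≤ F p ∧ F p ≤ Lam)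
    (hGb : ∀ p : En n × ℝ, lam ≤ G p ∧ G p ≤ Lam)
    (hFlip : LocallyLipschitz F) (hGlip : LocallyLipschitz G)
    (m : ℕ) (P : Fin m → MvPolynomial (Fin n) ℝ) (α : Fin m → ℝ) (hα : ∀ i, 0 ≤ α i)
    (hfb : ∀ x ∈ Ω,
      lam * (∑ i, |MvPolynomial.eval (fun j => x j) (P i)| ^ (α i)) ≤ f x ∧
      f x ≤ Lam * (∑ i, |MvPolynomial.eval (fun j => x j) (P i)| ^ (α i)))
    (u v : En n → ℝ) (hu : ConvexOn ℝ Ω u) (hv : ConvexOn ℝ Ω v)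
    (huv : ∀ x ∈ Ω, v x ≤ u x)
    (hMu : IsGenSol Ω f F G u) (hMv : IsGenSol Ω f F G v) :
    ∀ x ∈ Ω \ (SigmaSet Ω u ∩ SigmaSet Ω v),
      (∀ y ∈ connectedComponentIn (Ω \ (SigmaSet Ω u ∩ SigmaSet Ω v)) x, u y = v y) ∨
      (∀ y ∈ connectedComponentIn (Ω \ (SigmaSet Ω u ∩ SigmaSet Ω v)) x, v y < u y) := by
  intro x hx
  set E : Set (En n) := Ω \ (SigmaSet Ω u ∩ SigmaSet Ω v) with hE
  set C : Set (En n) := connectedComponentIn E x with hC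
  have hCE : C ⊆ E := connectedComponentIn_subset _ _
  have hCΩ : C ⊆ Ω := fun y hy => (hCE hy).1
  have hf : ∀ x ∈ Ω, 0 ≤ f x := fun x hx =>
    (mul_nonneg hlam.le (Finset.sum_nonneg fun i _ => by positivity)).trans (hfb x hx).1
  obtain ⟨D, hD, hdoub⟩ := isGenSol_doubling hlam hFb hGb P α hα hfb hMu
  have heq : ∀ y ∈ C, u y = v y → y ∈ interior {z | u z = v z} := fun y hy hyuv => by
    obtain ⟨p, hp⟩ := exists_strictContact_of_notMem hΩo hu hv huv hyuv (hCE hy)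
    exact mem_interior_iff_mem_nhds.mpr (eventually_eq_of_strictContact hΩo hu hv huv hf hlam hFb hGb
      hFlip hGlip hMu hMv hD hdoub hyuv hp)
  have hne : IsOpen {z ∈ Ω | v z < u z} := by
    have h1 := ((hu.continuousOn hΩo).sub (hv.continuousOn hΩo)).isOpen_inter_preimage hΩo
      (isOpen_Ioi (a := (0 : ℝ)))
    have h2 : {z ∈ Ω | v z < u z} = Ω ∩ (u - v) ⁻¹' Ioi 0 := by
      ext z
      simp only [mem_ofPred_eq, mem_inter_iff, mem_preimage, Pi.sub_apply, mem_Ioi, sub_pos]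
    rw [h2]
    exact h1
  rcases isPreconnected_connectedComponentIn.subset_or_subset isOpen_interior hne
    (disjoint_left.mpr fun z hz hz' => hz'.2.ne' (show z ∈ {z | u z = v z} from interior_subset hz)) (fun y hy => by
      by_cases h : u y = v y
      · exact Or.inl (heq y hy h)
      · exact Or.inr ⟨hCΩ hy, lt_of_le_of_ne (huv y (hCΩ hy)) (Ne.symm h)⟩) with h | h
  · exact Or.inl fun y hy => show y ∈ {z | u z = v z} from interior_subset (h hy)
  · exact Or.inr fun y hy => (h hy).2
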